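/- Let (Ω̄,ν,σ) be a tiling system with shapes S_1,…,S_m, let Ω = Λ^G, let η be a lift of ν on Ω̄ × Ω with conditional tile distributions D_1,…,D_m, and let η̄ be the lift of ν with the same conditional distributions and conditionally independent tiles. If the system (Ω̄,ν,σ) is Bernoulli, then the system (Ω̄ × Ω, η̄, σ×σ) is also Bernoulli. -/

import Mathlib

open MeasureTheory Filter
open scoped ENNReal symmDiff Pointwise Classical

noncomputable section

/-- The shift action of a group `G` on `Λ^G` : `(gShift g ω) h = ω (h * g)`. -/
def gShift {G Λ : Type} [Group G] (g : G) (ω : G → Λ) : G → Λ := fun h => ω (h * g)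

/-- The shift on `ℤ`-indexed sequences: `(zShift k x) n = x (n + k)`. -/
def zShift {A : Type} (k : ℤ) (x : ℤ → A) : ℤ → A := fun n => x (n + k)

/-- Invariance of a measure on `Λ^G` under the `G`-shift. -/
def ShiftInvariant {G Λ : Type} [Group G] [MeasurableSpace Λ]
    (μ : Measure (G → Λ)) : Prop :=
  ∀ g : G, Measure.map (gShift g) μ = μ

/-- A finite set `F ⊆ G` is `(K,γ)`-invariant if `|KF ∆ F| < γ·|F|`. -/
def KInv {G : Type} [Group G] [DecidableEq G] (K : Finset G) (γ : ℝ) (F : Finset G) : Prop :=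
  (((K * F) ∆ F).card : ℝ) < γ * (F.card : ℝ)

/-- A Følner sequence in a countable group `G`: a sequence of nonempty finite sets that is
eventually `(K,γ)`-invariant for every finite `K` and `γ > 0`. -/
def IsFolnerSeq {G : Type} [Group G] [DecidableEq G] (Fs : ℕ → Finset G) : Prop :=
  (∀ n, (Fs n).Nonempty) ∧ ∀ (K : Finset G) (γ : ℝ), 0 < γ → ∀ᶠ n in atTop, KInv K γ (Fs n)

/-- Shannon entropy of the partition of `Λ^G` into cylinders over a finite set `F`. -/
def blockEnt {G Λ : Type} [Group G] [DecidableEq G] [Fintype Λ] [MeasurableSpace Λ]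
    (μ : Measure (G → Λ)) (F : Finset G) : ℝ :=
  ∑ α : { g // g ∈ F } → Λ,
    Real.negMulLog (μ {ω : G → Λ | ∀ g : { g // g ∈ F }, ω (g : G) = α g}).toReal

/-- Kolmogorov–Sinai entropy of a shift-invariant measure on `Λ^G`, computed by averaging the
Shannon entropies of block partitions along a (Følner) sequence `Fs`. -/
def entAlong {G Λ : Type} [Group G] [DecidableEq G] [Fintype Λ] [MeasurableSpace Λ]
    (Fs : ℕ → Finset G) (μ : Measure (G → Λ)) : ℝ :=
  limsup (fun n => blockEnt μ (Fs n) / ((Fs n).card : ℝ)) atTop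

/-- Conditional Shannon entropy of the `Λ`-block partition over `F` given the `Λ₁`-block
partition over `F` pulled back through the factor map `π`. -/
def condBlockEnt {G Λ Λ₁ : Type} [Group G] [DecidableEq G]
    [Fintype Λ] [MeasurableSpace Λ] [Fintype Λ₁] [MeasurableSpace Λ₁]
    (μ : Measure (G → Λ)) (π : (G → Λ) → (G → Λ₁)) (F : Finset G) : ℝ :=
  (∑ q : ({ g // g ∈ F } → Λ) × ({ g // g ∈ F } → Λ₁),
    Real.negMulLog (μ {ω : G → Λ |
      (∀ g : { g // g ∈ F }, ω (g : G) = q.1 g) ∧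
      (∀ g : { g // g ∈ F }, π ω (g : G) = q.2 g)}).toReal)
  - ∑ β : { g // g ∈ F } → Λ₁,
      Real.negMulLog (μ {ω : G → Λ | ∀ g : { g // g ∈ F }, π ω (g : G) = β g}).toReal

/-- Conditional (relative) Kolmogorov–Sinai entropy `h(μ | Ω₁)` of a shift-invariant measure on
`Λ^G` over the factor `π : Λ^G → Λ₁^G`, computed along the sequence `Fs`. -/
def condEntAlong {G Λ Λ₁ : Type} [Group G] [DecidableEq G]
    [Fintype Λ] [MeasurableSpace Λ] [Fintype Λ₁] [MeasurableSpace Λ₁]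
    (Fs : ℕ → Finset G) (μ : Measure (G → Λ)) (π : (G → Λ) → (G → Λ₁)) : ℝ :=
  limsup (fun n => condBlockEnt μ π (Fs n) / ((Fs n).card : ℝ)) atTop

/-- `ν` is the i.i.d. (product) measure on `Δ^G` with one-coordinate distribution `p`. -/
def IsIIDG {G Δ : Type} [Group G] [MeasurableSpace Δ]
    (ν : Measure (G → Δ)) (p : Δ → ℝ≥0∞) : Prop :=
  ∀ (F : Finset G) (α : { g // g ∈ F } → Δ),
    ν {ω : G → Δ | ∀ g : { g // g ∈ F }, ω (g : G) = α g} = ∏ g : { g // g ∈ F }, p (α g)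

/-- A measure-theoretic isomorphism between two measure-preserving `G`-systems. -/
def IsMeasIsoG {G Y Z : Type} [Group G] [MeasurableSpace Y] [MeasurableSpace Z]
    (μ : Measure Y) (ν : Measure Z) (S : G → Y → Y) (T : G → Z → Z) : Prop :=
  ∃ (f : Y → Z) (f' : Z → Y), Measurable f ∧ Measurable f' ∧
    Measure.map f μ = ν ∧ Measure.map f' ν = μ ∧
    (∀ g : G, ∀ᵐ y ∂μ, f (S g y) = T g (f y)) ∧
    (∀ᵐ y ∂μ, f' (f y) = y) ∧ (∀ᵐ z ∂ν, f (f' z) = z)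

/-- A measure-preserving `G`-system is Bernoulli if it is measure-theoretically isomorphic to an
i.i.d. `G`-process (over a finite alphabet). -/
def IsBernoulliG {G Y : Type} [Group G] [MeasurableSpace Y]
    (μ : Measure Y) (S : G → Y → Y) : Prop :=
  ∃ (n : ℕ) (p : Fin n → ℝ≥0∞) (ν : Measure (G → Fin n)),
    (∑ i, p i) = 1 ∧ IsIIDG ν p ∧ IsMeasIsoG μ ν S gShift

/-- A measure-preserving `G`-system `(Y,μ,τY)` is Bernoulli relative to a factor
`(B,νB,τB)` along the factor map `proj` if it is isomorphic, by an isomorphism whose first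
coordinate is `proj`, to the direct product of the factor with an i.i.d. `G`-process. -/
def IsRelBernoulliG {G Y B : Type} [Group G] [MeasurableSpace Y] [MeasurableSpace B]
    (μ : Measure Y) (τY : G → Y → Y) (νB : Measure B) (τB : G → B → B) (proj : Y → B) : Prop :=
  ∃ (n : ℕ) (p : Fin n → ℝ≥0∞) (ν : Measure (G → Fin n)),
    (∑ i, p i) = 1 ∧ IsIIDG ν p ∧
    ∃ (f : Y → B × (G → Fin n)) (f' : B × (G → Fin n) → Y),
      Measurable f ∧ Measurable f' ∧
      Measure.map f μ = νB.prod ν ∧ Measure.map f' (νB.prod ν) = μ ∧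
      (∀ g : G, ∀ᵐ y ∂μ, f (τY g y) = (τB g (f y).1, gShift g (f y).2)) ∧
      (∀ᵐ y ∂μ, f' (f y) = y) ∧ (∀ᵐ z ∂(νB.prod ν), f (f' z) = z) ∧
      (∀ᵐ y ∂μ, (f y).1 = proj y)

/-- Ergodicity of a shift-invariant measure on `Λ^G`. -/
def ErgodicShiftG {G Λ : Type} [Group G] [MeasurableSpace Λ] (μ : Measure (G → Λ)) : Prop :=
  ∀ s : Set (G → Λ), MeasurableSet s → (∀ g : G, gShift g ⁻¹' s = s) → μ s = 0 ∨ μ s = 1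

/-- Freeness of a shift-invariant measure on `Λ^G`. -/
def FreeShift {G Λ : Type} [Group G] [MeasurableSpace Λ] (μ : Measure (G → Λ)) : Prop :=
  ∀ g : G, g ≠ 1 → μ {ω : G → Λ | gShift g ω = ω} = 0

/-- A measurable measure-preserving action of a group `G` on a measure space. -/
def IsMPAction {G X : Type} [Group G] [MeasurableSpace X]
    (μ : Measure X) (τ : G → X → X) : Prop :=
  (∀ x, τ 1 x = x) ∧ (∀ g h x, τ (g * h) x = τ g (τ h x)) ∧
  (∀ g, Measurable (τ g)) ∧ (∀ g, Measure.map (τ g) μ = μ)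

/-- Freeness of a measure-preserving action. -/
def IsFreeAction {G X : Type} [Group G] [MeasurableSpace X]
    (μ : Measure X) (τ : G → X → X) : Prop :=
  ∀ g : G, g ≠ 1 → μ {x : X | τ g x = x} = 0

/-- The itinerary (tiling factor map) of a point with respect to the bases `B i`:
`itin τ B x g = some i` iff `τ g x` lies in the base `B i`. -/
def itin {G X : Type} [Group G] {m : ℕ} (τ : G → X → X) (B : Fin m → Set X) (x : X) :
    G → Option (Fin m) :=
  fun g => if h : ∃ i, τ g x ∈ B i then some h.choose else none

/-- Shannon entropy of the length-`n` block partition of `A^ℤ`. -/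
def blockEntZ {A : Type} [Fintype A] [MeasurableSpace A]
    (μ : Measure (ℤ → A)) (n : ℕ) : ℝ :=
  ∑ α : Fin n → A,
    Real.negMulLog (μ {x : ℤ → A | ∀ i : Fin n, x ((i : ℕ) : ℤ) = α i}).toReal

/-- Kolmogorov–Sinai entropy of a shift-invariant measure on `A^ℤ`. -/
def entZ {A : Type} [Fintype A] [MeasurableSpace A] (μ : Measure (ℤ → A)) : ℝ :=
  limsup (fun n => blockEntZ μ n / (n : ℝ)) atTop

/-- `ν` is the i.i.d. (product) measure on `Δ^ℤ` with one-coordinate distribution `p`. -/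
def IsIIDZ {Δ : Type} [MeasurableSpace Δ] (ν : Measure (ℤ → Δ)) (p : Δ → ℝ≥0∞) : Prop :=
  ∀ (F : Finset ℤ) (α : { n // n ∈ F } → Δ),
    ν {x : ℤ → Δ | ∀ n : { n // n ∈ F }, x (n : ℤ) = α n} = ∏ n : { n // n ∈ F }, p (α n)

/-- A measure-theoretic isomorphism between two measure-preserving `ℤ`-systems
(given by single transformations). -/
def IsMeasIsoZ {Y Z : Type} [MeasurableSpace Y] [MeasurableSpace Z]
    (μ : Measure Y) (ν : Measure Z) (S : Y → Y) (T : Z → Z) : Prop :=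
  ∃ (f : Y → Z) (f' : Z → Y), Measurable f ∧ Measurable f' ∧
    Measure.map f μ = ν ∧ Measure.map f' ν = μ ∧
    (∀ᵐ y ∂μ, f (S y) = T (f y)) ∧
    (∀ᵐ y ∂μ, f' (f y) = y) ∧ (∀ᵐ z ∂ν, f (f' z) = z)

/-- A measure-preserving `ℤ`-system is Bernoulli if it is isomorphic to an i.i.d. `ℤ`-process. -/
def IsBernoulliZ {Y : Type} [MeasurableSpace Y] (μ : Measure Y) (S : Y → Y) : Prop :=
  ∃ (n : ℕ) (p : Fin n → ℝ≥0∞) (ν : Measure (ℤ → Fin n)),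
    (∑ i, p i) = 1 ∧ IsIIDZ ν p ∧ IsMeasIsoZ μ ν S (zShift 1)

/-- A measure-preserving `ℤ`-system `(Y,μ,T)` is Bernoulli relative to a factor `(B,νB,TB)`
along the factor map `proj` if it is isomorphic, by an isomorphism whose first coordinate is
`proj`, to the direct product of the factor with an i.i.d. `ℤ`-process. -/
def IsRelBernoulliZ {Y B : Type} [MeasurableSpace Y] [MeasurableSpace B]
    (μ : Measure Y) (T : Y → Y) (νB : Measure B) (TB : B → B) (proj : Y → B) : Prop :=
  ∃ (n : ℕ) (p : Fin n → ℝ≥0∞) (ν : Measure (ℤ → Fin n)),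
    (∑ i, p i) = 1 ∧ IsIIDZ ν p ∧
    ∃ (f : Y → B × (ℤ → Fin n)) (f' : B × (ℤ → Fin n) → Y),
      Measurable f ∧ Measurable f' ∧
      Measure.map f μ = νB.prod ν ∧ Measure.map f' (νB.prod ν) = μ ∧
      (∀ᵐ y ∂μ, f (T y) = (TB (f y).1, zShift 1 (f y).2)) ∧
      (∀ᵐ y ∂μ, f' (f y) = y) ∧ (∀ᵐ z ∂(νB.prod ν), f (f' z) = z) ∧
      (∀ᵐ y ∂μ, (f y).1 = proj y)

/-- The `n`-th power (`n ∈ ℤ`) of an invertible transformation given by `f` and its inverse. -/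
def zIter {Y : Type} (f finv : Y → Y) (n : ℤ) : Y → Y :=
  if 0 ≤ n then f^[n.toNat] else finv^[(-n).toNat]

/-- The `(R, [n₁, n₁+N-1])`-name of a point: the atom of `⋁_{i=n₁}^{n₁+N-1} T^{-i} R`
containing it, where the partition `R` is given by a map into a finite set `W`. -/
def wordOf {Y W : Type} (f finv : Y → Y) (R : Y → W) (n₁ : ℤ) (N : ℕ) (y : Y) : Fin N → W :=
  fun k => R (zIter f finv (n₁ + ((k : ℕ) : ℤ)) y)

/-- The distribution of the partition (given by) `R` conditioned on the set `E`. -/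
def condDist {Y W : Type} [MeasurableSpace Y] (μ : Measure Y) (R : Y → W) (E : Set Y) :
    W → ℝ := fun w => (μ (E ∩ R ⁻¹' {w})).toReal / (μ E).toReal

/-- ℓ¹ distance between two distributions on a finite set. -/
def distL1 {W : Type} [Fintype W] (p q : W → ℝ) : ℝ := ∑ w, |p w - q w|

/-- Normalized Hamming distance between two words of length `N`. -/
def hammDist {W : Type} [DecidableEq W] {N : ℕ} (a b : Fin N → W) : ℝ :=
  ((Finset.univ.filter (fun k => a k ≠ b k)).card : ℝ) / (N : ℝ)

/-- The `d̄`-distance between two distributions on words of length `N`: the infimum over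
couplings of the expected normalized Hamming distance. -/
def dbarN {W : Type} [Fintype W] [DecidableEq W] (N : ℕ) (p q : (Fin N → W) → ℝ) : ℝ :=
  sInf {r : ℝ | ∃ ξ : ((Fin N → W) × (Fin N → W)) → ℝ,
    (∀ pr, 0 ≤ ξ pr) ∧ (∀ a, (∑ b, ξ (a, b)) = p a) ∧ (∀ b, (∑ a, ξ (a, b)) = q b) ∧
    r = ∑ pr : (Fin N → W) × (Fin N → W), ξ pr * hammDist pr.1 pr.2}

/-- The partition `R` is very weakly Bernoulli relative to the partition `Q` for the invertible
transformation given by `f`, `finv`. -/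
def IsVWBrel {Y W V : Type} [MeasurableSpace Y] [Fintype W] [DecidableEq W]
    (μ : Measure Y) (f finv : Y → Y) (R : Y → W) (Q : Y → V) : Prop :=
  ∀ ε : ℝ, 0 < ε → ∃ N k₀ : ℕ, 0 < N ∧ ∀ k : ℕ, k₀ ≤ k →
    ∃ 𝒢 : Set ((Fin k → W) × (Fin (2 * k + 1) → V)),
      (μ {y | (wordOf f finv R (-(k : ℤ)) k y, wordOf f finv Q (-(k : ℤ)) (2 * k + 1) y) ∈ 𝒢}).toReal
        > 1 - ε ∧
      ∀ (a : Fin k → W) (b : Fin (2 * k + 1) → V), (a, b) ∈ 𝒢 →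
        dbarN N
          (condDist μ (wordOf f finv R 0 N)
            {y | wordOf f finv R (-(k : ℤ)) k y = a ∧ wordOf f finv Q (-(k : ℤ)) (2 * k + 1) y = b})
          (condDist μ (wordOf f finv R 0 N)
            {y | wordOf f finv Q (-(k : ℤ)) (2 * k + 1) y = b}) < ε

/-- Shannon entropy of a finite partition given by a map `R : Y → W`. -/
def partEnt {Y W : Type} [MeasurableSpace Y] [Fintype W] (μ : Measure Y) (R : Y → W) : ℝ :=
  ∑ w : W, Real.negMulLog (μ (R ⁻¹' {w})).toReal

/-- Conditional Shannon entropy `H(R | Q)` of finite partitions. -/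
def condEnt {Y W V : Type} [MeasurableSpace Y] [Fintype W] [Fintype V]
    (μ : Measure Y) (R : Y → W) (Q : Y → V) : ℝ :=
  partEnt μ (fun y => (R y, Q y)) - partEnt μ Q

/-- `R₀` is conditionally `ε`-independent of `R₂` given `R₁`. -/
def CondEpsIndep {Y W₀ W₁ W₂ : Type} [MeasurableSpace Y] [Fintype W₀]
    (μ : Measure Y) (R₀ : Y → W₀) (R₁ : Y → W₁) (R₂ : Y → W₂) (ε : ℝ) : Prop :=
  ∃ 𝒞 : Set (W₁ × W₂),
    (μ {y | (R₁ y, R₂ y) ∈ 𝒞}).toReal > 1 - ε ∧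
    ∀ c ∈ 𝒞, distL1 (condDist μ R₀ {y | R₁ y = c.1 ∧ R₂ y = c.2})
      (condDist μ R₀ {y | R₁ y = c.1}) < ε

/-- A family `S` of sets generates the full sigma-algebra modulo `μ`-null sets. -/
def IsGenMod {Y : Type} [MeasurableSpace Y] (μ : Measure Y) (S : Set (Set Y)) : Prop :=
  ∀ s : Set Y, MeasurableSet s →
    ∃ t : Set Y, MeasurableSet[MeasurableSpace.generateFrom S] t ∧ μ (s ∆ t) = 0

noncomputable section

/-- The event (in `Λ^G`) that the tile of shape `S i` centered at `g` (if `g` is marked in `ωb`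
as a center of type `i`) carries the block prescribed by `β g`. -/
def tileEvent {G Λ : Type} [Group G] {m : ℕ} (S : Fin m → Finset G)
    (ωb : G → Fin (m + 1)) (β : G → G → Λ) (g : G) : Set (G → Λ) :=
  {ω | ∀ i : Fin m, ωb g = i.succ → ∀ s ∈ S i, ω (s * g) = β g (s * g)}

/-- The coordinatewise identification `(Λ₀^G) × (Λ^G) ≃ (Λ₀ × Λ)^G`. -/
def pairFun {G Λ₀ Λ : Type} (q : (G → Λ₀) × (G → Λ)) : G → Λ₀ × Λ :=
  fun g => (q.1 g, q.2 g)

end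

set_option linter.unusedSectionVars false

noncomputable section FiniteProbability

/-- The discrete distance. -/
def discrep {α : Type} (x y : α) : ℝ := if x = y then 0 else 1

@[simp] theorem discrep_self {α : Type} (x : α) : discrep x x = 0 := if_pos rfl

theorem discrep_of_ne {α : Type} {x y : α} (h : x ≠ y) : discrep x y = 1 := if_neg h

theorem discrep_nonneg {α : Type} (x y : α) : 0 ≤ discrep x y := by
  unfold discrep; split_ifs <;> norm_num

theorem discrep_le_one {α : Type} (x y : α) : discrep x y ≤ 1 := by
  unfold discrep; split_ifs <;> norm_num

theorem discrep_comm {α : Type} (x y : α) : discrep x y = discrep y x := by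
  simp only [discrep, eq_comm]

theorem discrep_triangle {α : Type} (x y z : α) : discrep x z ≤ discrep x y + discrep y z := by
  by_cases h : x = y
  · simp [h]
  · rw [discrep_of_ne h]; linarith [discrep_nonneg y z, discrep_le_one x z]

/-- Expectation of a product of functions of distinct coordinates. -/
theorem sum_prod_weight {J Ω : Type} [Fintype J] [Fintype Ω] (w : J → Ω → ℝ) :
    ∑ ω : J → Ω, ∏ j, w j (ω j) = ∏ j, ∑ x, w j x := by
  rw [Finset.prod_univ_sum, Fintype.piFinset_univ]

theorem sum_prod_weight_mul_single {J Ω : Type} [Fintype J] [Fintype Ω]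
    (w : J → Ω → ℝ) (hw : ∀ j, ∑ x, w j x = 1) (i : J) (Y : Ω → ℝ) :
    ∑ ω : J → Ω, (∏ j, w j (ω j)) * Y (ω i) = ∑ x, w i x * Y x := by
  have h : ∀ ω : J → Ω, (∏ j, w j (ω j)) * Y (ω i)
      = ∏ j, (w j (ω j) * if j = i then Y (ω j) else 1) := by
    intro ω
    rw [Finset.prod_mul_distrib, Finset.prod_ite_eq' Finset.univ i (fun j => Y (ω j))]
    simp
  simp_rw [h]
  rw [sum_prod_weight (fun j x => w j x * if j = i then Y x else 1)]
  rw [Finset.prod_eq_single i]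
  · simp
  · intro j _ hj
    simp [hj, hw]
  · simp

theorem sum_prod_weight_mul_pair {J Ω : Type} [Fintype J] [Fintype Ω]
    (w : J → Ω → ℝ) (hw : ∀ j, ∑ x, w j x = 1) {i k : J} (hik : i ≠ k) (Y Z : Ω → ℝ) :
    ∑ ω : J → Ω, (∏ j, w j (ω j)) * (Y (ω i) * Z (ω k))
      = (∑ x, w i x * Y x) * ∑ x, w k x * Z x := by
  have h : ∀ ω : J → Ω, (∏ j, w j (ω j)) * (Y (ω i) * Z (ω k))
      = ∏ j, (w j (ω j) * ((if j = i then Y (ω j) else 1) * if j = k then Z (ω j) else 1)) := by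
    intro ω
    rw [Finset.prod_mul_distrib, Finset.prod_mul_distrib,
      Finset.prod_ite_eq' Finset.univ i (fun j => Y (ω j)),
      Finset.prod_ite_eq' Finset.univ k (fun j => Z (ω j))]
    simp
  simp_rw [h]
  rw [sum_prod_weight
    (fun j x => w j x * ((if j = i then Y x else 1) * if j = k then Z x else 1))]
  rw [Finset.prod_eq_mul i k hik]
  · simp [hik, hik.symm]
  · rintro j _ ⟨hj, hj'⟩
    simp [hj, hj', hw]
  · simp
  · simp

/-- Chebyshev's inequality for a sum of independent bounded functions on a finite product. -/
theorem finite_chebyshev {J Ω : Type} [Fintype J] [Fintype Ω]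
    (w : J → Ω → ℝ) (hw0 : ∀ j x, 0 ≤ w j x) (hw : ∀ j, ∑ x, w j x = 1)
    (Y : J → Ω → ℝ) {C : ℝ} (hY : ∀ j x, |Y j x| ≤ C) {s : ℝ} (hs : 0 < s) :
    ∑ ω : J → Ω with s ≤ |∑ j, Y j (ω j) - ∑ j, ∑ x, w j x * Y j x|, ∏ j, w j (ω j)
      ≤ Fintype.card J * (2 * C) ^ 2 / s ^ 2 := by
  set m : J → ℝ := fun j => ∑ x, w j x * Y j x with hm
  have hmC : ∀ j, |m j| ≤ C := by
    intro j
    calc |m j| ≤ ∑ x, |w j x * Y j x| := Finset.abs_sum_le_sum_abs _ _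
      _ ≤ ∑ x, w j x * C := by
          refine Finset.sum_le_sum fun x _ => ?_
          rw [abs_mul, abs_of_nonneg (hw0 j x)]
          exact mul_le_mul_of_nonneg_left (hY j x) (hw0 j x)
      _ = C := by rw [← Finset.sum_mul, hw, one_mul]
  set Z : J → Ω → ℝ := fun j x => Y j x - m j with hZ
  have hZm : ∀ j, ∑ x, w j x * Z j x = 0 := by
    intro j
    simp only [hZ, mul_sub, Finset.sum_sub_distrib, ← Finset.sum_mul, hw, one_mul]
    simp [hm]
  have hZC : ∀ j x, (Z j x) ^ 2 ≤ (2 * C) ^ 2 := by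
    intro j x
    rw [← sq_abs]
    refine pow_le_pow_left₀ (abs_nonneg _) ?_ 2
    calc |Y j x - m j| ≤ |Y j x| + |m j| := abs_sub _ _
      _ ≤ 2 * C := by linarith [hY j x, hmC j]
  have hW0 : ∀ ω : J → Ω, 0 ≤ ∏ j, w j (ω j) := fun ω => Finset.prod_nonneg fun j _ => hw0 j _
  have hsecond : ∑ ω : J → Ω, (∏ j, w j (ω j)) * (∑ j, Z j (ω j)) ^ 2
      ≤ Fintype.card J * (2 * C) ^ 2 := by
    have : ∀ ω : J → Ω, (∏ j, w j (ω j)) * (∑ j, Z j (ω j)) ^ 2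
        = ∑ i, ∑ k, (∏ j, w j (ω j)) * (Z i (ω i) * Z k (ω k)) := by
      intro ω
      rw [sq, Finset.sum_mul_sum, Finset.mul_sum]
      simp_rw [Finset.mul_sum]
    simp_rw [this]
    rw [Finset.sum_comm]
    have hi : ∀ i : J, ∑ ω : J → Ω, ∑ k, (∏ j, w j (ω j)) * (Z i (ω i) * Z k (ω k))
        ≤ (2 * C) ^ 2 := by
      intro i
      rw [Finset.sum_comm, Finset.sum_eq_single i]
      · have := sum_prod_weight_mul_single w hw i (fun x => Z i x * Z i x)
        rw [this]
        calc ∑ x, w i x * (Z i x * Z i x) ≤ ∑ x, w i x * (2 * C) ^ 2 := by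
              refine Finset.sum_le_sum fun x _ => mul_le_mul_of_nonneg_left ?_ (hw0 i x)
              rw [← sq]; exact hZC i x
          _ = (2 * C) ^ 2 := by rw [← Finset.sum_mul, hw, one_mul]
      · intro k _ hk
        rw [sum_prod_weight_mul_pair w hw hk.symm, hZm, zero_mul]
      · simp
    calc _ ≤ ∑ _i : J, (2 * C) ^ 2 := Finset.sum_le_sum fun i _ => hi i
      _ = _ := by simp
  rw [le_div_iff₀ (by positivity), Finset.sum_mul]
  refine le_trans ?_ hsecond
  refine le_trans ?_ (Finset.sum_le_sum_of_subset_of_nonneg (Finset.filter_subset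
    (fun ω : J → Ω => s ≤ |∑ j, Y j (ω j) - ∑ j, m j|) _)
    (fun ω _ _ => mul_nonneg (hW0 ω) (sq_nonneg _)))
  refine Finset.sum_le_sum fun ω hω => mul_le_mul_of_nonneg_left ?_ (hW0 ω)
  have h1 : s ≤ |∑ j, Z j (ω j)| := by
    have := (Finset.mem_filter.mp hω).2
    simpa [hZ, Finset.sum_sub_distrib] using this
  rw [← sq_abs (∑ j, Z j (ω j))]
  exact pow_le_pow_left₀ hs.le h1 2

end FiniteProbability

section SparseCoupling

/-- A matrix with more nonzero entries than nonzero rows and columns carries a nonzero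
perturbation of its entries with vanishing row and column sums. -/
theorem exists_balanced_perturbation {A B : Type} [Fintype A] [Fintype B] (ζ : A → B → ℝ)
    (hcard : Fintype.card {a // ∃ b, ζ a b ≠ 0} + Fintype.card {b // ∃ a, ζ a b ≠ 0}
      < Fintype.card {p : A × B // ζ p.1 p.2 ≠ 0}) :
    ∃ d : A → B → ℝ, (∀ a, ∑ b, d a b = 0) ∧ (∀ b, ∑ a, d a b = 0) ∧
      (∀ a b, ζ a b = 0 → d a b = 0) ∧ ∃ a b, d a b ≠ 0 := by
  let L : (A × B → ℝ) →ₗ[ℝ]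
      (({a // ∃ b, ζ a b ≠ 0} → ℝ) × ({b // ∃ a, ζ a b ≠ 0} → ℝ)) ×
        ({p : A × B // ¬ ζ p.1 p.2 ≠ 0} → ℝ) :=
    { toFun := fun d => ((fun a => ∑ b, d (a.1, b), fun b => ∑ a, d (a, b.1)), fun e => d e.1)
      map_add' := by
        intro x y
        simp only [Pi.add_apply, Finset.sum_add_distrib]
        rfl
      map_smul' := by
        intro r x
        simp only [Pi.smul_apply, ← Finset.smul_sum]
        rfl }
  have hker : LinearMap.ker L ≠ ⊥ := by
    apply LinearMap.ker_ne_bot_of_finrank_lt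
    have := Fintype.card_subtype_compl (fun p : A × B => ζ p.1 p.2 ≠ 0)
    have h2 := Fintype.card_subtype_le (fun p : A × B => ζ p.1 p.2 ≠ 0)
    simp only [Module.finrank_prod, Module.finrank_fintype_fun_eq_card]
    omega
  obtain ⟨d, hd, hd0⟩ := (Submodule.ne_bot_iff _).mp hker
  have hLd : L d = 0 := hd
  have hoff : ∀ a b, ζ a b = 0 → d (a, b) = 0 := fun a b h =>
    congrFun (congrArg Prod.snd hLd) ⟨(a, b), not_not.mpr h⟩
  refine ⟨fun a b => d (a, b), fun a => ?_, fun b => ?_, hoff, ?_⟩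
  · by_cases h : ∃ b, ζ a b ≠ 0
    · exact congrFun (congrArg (fun q => q.1.1) hLd) ⟨a, h⟩
    · push Not at h
      exact Finset.sum_eq_zero fun b _ => hoff a b (h b)
  · by_cases h : ∃ a, ζ a b ≠ 0
    · exact congrFun (congrArg (fun q => q.1.2) hLd) ⟨b, h⟩
    · push Not at h
      exact Finset.sum_eq_zero fun a _ => hoff a b (h a)
  · by_contra! hne
    exact hd0 (funext fun p => hne p.1 p.2)

/-- A nonnegative matrix with more nonzero entries than nonzero rows and columns can be modified,
keeping its row and column sums, so that an entry of the support disappears. -/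
theorem exists_smaller_support {A B : Type} [Fintype A] [Fintype B] (ζ : A → B → ℝ)
    (h0 : ∀ a b, 0 ≤ ζ a b)
    (hcard : Fintype.card {a // ∃ b, ζ a b ≠ 0} + Fintype.card {b // ∃ a, ζ a b ≠ 0}
      < Fintype.card {p : A × B // ζ p.1 p.2 ≠ 0}) :
    ∃ ζ' : A → B → ℝ, (∀ a b, 0 ≤ ζ' a b) ∧ (∀ a, ∑ b, ζ' a b = ∑ b, ζ a b) ∧
      (∀ b, ∑ a, ζ' a b = ∑ a, ζ a b) ∧ (∀ a b, ζ' a b ≠ 0 → ζ a b ≠ 0) ∧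
      Fintype.card {p : A × B // ζ' p.1 p.2 ≠ 0}
        < Fintype.card {p : A × B // ζ p.1 p.2 ≠ 0} := by
  obtain ⟨d, hrow, hcol, hoff, a₀, b₀, hab⟩ := exists_balanced_perturbation ζ hcard
  obtain ⟨b₁, hb₁⟩ : ∃ b₁, d a₀ b₁ < 0 := by
    by_contra! hn
    exact hab ((Finset.sum_eq_zero_iff_of_nonneg fun b _ => hn b).mp (hrow a₀) b₀
      (Finset.mem_univ _))
  obtain ⟨q, hq, hqmin⟩ := Finset.exists_min_image
    (Finset.univ.filter fun p : A × B => d p.1 p.2 < 0) (fun p => ζ p.1 p.2 / (-d p.1 p.2))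
    ⟨(a₀, b₁), by simpa using hb₁⟩
  have hqd : d q.1 q.2 < 0 := by simpa using hq
  set t := ζ q.1 q.2 / (-d q.1 q.2) with ht
  have ht0 : 0 ≤ t := div_nonneg (h0 _ _) (by linarith)
  have hvan : ζ q.1 q.2 + t * d q.1 q.2 = 0 := by
    rw [ht]; field_simp [hqd.ne]; ring
  have hsub : ∀ a b, ζ a b + t * d a b ≠ 0 → ζ a b ≠ 0 := by
    intro a b h h'
    exact h (by rw [hoff a b h', h']; ring)
  refine ⟨fun a b => ζ a b + t * d a b, fun a b => ?_, fun a => ?_, fun b => ?_, hsub, ?_⟩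
  · rcases lt_or_ge (d a b) 0 with h | h
    · have := hqmin (a, b) (by simpa using h)
      have h1 : t ≤ ζ a b / (-d a b) := this
      rw [le_div_iff₀ (by linarith)] at h1
      linarith
    · exact add_nonneg (h0 a b) (mul_nonneg ht0 h)
  · rw [Finset.sum_add_distrib, ← Finset.mul_sum, hrow]; ring
  · rw [Finset.sum_add_distrib, ← Finset.mul_sum, hcol]; ring
  · rw [Fintype.card_subtype, Fintype.card_subtype]
    apply Finset.card_lt_card
    rw [Finset.ssubset_iff_of_subset]
    · refine ⟨q, ?_, by simpa using hvan⟩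
      have : ζ q.1 q.2 ≠ 0 := fun h => hqd.ne (hoff _ _ h)
      simpa using this
    · intro p hp
      simp only [Finset.mem_filter, Finset.mem_univ, true_and] at hp ⊢
      exact hsub _ _ hp

/-- Every nonnegative matrix can be modified, keeping its row and column sums and without
enlarging its support, so that outside one selected entry per row there are at most as many
nonzero entries as there were nonzero columns. -/
theorem exists_sparse_matrix {A B : Type} [Fintype A] [Fintype B] (ζ : A → B → ℝ)
    (h0 : ∀ a b, 0 ≤ ζ a b) :
    ∃ ζ' : A → B → ℝ, (∀ a b, 0 ≤ ζ' a b) ∧ (∀ a, ∑ b, ζ' a b = ∑ b, ζ a b) ∧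
      (∀ b, ∑ a, ζ' a b = ∑ a, ζ a b) ∧ (∀ a b, ζ' a b ≠ 0 → ζ a b ≠ 0) ∧
      Fintype.card {p : A × B // ζ' p.1 p.2 ≠ 0} ≤
        Fintype.card {a // ∃ b, ζ' a b ≠ 0} + Fintype.card {b // ∃ a, ζ' a b ≠ 0} := by
  induction hn : Fintype.card {p : A × B // ζ p.1 p.2 ≠ 0} using Nat.strong_induction_on
    generalizing ζ with
  | _ n ih =>
    by_cases h : Fintype.card {p : A × B // ζ p.1 p.2 ≠ 0} ≤
        Fintype.card {a // ∃ b, ζ a b ≠ 0} + Fintype.card {b // ∃ a, ζ a b ≠ 0}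
    · exact ⟨ζ, h0, fun _ => rfl, fun _ => rfl, fun _ _ => id, h⟩
    · obtain ⟨ζ₁, p0, pr, pc, ps, plt⟩ := exists_smaller_support ζ h0 (not_le.mp h)
      obtain ⟨ζ₂, q0, qr, qc, qs, q⟩ := ih _ (hn ▸ plt) ζ₁ p0 rfl
      exact ⟨ζ₂, q0, fun a => (qr a).trans (pr a), fun b => (qc b).trans (pc b),
        fun a b hh => ps a b (qs a b hh), q⟩

/-- Sparse couplings: keeping marginals and, up to the map `T`, the support, the second
coordinate seen through `T` can be made a function of the first one up to an error controlled by
the number of reached values of `T` times the largest row sum. -/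
theorem exists_sparse_coupling {A B B₀ : Type} [Fintype A] [Fintype B] [Fintype B₀] [Nonempty B₀]
    (T : B → B₀) (ξ : A → B → ℝ) (h0 : ∀ a b, 0 ≤ ξ a b) {ρ : ℝ} (hρ : ∀ a, ∑ b, ξ a b ≤ ρ)
    (hρ0 : 0 ≤ ρ) :
    ∃ (ξ' : A → B → ℝ) (φ : A → B₀), (∀ a b, 0 ≤ ξ' a b) ∧ (∀ a, ∑ b, ξ' a b = ∑ b, ξ a b) ∧
      (∀ b, ∑ a, ξ' a b = ∑ a, ξ a b) ∧
      (∀ a b, ξ' a b ≠ 0 → ∃ b', T b' = T b ∧ ξ a b' ≠ 0) ∧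
      ∑ a, ∑ b, ξ' a b * (if T b = φ a then 0 else 1)
        ≤ Nat.card {b₀ // ∃ a b, T b = b₀ ∧ ξ a b ≠ 0} * ρ := by
  rw [Nat.card_eq_fintype_card]
  set ζ : A → B₀ → ℝ := fun a b₀ => ∑ b with T b = b₀, ξ a b with hζ
  have hζ0 : ∀ a b₀, 0 ≤ ζ a b₀ := fun a b₀ => Finset.sum_nonneg fun b _ => h0 a b
  obtain ⟨ζ', z0, zr, zc, zs, zcard⟩ := exists_sparse_matrix ζ hζ0
  have hζrow : ∀ a, ∑ b₀, ζ a b₀ = ∑ b, ξ a b := fun a =>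
    Finset.sum_fiberwise Finset.univ T (fun b => ξ a b)
  have hex : ∀ a, ∃ b₀ : B₀, (∃ b, ζ' a b ≠ 0) → ζ' a b₀ ≠ 0 := by
    intro a
    by_cases h : ∃ b, ζ' a b ≠ 0
    · exact ⟨h.choose, fun _ => h.choose_spec⟩
    · exact ⟨Classical.arbitrary _, fun h' => absurd h' h⟩
  choose φ hφ using hex
  set M : B → ℝ := fun b => ∑ a, ξ a b with hM
  set M₀ : B₀ → ℝ := fun b₀ => ∑ a, ζ a b₀ with hM₀
  have hM0 : ∀ b, 0 ≤ M b := fun b => Finset.sum_nonneg fun a _ => h0 a b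
  have hMM : ∀ b₀, ∑ b with T b = b₀, M b = M₀ b₀ := by
    intro b₀
    rw [hM₀]
    simp only [hM, hζ]
    rw [Finset.sum_comm]
  have hfib : ∀ a b₀, ∑ b with T b = b₀, ζ' a (T b) * (M b / M₀ (T b)) = ζ' a b₀ := by
    intro a b₀
    have : ∑ b with T b = b₀, ζ' a (T b) * (M b / M₀ (T b))
        = ∑ b with T b = b₀, (ζ' a b₀ / M₀ b₀) * M b := by
      refine Finset.sum_congr rfl fun b hb => ?_
      rw [(Finset.mem_filter.mp hb).2]; ring
    rw [this, ← Finset.mul_sum, hMM]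
    by_cases hz : M₀ b₀ = 0
    · have h1 : ∑ a, ζ' a b₀ = 0 := (zc b₀).trans hz
      have := (Finset.sum_eq_zero_iff_of_nonneg fun a _ => z0 a b₀).mp h1 a (Finset.mem_univ _)
      rw [this]; simp
    · field_simp
  refine ⟨fun a b => ζ' a (T b) * (M b / M₀ (T b)), φ, fun a b => ?_, fun a => ?_, fun b => ?_,
    fun a b h => ?_, ?_⟩
  · exact mul_nonneg (z0 _ _) (div_nonneg (hM0 b) (Finset.sum_nonneg fun a _ => hζ0 a _))
  · rw [← hζrow, ← zr, ← Finset.sum_fiberwise Finset.univ T]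
    exact Finset.sum_congr rfl fun b₀ _ => hfib a b₀
  · rw [← Finset.sum_mul, zc]
    change M₀ (T b) * (M b / M₀ (T b)) = M b
    by_cases hz : M₀ (T b) = 0
    · have h1 : ∑ b' with T b' = T b, M b' = 0 := (hMM _).trans hz
      have := (Finset.sum_eq_zero_iff_of_nonneg fun b _ => hM0 b).mp h1 b (by simp)
      rw [this]; simp
    · field_simp
  · have h1 : ζ a (T b) ≠ 0 := zs _ _ (left_ne_zero_of_mul h)
    obtain ⟨b', hb', hne⟩ := Finset.exists_ne_zero_of_sum_ne_zero h1
    exact ⟨b', (Finset.mem_filter.mp hb').2, hne⟩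
  · have e1 : ∀ a, ∑ b, ζ' a (T b) * (M b / M₀ (T b)) * (if T b = φ a then 0 else 1)
        = ∑ b₀, ζ' a b₀ * (if b₀ = φ a then 0 else 1) := by
      intro a
      rw [← Finset.sum_fiberwise Finset.univ T]
      refine Finset.sum_congr rfl fun b₀ _ => ?_
      rw [← hfib a b₀, Finset.sum_mul]
      refine Finset.sum_congr rfl fun b hb => ?_
      rw [(Finset.mem_filter.mp hb).2]
    simp_rw [e1]
    have hle : ∀ a b₀, ζ' a b₀ ≤ ρ := fun a b₀ =>
      (Finset.single_le_sum (fun b _ => z0 a b) (Finset.mem_univ b₀)).trans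
        ((zr a).le.trans ((hζrow a).le.trans (hρ a)))
    set E := Finset.univ.filter fun p : A × B₀ => ζ' p.1 p.2 ≠ 0 with hE
    set E₁ := Finset.univ.filter fun p : A × B₀ => ζ' p.1 p.2 ≠ 0 ∧ p.2 = φ p.1 with hE₁
    set E₂ := Finset.univ.filter fun p : A × B₀ => ζ' p.1 p.2 ≠ 0 ∧ p.2 ≠ φ p.1 with hE₂
    have hEE : E.card = E₁.card + E₂.card := by
      rw [hE₁, hE₂, ← Finset.filter_filter, ← Finset.filter_filter,
        Finset.card_filter_add_card_filter_not]
    have hE₁card : Fintype.card {a // ∃ b, ζ' a b ≠ 0} = E₁.card := by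
      rw [Fintype.card_subtype]
      refine Finset.card_bij (fun a _ => (a, φ a)) ?_ ?_ ?_
      · intro a ha
        simp only [Finset.mem_filter, Finset.mem_univ, true_and] at ha
        simp [hE₁, hφ a ha]
      · intro a _ a' _ h
        exact congrArg Prod.fst h
      · rintro ⟨a, b⟩ hp
        simp only [hE₁, Finset.mem_filter, Finset.mem_univ, true_and] at hp
        exact ⟨a, by simpa using ⟨b, hp.1⟩, by rw [hp.2]⟩
    have hE₂card : E₂.card ≤ Fintype.card {b₀ // ∃ a b, T b = b₀ ∧ ξ a b ≠ 0} := by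
      have h1 : Fintype.card {p : A × B₀ // ζ' p.1 p.2 ≠ 0} = E.card := Fintype.card_subtype _
      have h2 : Fintype.card {b // ∃ a, ζ' a b ≠ 0}
          ≤ Fintype.card {b₀ // ∃ a b, T b = b₀ ∧ ξ a b ≠ 0} := by
        refine Fintype.card_subtype_mono _ _ fun b₀ h => ?_
        obtain ⟨a, ha⟩ := h
        obtain ⟨b, hb, hne⟩ := Finset.exists_ne_zero_of_sum_ne_zero (zs a b₀ ha)
        exact ⟨a, b, (Finset.mem_filter.mp hb).2, hne⟩
      omega
    calc ∑ a, ∑ b₀, ζ' a b₀ * (if b₀ = φ a then 0 else 1)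
        = ∑ p : A × B₀, ζ' p.1 p.2 * (if p.2 = φ p.1 then 0 else 1) := by
          rw [Fintype.sum_prod_type]
      _ = ∑ p ∈ E₂, ζ' p.1 p.2 := by
          rw [hE₂, Finset.sum_filter]
          refine Finset.sum_congr rfl fun p _ => ?_
          by_cases h : p.2 = φ p.1 <;> by_cases h' : ζ' p.1 p.2 = 0 <;> simp [h, h']
      _ ≤ ∑ p ∈ E₂, ρ := Finset.sum_le_sum fun p _ => hle _ _
      _ = E₂.card * ρ := by simp
      _ ≤ _ := mul_le_mul_of_nonneg_right (by exact_mod_cast hE₂card) hρ0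

end SparseCoupling

section OneStep

/-- Chebyshev's inequality for a product of couplings. -/
theorem coupling_chebyshev {J 𝔸 𝔹 : Type} [Fintype J] [Fintype 𝔸] [Fintype 𝔹]
    (ξ : J → 𝔸 → 𝔹 → ℝ) (h0 : ∀ j a b, 0 ≤ ξ j a b) (h1 : ∀ j, ∑ a, ∑ b, ξ j a b = 1)
    (Y : J → 𝔸 → 𝔹 → ℝ) {C : ℝ} (hY : ∀ j a b, |Y j a b| ≤ C) {s : ℝ} (hs : 0 < s) :
    ∑ a : J → 𝔸, ∑ b : J → 𝔹, (∏ j, ξ j (a j) (b j)) *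
      (if s ≤ |∑ j, Y j (a j) (b j) - ∑ j, ∑ a, ∑ b, ξ j a b * Y j a b| then 1 else 0)
      ≤ Fintype.card J * (2 * C) ^ 2 / s ^ 2 := by
  have h := finite_chebyshev (fun j (x : 𝔸 × 𝔹) => ξ j x.1 x.2) (fun j x => h0 j _ _)
    (fun j => by rw [Fintype.sum_prod_type]; exact h1 j) (fun j x => Y j x.1 x.2)
    (fun j x => hY j _ _) hs
  simp only [Fintype.sum_prod_type] at h
  refine le_trans (le_of_eq ?_) h
  rw [Finset.sum_filter, ← Fintype.sum_prod_type',
    ← (Equiv.arrowProdEquivProdArrow J (fun _ => 𝔸) (fun _ => 𝔹)).sum_comp]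
  refine Finset.sum_congr rfl fun ω _ => ?_
  have hite : ∀ (P : Prop) [Decidable P] (x : ℝ), x * (if P then 1 else 0) = if P then x else 0 := by
    intro P _ x
    split_ifs <;> simp
  exact hite _ _

theorem exists_one_step_threshold {δ C R c₀ : ℝ} (hδ : 0 < δ) (hc₀ : 0 < c₀) (hC : 0 < C)
    {κ : ℝ} (hκ : 0 < κ) (k : ℕ) :
    ∃ N₀ : ℕ, ∀ N : ℕ, N₀ ≤ N → 0 < N ∧ 4 ≤ δ * N ∧
      (k + 2) * (N * (2 * C) ^ 2 / (κ * N) ^ 2) ≤ δ / 4 ∧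
      Real.exp (R - δ * c₀ / 8 * N) ≤ δ / 4 := by
  obtain ⟨N₁, h₁⟩ := exists_nat_ge (4 / δ)
  obtain ⟨N₂, h₂⟩ := exists_nat_ge ((k + 2) * (2 * C) ^ 2 / κ ^ 2 / (δ / 4))
  obtain ⟨N₃, h₃⟩ := exists_nat_ge ((R - Real.log (δ / 4)) / (δ * c₀ / 8))
  refine ⟨N₁ + N₂ + N₃ + 1, fun N hN => ?_⟩
  have hN0 : 0 < N := by omega
  have hNr : (0 : ℝ) < N := by exact_mod_cast hN0
  have g₁ : (N₁ : ℝ) ≤ N := by exact_mod_cast (by omega : N₁ ≤ N)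
  have g₂ : (N₂ : ℝ) ≤ N := by exact_mod_cast (by omega : N₂ ≤ N)
  have g₃ : (N₃ : ℝ) ≤ N := by exact_mod_cast (by omega : N₃ ≤ N)
  refine ⟨hN0, ?_, ?_, ?_⟩
  · have := h₁.trans g₁
    rw [div_le_iff₀ hδ] at this
    linarith
  · have := h₂.trans g₂
    rw [div_le_iff₀ (by positivity)] at this
    have e : ((k : ℝ) + 2) * (N * (2 * C) ^ 2 / (κ * N) ^ 2)
        = (k + 2) * (2 * C) ^ 2 / κ ^ 2 / N := by
      field_simp
    rw [e, div_le_iff₀ hNr]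
    linarith
  · rw [← Real.exp_log (by positivity : 0 < δ / 4)]
    apply Real.exp_le_exp.mpr
    have := h₃.trans g₃
    rw [div_le_iff₀ (by positivity)] at this
    linarith

/-- One step of the coding construction: independent couplings over a large index set can be
replaced by a coupling of the product measures which does not increase the given average costs
by much, and in which the second coordinate is nearly a function of the first one. -/
theorem exists_nearly_deterministic_coupling {δ C R c₀ : ℝ} (hδ : 0 < δ) (hδ1 : δ ≤ 1)
    (hc₀ : 0 < c₀) (hC : 1 ≤ C) (ι : Type) [Fintype ι] :
    ∃ N₀ : ℕ, ∀ (J 𝔸 𝔹 : Type) [Fintype J] [Fintype 𝔸] [Fintype 𝔹] [Nonempty 𝔹],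
      N₀ ≤ Fintype.card J →
      ∀ (p : J → 𝔸 → ℝ) (q : J → 𝔹 → ℝ) (ξ : J → 𝔸 → 𝔹 → ℝ) (c : ι → J → 𝔸 → 𝔹 → ℝ),
      (∀ j, ∑ a, p j a = 1) → (∀ j, ∑ b, q j b = 1) →
      (∀ j a, |Real.log (p j a)| ≤ C) → (∀ j b, |Real.log (q j b)| ≤ C) →
      (∀ j a b, 0 ≤ ξ j a b) → (∀ j a, ∑ b, ξ j a b = p j a) → (∀ j b, ∑ a, ξ j a b = q j b) →
      (∀ i j a b, 0 ≤ c i j a b ∧ c i j a b ≤ 1) →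
      (∑ j, ∑ b, (q j b).negMulLog) ≤ (∑ j, ∑ a, (p j a).negMulLog) + R →
      (∀ j, c₀ ≤ ∑ b, (q j b).negMulLog) →
      ∃ (ξ' : (J → 𝔸) → (J → 𝔹) → ℝ) (φ : (J → 𝔸) → (J → 𝔹)),
        (∀ a b, 0 ≤ ξ' a b) ∧ (∀ a, ∑ b, ξ' a b = ∏ j, p j (a j)) ∧
        (∀ b, ∑ a, ξ' a b = ∏ j, q j (b j)) ∧
        (∀ i, ∑ a, ∑ b, ξ' a b * ∑ j, c i j (a j) (b j)
          ≤ (∑ j, ∑ a, ∑ b, ξ j a b * c i j a b) + δ * Fintype.card J) ∧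
        ∑ a, ∑ b, ξ' a b * ∑ j, discrep (φ a j) (b j) ≤ δ * Fintype.card J := by
  set κ := min (δ / 4) (δ * c₀ / 16) with hκ
  have hκ0 : 0 < κ := by positivity
  obtain ⟨N₀, hN₀⟩ := exists_one_step_threshold (R := R) hδ hc₀ (by linarith : 0 < C) hκ0
    (Fintype.card ι)
  refine ⟨N₀, ?_⟩
  intro J 𝔸 𝔹 _ _ _ _ hJ p q ξ c hp1 hq1 hpC hqC hξ0 hξp hξq hc hR hqc
  obtain ⟨hNpos, hN4, hNbad, hNexp⟩ := hN₀ _ hJ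
  set N := Fintype.card J with hN
  have hNr : (0 : ℝ) < N := by exact_mod_cast hNpos
  have hp0 : ∀ j a, 0 ≤ p j a := fun j a => hξp j a ▸ Finset.sum_nonneg fun b _ => hξ0 j a b
  have hq0 : ∀ j b, 0 ≤ q j b := fun j b => hξq j b ▸ Finset.sum_nonneg fun a _ => hξ0 j a b
  have hξ1 : ∀ j, ∑ a, ∑ b, ξ j a b = 1 := fun j => by simp_rw [hξp, hp1]
  -- the dropped coordinates
  obtain ⟨D, hDlo, hDhi⟩ : ∃ D : Finset J, δ * N / 4 ≤ D.card ∧ (D.card : ℝ) ≤ δ * N / 2 := by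
    obtain ⟨D, -, hD⟩ := Finset.exists_subset_card_eq (s := (Finset.univ : Finset J))
      (n := ⌈δ * N / 4⌉₊) (by
        rw [Finset.card_univ, ← hN]
        apply Nat.ceil_le.mpr
        nlinarith)
    refine ⟨D, ?_, ?_⟩
    · rw [hD]; exact Nat.le_ceil _
    · rw [hD]
      have := (Nat.ceil_lt_add_one (by positivity : 0 ≤ δ * N / 4)).le
      linarith
  set b₁ : 𝔹 := Classical.arbitrary 𝔹
  set T : (J → 𝔹) → (J → 𝔹) := fun b j => if j ∈ D then b₁ else b j with hT
  set s := κ * N with hs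
  have hs0 : 0 < s := by positivity
  set Y₁ : J → 𝔸 → 𝔹 → ℝ := fun j a _ => Real.log (p j a)
  set Y₂ : J → 𝔸 → 𝔹 → ℝ := fun j _ b => if j ∈ D then 0 else Real.log (q j b)
  set dev : (J → 𝔸 → 𝔹 → ℝ) → (J → 𝔸) → (J → 𝔹) → ℝ := fun Y a b =>
    |∑ j, Y j (a j) (b j) - ∑ j, ∑ a, ∑ b, ξ j a b * Y j a b| with hdev
  set Good : (J → 𝔸) → (J → 𝔹) → Prop := fun a b =>
    dev Y₁ a b < s ∧ dev Y₂ a b < s ∧ ∀ i, dev (c i) a b < s with hGood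
  set W : (J → 𝔸) → (J → 𝔹) → ℝ := fun a b => ∏ j, ξ j (a j) (b j) with hW
  have hW0 : ∀ a b, 0 ≤ W a b := fun a b => Finset.prod_nonneg fun j _ => hξ0 j _ _
  have hWp : ∀ a, ∑ b, W a b = ∏ j, p j (a j) := fun a => by
    simp only [hW]
    rw [sum_prod_weight (fun j b => ξ j (a j) b)]
    simp_rw [hξp]
  have hWq : ∀ b, ∑ a, W a b = ∏ j, q j (b j) := fun b => by
    simp only [hW]
    rw [sum_prod_weight (fun j a => ξ j a (b j))]
    simp_rw [hξq]
  set ξg : (J → 𝔸) → (J → 𝔹) → ℝ := fun a b => if Good a b then W a b else 0 with hξg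
  set ξb : (J → 𝔸) → (J → 𝔹) → ℝ := fun a b => if Good a b then 0 else W a b with hξb
  have hsplit : ∀ a b, W a b = ξg a b + ξb a b := fun a b => by
    simp only [hξg, hξb]; split_ifs <;> simp
  have hξg0 : ∀ a b, 0 ≤ ξg a b := fun a b => by
    simp only [hξg]; split_ifs; exacts [hW0 a b, le_rfl]
  have hξb0 : ∀ a b, 0 ≤ ξb a b := fun a b => by
    simp only [hξb]; split_ifs; exacts [le_rfl, hW0 a b]
  -- the bad part is small
  have hbad : ∑ a, ∑ b, ξb a b ≤ δ / 4 := by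
    refine le_trans ?_ hNbad
    have hcheb : ∀ Y : J → 𝔸 → 𝔹 → ℝ, (∀ j a b, |Y j a b| ≤ C) →
        ∑ a, ∑ b, W a b * (if s ≤ dev Y a b then 1 else 0) ≤ N * (2 * C) ^ 2 / s ^ 2 :=
      fun Y hY => coupling_chebyshev ξ hξ0 hξ1 Y hY hs0
    have h1 := hcheb Y₁ (fun j a b => hpC j a)
    have h2 := hcheb Y₂ (fun j a b => by
      simp only [Y₂]; split_ifs
      · simpa using zero_le_one.trans hC
      · exact hqC j b)
    have h3 : ∀ i, _ := fun i => hcheb (c i) (fun j a b => by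
      rw [abs_of_nonneg (hc i j a b).1]; exact (hc i j a b).2.trans hC)
    have hle : ∀ a b, ξb a b ≤ W a b * (if s ≤ dev Y₁ a b then 1 else 0) +
        W a b * (if s ≤ dev Y₂ a b then 1 else 0) +
        ∑ i, W a b * (if s ≤ dev (c i) a b then 1 else 0) := by
      intro a b
      have n1 : ∀ P : Prop, 0 ≤ W a b * (if P then (1 : ℝ) else 0) := fun P => by
        split_ifs <;> simp [hW0]
      have nn := Finset.sum_nonneg (s := Finset.univ) fun i _ => n1 (s ≤ dev (c i) a b)
      by_cases hg : Good a b
      · have : ξb a b = 0 := if_pos hg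
        rw [this]
        have := n1 (s ≤ dev Y₁ a b); have := n1 (s ≤ dev Y₂ a b)
        linarith
      · have e : ξb a b = W a b := if_neg hg
        rw [e]
        have m1 := n1 (s ≤ dev Y₁ a b); have m2 := n1 (s ≤ dev Y₂ a b)
        by_cases g1 : s ≤ dev Y₁ a b
        · rw [if_pos g1] at m1 ⊢; linarith
        by_cases g2 : s ≤ dev Y₂ a b
        · rw [if_pos g2] at m2 ⊢; linarith
        have : ∃ i, s ≤ dev (c i) a b := by
          by_contra! g3
          exact hg ⟨not_le.mp g1, not_le.mp g2, g3⟩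
        obtain ⟨i, hi⟩ := this
        have := Finset.single_le_sum (s := Finset.univ)
          (f := fun i => W a b * (if s ≤ dev (c i) a b then (1 : ℝ) else 0))
          (fun i _ => n1 _) (Finset.mem_univ i)
        simp only [if_pos hi, mul_one] at this
        linarith
    calc ∑ a, ∑ b, ξb a b ≤ ∑ a, ∑ b, (W a b * (if s ≤ dev Y₁ a b then 1 else 0) +
        W a b * (if s ≤ dev Y₂ a b then 1 else 0) +
        ∑ i, W a b * (if s ≤ dev (c i) a b then 1 else 0)) :=
          Finset.sum_le_sum fun a _ => Finset.sum_le_sum fun b _ => hle a b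
      _ = ∑ a, ∑ b, W a b * (if s ≤ dev Y₁ a b then 1 else 0) +
        ∑ a, ∑ b, W a b * (if s ≤ dev Y₂ a b then 1 else 0) +
        ∑ i, ∑ a, ∑ b, W a b * (if s ≤ dev (c i) a b then 1 else 0) := by
          simp_rw [Finset.sum_add_distrib]
          congr 1
          rw [Finset.sum_comm (s := (Finset.univ : Finset ι))]
          exact Finset.sum_congr rfl fun a _ => Finset.sum_comm
      _ ≤ N * (2 * C) ^ 2 / s ^ 2 + N * (2 * C) ^ 2 / s ^ 2
          + ∑ _i : ι, N * (2 * C) ^ 2 / s ^ 2 :=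
          add_le_add (add_le_add h1 h2) (Finset.sum_le_sum fun i _ => h3 i)
      _ = _ := by
          rw [Finset.sum_const, Finset.card_univ, nsmul_eq_mul]; ring
  -- sparse coupling of the good part
  set Hp := ∑ j, ∑ a, (p j a).negMulLog with hHp
  set Hq₀ := ∑ j, (if j ∈ D then 0 else ∑ b, (q j b).negMulLog) with hHq₀
  have hE₁ : ∑ j, ∑ a, ∑ b, ξ j a b * Y₁ j a b = -Hp := by
    rw [hHp, ← Finset.sum_neg_distrib]
    refine Finset.sum_congr rfl fun j _ => ?_
    rw [← Finset.sum_neg_distrib]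
    refine Finset.sum_congr rfl fun a _ => ?_
    rw [← Finset.sum_mul, hξp, Real.negMulLog]; ring
  have hE₂ : ∑ j, ∑ a, ∑ b, ξ j a b * Y₂ j a b = -Hq₀ := by
    rw [hHq₀, ← Finset.sum_neg_distrib]
    refine Finset.sum_congr rfl fun j _ => ?_
    rw [Finset.sum_comm]
    simp only [Y₂]
    simp_rw [← Finset.sum_mul, hξq]
    split_ifs
    · simp
    · rw [← Finset.sum_neg_distrib]
      refine Finset.sum_congr rfl fun b _ => ?_
      rw [Real.negMulLog]; ring
  have hpos : ∀ a b, ξg a b ≠ 0 → Good a b ∧ ∀ j, 0 < ξ j (a j) (b j) := by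
    intro a b h
    have hg : Good a b := by
      by_contra hg
      exact h (if_neg hg)
    refine ⟨hg, fun j => lt_of_le_of_ne (hξ0 _ _ _) fun h0 => ?_⟩
    apply h
    simp only [hξg, if_pos hg, hW]
    exact Finset.prod_eq_zero (Finset.mem_univ j) h0.symm
  set ρ := Real.exp (-Hp + s) with hρ
  have hrow : ∀ a, ∑ b, ξg a b ≤ ρ := by
    intro a
    by_cases hz : ∃ b, ξg a b ≠ 0
    · obtain ⟨b, hb⟩ := hz
      obtain ⟨hg, hp'⟩ := hpos a b hb
      calc ∑ b, ξg a b ≤ ∑ b, W a b := Finset.sum_le_sum fun b _ => by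
            rw [hsplit]; linarith [hξb0 a b]
        _ = ∏ j, p j (a j) := hWp a
        _ = Real.exp (∑ j, Real.log (p j (a j))) := by
            rw [Real.exp_sum]
            refine Finset.prod_congr rfl fun j _ => (Real.exp_log ?_).symm
            exact (hp' j).trans_le (hξp j (a j) ▸
              Finset.single_le_sum (fun b _ => hξ0 j (a j) b) (Finset.mem_univ (b j)))
        _ ≤ ρ := by
            apply Real.exp_le_exp.mpr
            have h1 := hg.1
            simp only [hdev, hE₁] at h1
            have := (abs_lt.mp h1).2
            simp only [Y₁] at this
            linarith
    · push Not at hz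
      rw [Finset.sum_eq_zero fun b _ => hz b]
      exact (Real.exp_pos _).le
  obtain ⟨ξ', φ, hξ'0, hξ'r, hξ'c, hξ's, hξ'm⟩ :=
    exists_sparse_coupling T ξg hξg0 hrow (Real.exp_pos _).le
  set M := Nat.card {b₀ // ∃ a b, T b = b₀ ∧ ξg a b ≠ 0} with hM
  have hMcard : (M : ℝ) ≤ Real.exp (Hq₀ + s) := by
    set w : J → 𝔹 → ℝ := fun j b => if j ∈ D then (if b = b₁ then 1 else 0) else q j b with hw
    have hw0 : ∀ j b, 0 ≤ w j b := fun j b => by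
      simp only [hw]; split_ifs
      exacts [zero_le_one, le_rfl, hq0 j b]
    have hw1 : ∑ b : J → 𝔹, ∏ j, w j (b j) = 1 := by
      rw [sum_prod_weight]
      refine Finset.prod_eq_one fun j _ => ?_
      simp only [hw]; split_ifs
      · simp
      · exact hq1 j
    have hlow : ∀ b₀ : J → 𝔹, (∃ a b, T b = b₀ ∧ ξg a b ≠ 0) →
        Real.exp (-(Hq₀ + s)) ≤ ∏ j, w j (b₀ j) := by
      rintro b₀ ⟨a, b, rfl, hne⟩
      obtain ⟨hg, hp'⟩ := hpos a b hne
      have e : ∏ j, w j (T b j) = Real.exp (∑ j, Y₂ j (a j) (b j)) := by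
        rw [Real.exp_sum]
        refine Finset.prod_congr rfl fun j _ => ?_
        simp only [hw, hT, Y₂]
        by_cases hj : j ∈ D
        · simp [hj]
        · rw [if_neg hj, if_neg hj, if_neg hj]
          refine (Real.exp_log ?_).symm
          exact (hp' j).trans_le (hξq j (b j) ▸
            Finset.single_le_sum (fun a _ => hξ0 j a (b j)) (Finset.mem_univ (a j)))
      rw [e]
      apply Real.exp_le_exp.mpr
      have h1 := hg.2.1
      simp only [hdev, hE₂] at h1
      have := (abs_lt.mp h1).1
      linarith
    have : (M : ℝ) * Real.exp (-(Hq₀ + s)) ≤ 1 := by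
      rw [← hw1, hM, Nat.card_eq_fintype_card, Fintype.card_subtype, ← nsmul_eq_mul, ← Finset.sum_const]
      refine le_trans (Finset.sum_le_sum fun b₀ hb₀ => hlow b₀ (Finset.mem_filter.mp hb₀).2) ?_
      exact Finset.sum_le_sum_of_subset_of_nonneg (Finset.filter_subset _ _)
        fun b _ _ => Finset.prod_nonneg fun j _ => hw0 j _
    rw [Real.exp_neg, ← div_eq_mul_inv, div_le_one (Real.exp_pos _)] at this
    exact this
  have hMρ : (M : ℝ) * ρ ≤ δ / 4 := by
    calc (M : ℝ) * ρ ≤ Real.exp (Hq₀ + s) * ρ :=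
          mul_le_mul_of_nonneg_right hMcard (Real.exp_pos _).le
      _ = Real.exp (Hq₀ - Hp + 2 * s) := by rw [hρ, ← Real.exp_add]; ring_nf
      _ ≤ Real.exp (R - δ * c₀ / 8 * N) := by
          apply Real.exp_le_exp.mpr
          have h1 : Hq₀ + D.card * c₀ ≤ ∑ j, ∑ b, (q j b).negMulLog := by
            have : (D.card : ℝ) * c₀ = ∑ j, if j ∈ D then c₀ else 0 := by
              rw [← Finset.sum_filter]; simp
            rw [this, hHq₀, ← Finset.sum_add_distrib]
            refine Finset.sum_le_sum fun j _ => ?_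
            split_ifs
            · simpa using hqc j
            · simp
          have h2 : s ≤ δ * c₀ / 16 * N :=
            mul_le_mul_of_nonneg_right (min_le_right _ _) hNr.le
          have h3 : δ * N / 4 * c₀ ≤ D.card * c₀ := mul_le_mul_of_nonneg_right hDlo hc₀.le
          linarith
      _ ≤ δ / 4 := hNexp
  have hmass : ∑ a, ∑ b, ξ' a b ≤ 1 := by
    simp_rw [hξ'r]
    calc ∑ a, ∑ b, ξg a b ≤ ∑ a, ∑ b, W a b :=
          Finset.sum_le_sum fun a _ => Finset.sum_le_sum fun b _ => by
            rw [hsplit]; linarith [hξb0 a b]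
      _ = 1 := by
          simp_rw [hWp]
          rw [sum_prod_weight]
          exact Finset.prod_eq_one fun j _ => hp1 j
  have hTsum : ∀ (f : J → 𝔹 → ℝ) (b b' : J → 𝔹), (∀ j b, 0 ≤ f j b ∧ f j b ≤ 1) → T b' = T b →
      ∑ j, f j (b j) ≤ ∑ j, f j (b' j) + D.card := by
    intro f b b' hf hbb
    have : (D.card : ℝ) = ∑ j, if j ∈ D then 1 else 0 := by simp
    rw [this, ← Finset.sum_add_distrib]
    refine Finset.sum_le_sum fun j _ => ?_
    by_cases hj : j ∈ D
    · rw [if_pos hj]; linarith [(hf j (b j)).2, (hf j (b' j)).1]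
    · have : b' j = b j := by
        have := congrFun hbb j
        simpa [hT, hj] using this
      rw [if_neg hj, this, add_zero]
  have hbadsum : ∀ f : (J → 𝔸) → (J → 𝔹) → ℝ, (∀ a b, f a b ≤ N) →
      ∑ a, ∑ b, ξb a b * f a b ≤ δ / 4 * N := by
    intro f hf
    calc ∑ a, ∑ b, ξb a b * f a b ≤ ∑ a, ∑ b, ξb a b * N :=
          Finset.sum_le_sum fun a _ => Finset.sum_le_sum fun b _ =>
            mul_le_mul_of_nonneg_left (hf a b) (hξb0 a b)
      _ = (∑ a, ∑ b, ξb a b) * N := by simp_rw [Finset.sum_mul]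
      _ ≤ _ := mul_le_mul_of_nonneg_right hbad hNr.le
  refine ⟨fun a b => ξ' a b + ξb a b, φ, fun a b => add_nonneg (hξ'0 a b) (hξb0 a b),
    fun a => ?_, fun b => ?_, fun i => ?_, ?_⟩
  · rw [Finset.sum_add_distrib, hξ'r, ← Finset.sum_add_distrib, ← hWp]
    exact Finset.sum_congr rfl fun b _ => (hsplit a b).symm
  · rw [Finset.sum_add_distrib, hξ'c, ← Finset.sum_add_distrib, ← hWq]
    exact Finset.sum_congr rfl fun a _ => (hsplit a b).symm
  · simp_rw [add_mul, Finset.sum_add_distrib]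
    have hb := hbadsum (fun a b => ∑ j, c i j (a j) (b j)) (fun a b => by
      calc ∑ j, c i j (a j) (b j) ≤ ∑ _j : J, (1 : ℝ) :=
            Finset.sum_le_sum fun j _ => (hc i j _ _).2
        _ = N := by simp [hN])
    set E := ∑ j, ∑ a, ∑ b, ξ j a b * c i j a b with hE
    have hE0 : 0 ≤ E := Finset.sum_nonneg fun j _ => Finset.sum_nonneg fun a _ =>
      Finset.sum_nonneg fun b _ => mul_nonneg (hξ0 _ _ _) (hc i j a b).1
    have hgood : ∀ a b, ξ' a b * ∑ j, c i j (a j) (b j) ≤ ξ' a b * (E + s + δ * N / 2) := by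
      intro a b
      by_cases hz : ξ' a b = 0
      · simp [hz]
      · refine mul_le_mul_of_nonneg_left ?_ (hξ'0 a b)
        obtain ⟨b', hb', hne⟩ := hξ's a b hz
        have h1 := (hpos a b' hne).1.2.2 i
        simp only [hdev] at h1
        have h2 := (abs_lt.mp h1).2
        have h3 := hTsum (fun j y => c i j (a j) y) b b' (fun j y => hc i j _ y) hb'
        linarith
    have : ∑ a, ∑ b, ξ' a b * ∑ j, c i j (a j) (b j) ≤ E + s + δ * N / 2 := by
      calc ∑ a, ∑ b, ξ' a b * ∑ j, c i j (a j) (b j)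
          ≤ ∑ a, ∑ b, ξ' a b * (E + s + δ * N / 2) :=
            Finset.sum_le_sum fun a _ => Finset.sum_le_sum fun b _ => hgood a b
        _ = (∑ a, ∑ b, ξ' a b) * (E + s + δ * N / 2) := by simp_rw [Finset.sum_mul]
        _ ≤ 1 * (E + s + δ * N / 2) := mul_le_mul_of_nonneg_right hmass (by positivity)
        _ = _ := one_mul _
    have hs2 : s ≤ δ / 4 * N := mul_le_mul_of_nonneg_right (min_le_left _ _) hNr.le
    linarith
  · simp_rw [add_mul, Finset.sum_add_distrib]
    have hN1 : ∀ a b : J → 𝔹, ∑ j, discrep (a j) (b j) ≤ N := fun a b => by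
      calc ∑ j, discrep (a j) (b j) ≤ ∑ _j : J, (1 : ℝ) :=
            Finset.sum_le_sum fun j _ => discrep_le_one _ _
        _ = N := by simp [hN]
    have hb := hbadsum (fun a b => ∑ j, discrep (φ a j) (b j)) (fun a b => hN1 _ _)
    have hgood : ∀ a b, ξ' a b * ∑ j, discrep (φ a j) (b j)
        ≤ ξ' a b * D.card + N * (ξ' a b * (if T b = φ a then 0 else 1)) := by
      intro a b
      by_cases hz : T b = φ a
      · rw [if_pos hz, mul_zero, mul_zero, add_zero]
        refine mul_le_mul_of_nonneg_left ?_ (hξ'0 a b)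
        have : (D.card : ℝ) = ∑ j, if j ∈ D then 1 else 0 := by simp
        rw [this]
        refine Finset.sum_le_sum fun j _ => ?_
        by_cases hj : j ∈ D
        · rw [if_pos hj]; exact discrep_le_one _ _
        · have : φ a j = b j := by rw [← hz]; simp [hT, hj]
          rw [this, discrep_self, if_neg hj]
      · rw [if_neg hz, mul_one]
        have h1 := mul_le_mul_of_nonneg_left (hN1 (φ a) b) (hξ'0 a b)
        have h2 : 0 ≤ ξ' a b * D.card := mul_nonneg (hξ'0 a b) (Nat.cast_nonneg _)
        linarith
    have hξ'm' : ∑ a, ∑ b, ξ' a b * (if T b = φ a then (0 : ℝ) else 1) ≤ M * ρ := by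
      refine le_of_eq_of_le ?_ hξ'm
      refine Finset.sum_congr rfl fun a _ => Finset.sum_congr rfl fun b _ => ?_
      by_cases h : T b = φ a
      · rw [if_pos h, if_pos h]
      · rw [if_neg h, if_neg h]
    have : ∑ a, ∑ b, ξ' a b * ∑ j, discrep (φ a j) (b j)
        ≤ D.card + N * (δ / 4) := by
      calc ∑ a, ∑ b, ξ' a b * ∑ j, discrep (φ a j) (b j)
          ≤ ∑ a, ∑ b, (ξ' a b * D.card + N * (ξ' a b * (if T b = φ a then 0 else 1))) :=
            Finset.sum_le_sum fun a _ => Finset.sum_le_sum fun b _ => hgood a b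
        _ = (∑ a, ∑ b, ξ' a b) * D.card
            + N * ∑ a, ∑ b, ξ' a b * (if T b = φ a then 0 else 1) := by
            simp_rw [Finset.sum_add_distrib, Finset.sum_mul, Finset.mul_sum]
        _ ≤ 1 * D.card + N * (M * ρ) :=
            add_le_add (mul_le_mul_of_nonneg_right hmass (Nat.cast_nonneg _))
              (mul_le_mul_of_nonneg_left hξ'm' hNr.le)
        _ ≤ _ := by
            rw [one_mul]
            exact add_le_add_right (mul_le_mul_of_nonneg_left hMρ hNr.le) _
    linarith

end OneStep

noncomputable section Blocks

/-- Positions in a block of the dyadic tower of level `n`. -/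
abbrev Pos (n : ℕ) : Type := Fin n → Bool

/-- The sub-block of level `n` with index `j` in a block of level `n + r`. -/
def subBlock {n r : ℕ} {α : Type} (t : Pos (n + r) → α) (j : Pos r) : Pos n → α :=
  fun w => t (Fin.append w j)

def headPos {n r : ℕ} (p : Pos (n + r)) : Pos n := fun k => p (Fin.castAdd r k)

def tailPos {n r : ℕ} (p : Pos (n + r)) : Pos r := fun k => p (Fin.natAdd n k)

theorem append_headPos_tailPos {n r : ℕ} (p : Pos (n + r)) :
    Fin.append (headPos p) (tailPos p) = p := Fin.append_castAdd_natAdd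

@[simp] theorem headPos_append {n r : ℕ} (w : Pos n) (j : Pos r) :
    headPos (Fin.append w j) = w := by
  funext k; simp [headPos]

@[simp] theorem tailPos_append {n r : ℕ} (w : Pos n) (j : Pos r) :
    tailPos (Fin.append w j) = j := by
  funext k; simp [tailPos]

/-- A position of level `n + r` is a position of level `n` together with a sub-block index. -/
def posEquiv (n r : ℕ) : Pos r × Pos n ≃ Pos (n + r) where
  toFun q := Fin.append q.2 q.1
  invFun p := (tailPos p, headPos p)
  left_inv q := by simp
  right_inv p := append_headPos_tailPos p

/-- A labelling of a block of level `n + r` is a family of labellings of its sub-blocks. -/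
def blockEquiv (n r : ℕ) (α : Type) : (Pos (n + r) → α) ≃ (Pos r → Pos n → α) where
  toFun t := subBlock t
  invFun s p := s (tailPos p) (headPos p)
  left_inv t := by funext p; simp [subBlock, append_headPos_tailPos]
  right_inv s := by funext j w; simp [subBlock]

theorem sum_pos_append {n r : ℕ} (F : Pos (n + r) → ℝ) :
    ∑ p, F p = ∑ j : Pos r, ∑ w : Pos n, F (Fin.append w j) := by
  rw [← Fintype.sum_prod_type', ← (posEquiv n r).sum_comp]
  rfl

theorem prod_pos_append {n r : ℕ} (F : Pos (n + r) → ℝ) :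
    ∏ p, F p = ∏ j : Pos r, ∏ w : Pos n, F (Fin.append w j) := by
  rw [← Fintype.prod_prod_type', ← (posEquiv n r).prod_comp]
  rfl

theorem sum_subBlock {n r : ℕ} {α : Type} [Fintype α] (F : (Pos r → Pos n → α) → ℝ) :
    ∑ a : Pos (n + r) → α, F (subBlock a) = ∑ a', F a' :=
  (blockEquiv n r α).sum_comp F

/-- `ξ` is a coupling of the weights `p` and `q`. -/
def IsCoupling {A B : Type} [Fintype A] [Fintype B] (p : A → ℝ) (q : B → ℝ) (ξ : A → B → ℝ) :
    Prop :=
  (∀ a b, 0 ≤ ξ a b) ∧ (∀ a, ∑ b, ξ a b = p a) ∧ ∀ b, ∑ a, ξ a b = q b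

theorem IsCoupling.swap {A B : Type} [Fintype A] [Fintype B] {p : A → ℝ} {q : B → ℝ}
    {ξ : A → B → ℝ} (h : IsCoupling p q ξ) : IsCoupling q p (fun b a => ξ a b) :=
  ⟨fun b a => h.1 a b, h.2.2, h.2.1⟩

/-- The weight of a labelling of a block with pattern `t` for independent labels. -/
def blockWeight {V I 𝒜 : Type} [Fintype V] (P : I → 𝒜 → ℝ) (t : V → I) (a : V → 𝒜) : ℝ :=
  ∏ v, P (t v) (a v)

theorem blockWeight_nonneg {V I 𝒜 : Type} [Fintype V] {P : I → 𝒜 → ℝ} (hP : ∀ i a, 0 ≤ P i a)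
    (t : V → I) (a : V → 𝒜) : 0 ≤ blockWeight P t a :=
  Finset.prod_nonneg fun _ _ => hP _ _

theorem sum_blockWeight {V I 𝒜 : Type} [dec : DecidableEq V] [Fintype V] [Fintype 𝒜] {P : I → 𝒜 → ℝ}
    (hP : ∀ i, ∑ a, P i a = 1) (t : V → I) : ∑ a, blockWeight P t a = 1 := by
  simp only [blockWeight]
  obtain rfl : dec = Classical.decEq V := Subsingleton.elim _ _
  rw [sum_prod_weight (fun v a => P (t v) a)]
  exact Finset.prod_eq_one fun _ _ => hP _

theorem blockWeight_append {n r : ℕ} {I 𝒜 : Type} (P : I → 𝒜 → ℝ) (t : Pos (n + r) → I)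
    (a : Pos (n + r) → 𝒜) :
    blockWeight P t a = ∏ j, blockWeight P (subBlock t j) (subBlock a j) :=
  prod_pos_append _

theorem sum_negMulLog_prod {J 𝔸 : Type} [dec : DecidableEq J] [Fintype J] [Fintype 𝔸] (p : J → 𝔸 → ℝ)
    (hp : ∀ j, ∑ a, p j a = 1) :
    ∑ a : J → 𝔸, (∏ j, p j (a j)).negMulLog = ∑ j, ∑ a, (p j a).negMulLog := by
  obtain rfl : dec = Classical.decEq J := Subsingleton.elim _ _
  have h : ∀ a : J → 𝔸, (∏ j, p j (a j)).negMulLog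
      = ∑ i, (∏ j, p j (a j)) * (-Real.log (p i (a i))) := by
    intro a
    by_cases hz : ∏ j, p j (a j) = 0
    · simp [hz]
    · rw [← ne_eq, Finset.prod_ne_zero_iff] at hz
      rw [Real.negMulLog, Real.log_prod hz, ← Finset.mul_sum, Finset.sum_neg_distrib]
      ring
  simp_rw [h]
  rw [Finset.sum_comm]
  refine Finset.sum_congr rfl fun i _ => ?_
  rw [sum_prod_weight_mul_single p hp i (fun x => -Real.log (p i x))]
  refine Finset.sum_congr rfl fun x _ => ?_
  rw [Real.negMulLog]; ring

/-- The entropy of the label of a site of type `i`. -/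
def siteEntropy {I 𝒜 : Type} [Fintype 𝒜] (P : I → 𝒜 → ℝ) (i : I) : ℝ := ∑ a, (P i a).negMulLog

theorem sum_negMulLog_blockWeight {V I 𝒜 : Type} [dec : DecidableEq V] [Fintype V] [Fintype 𝒜] (P : I → 𝒜 → ℝ)
    (hP : ∀ i, ∑ a, P i a = 1) (t : V → I) :
    ∑ a, (blockWeight P t a).negMulLog = ∑ v, siteEntropy P (t v) :=
  sum_negMulLog_prod (fun v a => P (t v) a) fun _ => hP _

/-- The rule of level `n + r` applying a rule of level `n` in every sub-block. -/
def liftRule {n : ℕ} (r : ℕ) {I 𝒜 ℱ : Type} (φ : (Pos n → I) → (Pos n → 𝒜) → Pos n → ℱ)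
    (t : Pos (n + r) → I) (a : Pos (n + r) → 𝒜) (p : Pos (n + r)) : ℱ :=
  φ (subBlock t (tailPos p)) (subBlock a (tailPos p)) (headPos p)

/-- The average over the sub-blocks of a cost of level `n`. -/
def liftCost {n : ℕ} (r : ℕ) {I 𝒜 ℱ : Type}
    (c : (Pos n → I) → (Pos n → 𝒜) → (Pos n → ℱ) → ℝ)
    (t : Pos (n + r) → I) (a : Pos (n + r) → 𝒜) (b : Pos (n + r) → ℱ) : ℝ :=
  (∑ j, c (subBlock t j) (subBlock a j) (subBlock b j)) / 2 ^ r

/-- The proportion of positions of a block at which the two labellings differ. -/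
def mism {n : ℕ} {ℱ : Type} (b b' : Pos n → ℱ) : ℝ :=
  (∑ p, discrep (b p) (b' p)) / 2 ^ n

theorem card_pos (n : ℕ) : (Fintype.card (Pos n) : ℝ) = 2 ^ n := by simp [Pos]

theorem mism_nonneg {n : ℕ} {ℱ : Type} (b b' : Pos n → ℱ) : 0 ≤ mism b b' :=
  div_nonneg (Finset.sum_nonneg fun _ _ => discrep_nonneg _ _) (by positivity)

theorem mism_le_one {n : ℕ} {ℱ : Type} (b b' : Pos n → ℱ) : mism b b' ≤ 1 := by
  rw [mism, div_le_one (by positivity), ← card_pos, ← nsmul_one, ← Finset.card_univ,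
    ← Finset.sum_const]
  exact Finset.sum_le_sum fun p _ => discrep_le_one _ _

theorem mism_comm {n : ℕ} {ℱ : Type} (b b' : Pos n → ℱ) : mism b b' = mism b' b := by
  simp only [mism, discrep_comm]

theorem mism_triangle {n : ℕ} {ℱ : Type} (b b' b'' : Pos n → ℱ) :
    mism b b'' ≤ mism b b' + mism b' b'' := by
  rw [mism, mism, mism, ← add_div, ← Finset.sum_add_distrib]
  refine div_le_div_of_nonneg_right (Finset.sum_le_sum fun p _ => ?_) (by positivity)
  exact discrep_triangle _ _ _

theorem mism_liftRule {n : ℕ} (r : ℕ) {I 𝒜 ℱ : Type}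
    (φ : (Pos n → I) → (Pos n → 𝒜) → Pos n → ℱ) (t : Pos (n + r) → I) (a : Pos (n + r) → 𝒜)
    (b : Pos (n + r) → ℱ) :
    mism (liftRule r φ t a) b = liftCost r (fun t a b => mism (φ t a) b) t a b := by
  rw [mism, liftCost, sum_pos_append]
  simp only [mism, liftRule, headPos_append, tailPos_append, subBlock]
  rw [← Finset.sum_div, div_div, pow_add]

theorem exists_nearly_deterministic_coupling_of_decidableEq {δ C R c₀ : ℝ} (hδ : 0 < δ) (hδ1 : δ ≤ 1)
    (hc₀ : 0 < c₀) (hC : 1 ≤ C) (ι : Type) [Fintype ι] :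
    ∃ N₀ : ℕ, ∀ (J 𝔸 𝔹 : Type) [DecidableEq J] [Fintype J] [Fintype 𝔸] [Fintype 𝔹] [Nonempty 𝔹],
      N₀ ≤ Fintype.card J →
      ∀ (p : J → 𝔸 → ℝ) (q : J → 𝔹 → ℝ) (ξ : J → 𝔸 → 𝔹 → ℝ) (c : ι → J → 𝔸 → 𝔹 → ℝ),
      (∀ j, ∑ a, p j a = 1) → (∀ j, ∑ b, q j b = 1) →
      (∀ j a, |Real.log (p j a)| ≤ C) → (∀ j b, |Real.log (q j b)| ≤ C) →
      (∀ j a b, 0 ≤ ξ j a b) → (∀ j a, ∑ b, ξ j a b = p j a) → (∀ j b, ∑ a, ξ j a b = q j b) →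
      (∀ i j a b, 0 ≤ c i j a b ∧ c i j a b ≤ 1) →
      (∑ j, ∑ b, (q j b).negMulLog) ≤ (∑ j, ∑ a, (p j a).negMulLog) + R →
      (∀ j, c₀ ≤ ∑ b, (q j b).negMulLog) →
      ∃ (ξ' : (J → 𝔸) → (J → 𝔹) → ℝ) (φ : (J → 𝔸) → (J → 𝔹)),
        (∀ a b, 0 ≤ ξ' a b) ∧ (∀ a, ∑ b, ξ' a b = ∏ j, p j (a j)) ∧
        (∀ b, ∑ a, ξ' a b = ∏ j, q j (b j)) ∧
        (∀ i, ∑ a, ∑ b, ξ' a b * ∑ j, c i j (a j) (b j)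
          ≤ (∑ j, ∑ a, ∑ b, ξ j a b * c i j a b) + δ * Fintype.card J) ∧
        ∑ a, ∑ b, ξ' a b * ∑ j, discrep (φ a j) (b j) ≤ δ * Fintype.card J := by
  obtain ⟨N₀, hN₀⟩ := exists_nearly_deterministic_coupling (R := R) hδ hδ1 hc₀ hC ι
  refine ⟨N₀, ?_⟩
  intro J 𝔸 𝔹 inst
  obtain rfl : inst = Classical.decEq J := Subsingleton.elim _ _
  exact hN₀ J 𝔸 𝔹

/-- The coding step, in blocks of the dyadic tower. -/
theorem exists_block_step {I 𝒜 ℱ : Type} [Fintype I] [Fintype 𝒜] [Fintype ℱ] [Nonempty ℱ]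
    (P : I → 𝒜 → ℝ) (Q : I → ℱ → ℝ) (hP1 : ∀ i, ∑ a, P i a = 1) (hQ1 : ∀ i, ∑ b, Q i b = 1)
    (Adm : ∀ n, (Pos n → I) → Prop)
    (hAdm : ∀ n r (t : Pos (n + r) → I), Adm (n + r) t → ∀ j, Adm n (subBlock t j))
    {h R : ℝ}
    (hAP : ∀ n t, Adm n t → |∑ v, siteEntropy P (t v) - 2 ^ n * h| ≤ R)
    (hAQ : ∀ n t, Adm n t → |∑ v, siteEntropy Q (t v) - 2 ^ n * h| ≤ R)
    {n : ℕ} {c₀ : ℝ} (hc₀ : 0 < c₀) (hQc : ∀ t, Adm n t → c₀ ≤ ∑ v, siteEntropy Q (t v))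
    (ξ : (Pos n → I) → (Pos n → 𝒜) → (Pos n → ℱ) → ℝ)
    (hξ : ∀ t, Adm n t → IsCoupling (blockWeight P t) (blockWeight Q t) (ξ t))
    {ι : Type} [Fintype ι] (c : ι → (Pos n → I) → (Pos n → 𝒜) → (Pos n → ℱ) → ℝ)
    (hc : ∀ i t a b, 0 ≤ c i t a b ∧ c i t a b ≤ 1) (e : ι → ℝ)
    (hce : ∀ i t, Adm n t → ∑ a, ∑ b, ξ t a b * c i t a b ≤ e i)
    {δ : ℝ} (hδ : 0 < δ) (hδ1 : δ ≤ 1) :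
    ∃ (r : ℕ) (ξ' : (Pos (n + r) → I) → (Pos (n + r) → 𝒜) → (Pos (n + r) → ℱ) → ℝ)
      (φ : (Pos (n + r) → I) → (Pos (n + r) → 𝒜) → Pos (n + r) → ℱ),
      ∀ t, Adm (n + r) t → IsCoupling (blockWeight P t) (blockWeight Q t) (ξ' t) ∧
        (∀ i, ∑ a, ∑ b, ξ' t a b * liftCost r (c i) t a b ≤ e i + δ) ∧
        ∑ a, ∑ b, ξ' t a b * mism (φ t a) b ≤ δ := by
  obtain ⟨C, hC1, hCP, hCQ⟩ : ∃ C : ℝ, 1 ≤ C ∧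
      (∀ (t : Pos n → I) a, |Real.log (blockWeight P t a)| ≤ C) ∧
      (∀ (t : Pos n → I) b, |Real.log (blockWeight Q t b)| ≤ C) := by
    set s₁ := ∑ q : (Pos n → I) × (Pos n → 𝒜), |Real.log (blockWeight P q.1 q.2)| with hs₁
    set s₂ := ∑ q : (Pos n → I) × (Pos n → ℱ), |Real.log (blockWeight Q q.1 q.2)| with hs₂
    have h₁ : 0 ≤ s₁ := Finset.sum_nonneg fun q _ => abs_nonneg _
    have h₂ : 0 ≤ s₂ := Finset.sum_nonneg fun q _ => abs_nonneg _
    refine ⟨1 + s₁ + s₂, by linarith, fun t a => ?_, fun t b => ?_⟩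
    · have := Finset.single_le_sum
        (f := fun q : (Pos n → I) × (Pos n → 𝒜) => |Real.log (blockWeight P q.1 q.2)|)
        (fun q _ => abs_nonneg _) (Finset.mem_univ (t, a))
      simp only [← hs₁] at this
      linarith
    · have := Finset.single_le_sum
        (f := fun q : (Pos n → I) × (Pos n → ℱ) => |Real.log (blockWeight Q q.1 q.2)|)
        (fun q _ => abs_nonneg _) (Finset.mem_univ (t, b))
      simp only [← hs₂] at this
      linarith
  obtain ⟨N₀, hN₀⟩ := exists_nearly_deterministic_coupling_of_decidableEq (R := 2 * R) hδ hδ1 hc₀ hC1 ι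
  have hcard : N₀ ≤ Fintype.card (Pos N₀) := by
    simpa [Pos] using Nat.lt_two_pow_self.le
  have key : ∀ t : Pos (n + N₀) → I, ∃ (ξ' : (Pos N₀ → Pos n → 𝒜) → (Pos N₀ → Pos n → ℱ) → ℝ)
      (φ : (Pos N₀ → Pos n → 𝒜) → (Pos N₀ → Pos n → ℱ)), Adm (n + N₀) t →
        (∀ a b, 0 ≤ ξ' a b) ∧ (∀ a, ∑ b, ξ' a b = ∏ j, blockWeight P (subBlock t j) (a j)) ∧
        (∀ b, ∑ a, ξ' a b = ∏ j, blockWeight Q (subBlock t j) (b j)) ∧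
        (∀ i, ∑ a, ∑ b, ξ' a b * ∑ j, c i (subBlock t j) (a j) (b j)
          ≤ (∑ j, ∑ a, ∑ b, ξ (subBlock t j) a b * c i (subBlock t j) a b)
            + δ * Fintype.card (Pos N₀)) ∧
        ∑ a, ∑ b, ξ' a b * ∑ j, discrep (φ a j) (b j)
          ≤ δ * Fintype.card (Pos N₀) := by
    intro t
    by_cases ht : Adm (n + N₀) t
    · have hsub := hAdm n N₀ t ht
      have e1 : ∀ (j : Pos N₀), ∑ a, blockWeight P (subBlock t j) a = 1 :=
        fun j => sum_blockWeight hP1 _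
      have e2 : ∀ (j : Pos N₀), ∑ b, blockWeight Q (subBlock t j) b = 1 :=
        fun j => sum_blockWeight hQ1 _
      have e3 : (∑ j : Pos N₀, ∑ b, (blockWeight Q (subBlock t j) b).negMulLog)
          ≤ (∑ j : Pos N₀, ∑ a, (blockWeight P (subBlock t j) a).negMulLog) + 2 * R := by
        simp_rw [sum_negMulLog_blockWeight P hP1, sum_negMulLog_blockWeight Q hQ1]
        have h1 := hAP _ t ht
        have h2 := hAQ _ t ht
        rw [sum_pos_append] at h1 h2
        have h3 := (abs_le.mp h1).1
        have h4 := (abs_le.mp h2).2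
        simp only [subBlock]
        linarith
      have e4 : ∀ j : Pos N₀, c₀ ≤ ∑ b, (blockWeight Q (subBlock t j) b).negMulLog := by
        intro j
        rw [sum_negMulLog_blockWeight Q hQ1]
        exact hQc _ (hsub j)
      obtain ⟨ξ', φ, hh⟩ := hN₀ (Pos N₀) (Pos n → 𝒜) (Pos n → ℱ) hcard
        (fun j => blockWeight P (subBlock t j)) (fun j => blockWeight Q (subBlock t j))
        (fun j => ξ (subBlock t j)) (fun i j => c i (subBlock t j))
        e1 e2 (fun j => hCP _) (fun j => hCQ _) (fun j => (hξ _ (hsub j)).1)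
        (fun j => (hξ _ (hsub j)).2.1) (fun j => (hξ _ (hsub j)).2.2)
        (fun i j => hc i _) e3 e4
      exact ⟨ξ', φ, fun _ => hh⟩
    · exact ⟨fun _ _ => 0, fun _ _ => Classical.arbitrary _, fun h => absurd h ht⟩
  choose ξ' φ hkey using key
  refine ⟨N₀, fun t a b => ξ' t (subBlock a) (subBlock b),
    fun t a p => φ t (subBlock a) (tailPos p) (headPos p), fun t ht => ?_⟩
  obtain ⟨h0, hr, hcol, hcost, hm⟩ := hkey t ht
  have hsub := hAdm n N₀ t ht
  have hsum2 : ∀ F : (Pos N₀ → Pos n → 𝒜) → (Pos N₀ → Pos n → ℱ) → ℝ,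
      ∑ a : Pos (n + N₀) → 𝒜, ∑ b : Pos (n + N₀) → ℱ, F (subBlock a) (subBlock b)
        = ∑ a, ∑ b, F a b := by
    intro F
    rw [← sum_subBlock (fun a => ∑ b, F a b)]
    exact Finset.sum_congr rfl fun a _ => sum_subBlock (F (subBlock a))
  refine ⟨⟨fun a b => h0 _ _, fun a => ?_, fun b => ?_⟩, fun i => ?_, ?_⟩
  · rw [sum_subBlock (fun b => ξ' t (subBlock a) b), hr, blockWeight_append]
  · rw [sum_subBlock (fun a => ξ' t a (subBlock b)), hcol, blockWeight_append]
  · have := hsum2 (fun a b => ξ' t a b * ((∑ j, c i (subBlock t j) (a j) (b j)) / 2 ^ N₀))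
    simp only [liftCost]
    rw [this]
    simp_rw [mul_div_assoc']
    simp_rw [← Finset.sum_div]
    rw [div_le_iff₀ (by positivity), ← card_pos]
    refine (hcost i).trans ?_
    rw [add_mul]
    gcongr
    calc _ ≤ ∑ j : Pos N₀, e i := Finset.sum_le_sum fun j _ => hce i _ (hsub j)
      _ = _ := by rw [Finset.sum_const, Finset.card_univ, nsmul_eq_mul, mul_comm]
  · have hle : ∀ (a : Pos N₀ → Pos n → 𝒜) (b : Pos (n + N₀) → ℱ),
        mism (fun p => φ t a (tailPos p) (headPos p)) b
          ≤ (∑ j, discrep (φ t a j) (subBlock b j)) / 2 ^ N₀ := by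
      intro a b
      rw [mism, sum_pos_append, div_le_div_iff₀ (by positivity) (by positivity), pow_add,
        ← mul_assoc, mul_comm (_ * _) ((2 : ℝ) ^ N₀), mul_comm _ ((2 : ℝ) ^ N₀)]
      refine mul_le_mul_of_nonneg_left ?_ (by positivity)
      rw [Finset.sum_mul]
      refine Finset.sum_le_sum fun j _ => ?_
      simp only [tailPos_append, headPos_append]
      by_cases hj : φ t a j = subBlock b j
      · rw [hj, discrep_self, zero_mul]
        refine (Finset.sum_eq_zero fun w _ => ?_).le
        simp [subBlock]
      · rw [discrep_of_ne hj, one_mul, ← card_pos, ← nsmul_one, ← Finset.card_univ, ← Finset.sum_const]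
        exact Finset.sum_le_sum fun p _ => discrep_le_one _ _
    have := hsum2 (fun a b => ξ' t a b *
      ((∑ j, discrep (φ t a j) (b j)) / 2 ^ N₀))
    refine le_trans (Finset.sum_le_sum fun a _ => Finset.sum_le_sum fun b _ =>
      mul_le_mul_of_nonneg_left (hle _ _) (h0 _ _)) ?_
    rw [this]
    simp_rw [mul_div_assoc']
    simp_rw [← Finset.sum_div]
    rw [div_le_iff₀ (by positivity), ← card_pos]
    exact hm

end Blocks

noncomputable section Stages

/-- A coupling of the labellings of every admissible block of level `n`, together with rules
`f`, `g` recovering, up to an error `ε`, each labelling from the other one. -/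
def IsStage {I 𝒜 ℱ : Type} [Fintype 𝒜] [Fintype ℱ] (P : I → 𝒜 → ℝ) (Q : I → ℱ → ℝ)
    (Adm : ∀ n, (Pos n → I) → Prop) (n : ℕ) (ε : ℝ)
    (ξ : (Pos n → I) → (Pos n → 𝒜) → (Pos n → ℱ) → ℝ)
    (f : (Pos n → I) → (Pos n → 𝒜) → Pos n → ℱ)
    (g : (Pos n → I) → (Pos n → ℱ) → Pos n → 𝒜) : Prop :=
  ∀ t, Adm n t → IsCoupling (blockWeight P t) (blockWeight Q t) (ξ t) ∧
    ∑ a, ∑ b, ξ t a b * mism (f t a) b ≤ ε ∧ ∑ a, ∑ b, ξ t a b * mism (g t b) a ≤ ε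

theorem mism_mem {n : ℕ} {ℱ : Type} (b b' : Pos n → ℱ) : 0 ≤ mism b b' ∧ mism b b' ≤ 1 :=
  ⟨mism_nonneg _ _, mism_le_one _ _⟩

/-- Two coding steps, one in each direction. -/
theorem IsStage.exists_next {I 𝒜 ℱ : Type} [Fintype I] [Fintype 𝒜] [Fintype ℱ] [Nonempty 𝒜]
    [Nonempty ℱ] {P : I → 𝒜 → ℝ} {Q : I → ℱ → ℝ} (hP1 : ∀ i, ∑ a, P i a = 1)
    (hQ1 : ∀ i, ∑ b, Q i b = 1) {Adm : ∀ n, (Pos n → I) → Prop}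
    (hAdm : ∀ n r (t : Pos (n + r) → I), Adm (n + r) t → ∀ j, Adm n (subBlock t j))
    {h R : ℝ} (hh : 0 ≤ h)
    (hAP : ∀ n t, Adm n t → |∑ v, siteEntropy P (t v) - 2 ^ n * h| ≤ R)
    (hAQ : ∀ n t, Adm n t → |∑ v, siteEntropy Q (t v) - 2 ^ n * h| ≤ R)
    {n : ℕ} (hn : R < 2 ^ n * h) {ε : ℝ} (hε : 0 < ε) (hε1 : ε ≤ 1)
    {ξ : (Pos n → I) → (Pos n → 𝒜) → (Pos n → ℱ) → ℝ}
    {f : (Pos n → I) → (Pos n → 𝒜) → Pos n → ℱ} {g : (Pos n → I) → (Pos n → ℱ) → Pos n → 𝒜}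
    (hS : IsStage P Q Adm n ε ξ f g) {ε' : ℝ} (hε' : 0 < ε') :
    ∃ (r r' : ℕ)
      (ξ' : (Pos (n + r + r') → I) → (Pos (n + r + r') → 𝒜) → (Pos (n + r + r') → ℱ) → ℝ)
      (f' : (Pos (n + r + r') → I) → (Pos (n + r + r') → 𝒜) → Pos (n + r + r') → ℱ)
      (g' : (Pos (n + r + r') → I) → (Pos (n + r + r') → ℱ) → Pos (n + r + r') → 𝒜),
      IsStage P Q Adm (n + r + r') ε' ξ' f' g' ∧
      IsStage P Q Adm (n + r + r') (2 * ε) ξ' (liftRule r' (liftRule r f))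
        (liftRule r' (liftRule r g)) := by
  set δ := min (ε' / 2) (ε / 2) with hδ
  have hδ0 : 0 < δ := by positivity
  have hδ1 : δ ≤ 1 := (min_le_right _ _).trans (by linarith)
  have hδε : δ ≤ ε / 2 := min_le_right _ _
  have hδε' : δ ≤ ε' / 2 := min_le_left _ _
  have hc₀ : 0 < 2 ^ n * h - R := by linarith
  obtain ⟨r, ξ₁, f₁, h₁⟩ := exists_block_step P Q hP1 hQ1 Adm hAdm hAP hAQ hc₀
    (fun t ht => by linarith [(abs_le.mp (hAQ n t ht)).1]) ξ (fun t ht => (hS t ht).1)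
    (ι := Fin 2) ![fun t a b => mism (f t a) b, fun t a b => mism (g t b) a]
    (by intro i; fin_cases i <;> exact fun _ _ _ => mism_mem _ _) (fun _ => ε)
    (by intro i t ht; fin_cases i; exacts [(hS t ht).2.1, (hS t ht).2.2]) hδ0 hδ1
  obtain ⟨r', ξ₂, g₂, h₂⟩ := exists_block_step Q P hQ1 hP1 Adm hAdm hAQ hAP (n := n + r) hc₀
    (fun t ht => by
      have h1 := (abs_le.mp (hAP _ t ht)).1
      have h2 : (2 : ℝ) ^ n * h ≤ 2 ^ (n + r) * h := by
        gcongr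
        · norm_num
        · omega
      linarith)
    (fun t b a => ξ₁ t a b) (fun t ht => (h₁ t ht).1.swap)
    (ι := Fin 3) ![fun t b a => mism (liftRule r f t a) b, fun t b a => mism (liftRule r g t b) a,
      fun t b a => mism (f₁ t a) b]
    (by intro i; fin_cases i <;> exact fun _ _ _ => mism_mem _ _)
    ![ε + δ, ε + δ, δ]
    (by
      intro i t ht
      have hl := (h₁ t ht).2.1
      fin_cases i
      · rw [Finset.sum_comm]
        simpa [mism_liftRule] using hl 0
      · rw [Finset.sum_comm]
        have := hl 1
        have e : ∀ a b, mism (liftRule r g t b) a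
          = liftCost r (fun t a b => mism (g t b) a) t a b := fun a b => mism_liftRule r g t b a
        simpa [e] using this
      · rw [Finset.sum_comm]
        simpa using (h₁ t ht).2.2) hδ0 hδ1
  refine ⟨r, r', fun t a b => ξ₂ t b a, liftRule r' f₁, g₂, fun t ht => ⟨(h₂ t ht).1.swap, ?_, ?_⟩,
    fun t ht => ⟨(h₂ t ht).1.swap, ?_, ?_⟩⟩
  · have := (h₂ t ht).2.1 2
    have e : ∀ a b, mism (liftRule r' f₁ t a) b
      = liftCost r' (fun t b a => mism (f₁ t a) b) t b a := fun a b => mism_liftRule r' f₁ t a b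
    rw [Finset.sum_comm]
    simp only [e]
    refine this.trans ?_
    simp only [Matrix.cons_val]
    linarith
  · rw [Finset.sum_comm]
    exact (h₂ t ht).2.2.trans (by linarith)
  · have := (h₂ t ht).2.1 0
    have e : ∀ a b, mism (liftRule r' (liftRule r f) t a) b
      = liftCost r' (fun t b a => mism (liftRule r f t a) b) t b a :=
        fun a b => mism_liftRule r' _ t a b
    rw [Finset.sum_comm]
    simp only [e]
    refine this.trans ?_
    simp only [Matrix.cons_val]
    linarith
  · have := (h₂ t ht).2.1 1
    have e : ∀ a b, mism (liftRule r' (liftRule r g) t b) a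
      = liftCost r' (fun t b a => mism (liftRule r g t b) a) t b a :=
        fun a b => mism_liftRule r' _ t b a
    rw [Finset.sum_comm]
    simp only [e]
    refine this.trans ?_
    simp only [Matrix.cons_val]
    linarith

/-- The product coupling is a stage. -/
theorem isStage_one {I 𝒜 ℱ : Type} [Fintype 𝒜] [Fintype ℱ] {P : I → 𝒜 → ℝ} {Q : I → ℱ → ℝ}
    (hP0 : ∀ i a, 0 ≤ P i a) (hQ0 : ∀ i b, 0 ≤ Q i b)
    (hP1 : ∀ i, ∑ a, P i a = 1) (hQ1 : ∀ i, ∑ b, Q i b = 1)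
    (Adm : ∀ n, (Pos n → I) → Prop) (n : ℕ)
    (f : (Pos n → I) → (Pos n → 𝒜) → Pos n → ℱ) (g : (Pos n → I) → (Pos n → ℱ) → Pos n → 𝒜) :
    IsStage P Q Adm n 1 (fun t a b => blockWeight P t a * blockWeight Q t b) f g := by
  intro t _
  have hp := sum_blockWeight hP1 t
  have hq := sum_blockWeight hQ1 t
  have h0 : ∀ a b, 0 ≤ blockWeight P t a * blockWeight Q t b := fun a b =>
    mul_nonneg (blockWeight_nonneg hP0 t a) (blockWeight_nonneg hQ0 t b)
  have h1 : ∑ a, ∑ b, blockWeight P t a * blockWeight Q t b = 1 := by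
    simp_rw [← Finset.mul_sum, hq, mul_one, hp]
  refine ⟨⟨h0, fun a => by rw [← Finset.mul_sum, hq, mul_one],
    fun b => by rw [← Finset.sum_mul, hp, one_mul]⟩, ?_, ?_⟩
  all_goals
    rw [← h1]
    exact Finset.sum_le_sum fun a _ => Finset.sum_le_sum fun b _ =>
      mul_le_of_le_one_right (h0 a b) (mism_le_one _ _)

theorem IsStage.swap {I 𝒜 ℱ : Type} [Fintype 𝒜] [Fintype ℱ] {P : I → 𝒜 → ℝ} {Q : I → ℱ → ℝ}
    {Adm : ∀ n, (Pos n → I) → Prop} {n : ℕ} {ε : ℝ}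
    {ξ : (Pos n → I) → (Pos n → 𝒜) → (Pos n → ℱ) → ℝ}
    {f : (Pos n → I) → (Pos n → 𝒜) → Pos n → ℱ} {g : (Pos n → I) → (Pos n → ℱ) → Pos n → 𝒜}
    (hS : IsStage P Q Adm n ε ξ f g) : IsStage Q P Adm n ε (fun t b a => ξ t a b) g f := by
  intro t ht
  obtain ⟨h1, h2, h3⟩ := hS t ht
  refine ⟨h1.swap, ?_, ?_⟩ <;> rw [Finset.sum_comm] <;> assumption

/-- Two rules approximating the same labelling are close to each other. -/
theorem IsStage.rule_close {I 𝒜 ℱ : Type} [Fintype 𝒜] [Fintype ℱ] {P : I → 𝒜 → ℝ} {Q : I → ℱ → ℝ}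
    {Adm : ∀ n, (Pos n → I) → Prop} {n : ℕ} {ε ε' : ℝ}
    {ξ : (Pos n → I) → (Pos n → 𝒜) → (Pos n → ℱ) → ℝ}
    {f f' : (Pos n → I) → (Pos n → 𝒜) → Pos n → ℱ}
    {g g' : (Pos n → I) → (Pos n → ℱ) → Pos n → 𝒜}
    (hS : IsStage P Q Adm n ε ξ f g) (hS' : IsStage P Q Adm n ε' ξ f' g')
    (t : Pos n → I) (ht : Adm n t) :
    ∑ a, blockWeight P t a * mism (f t a) (f' t a) ≤ ε + ε' := by
  obtain ⟨⟨h0, hr, -⟩, h2, -⟩ := hS t ht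
  obtain ⟨-, h2', -⟩ := hS' t ht
  refine le_trans ?_ (add_le_add h2 h2')
  rw [← Finset.sum_add_distrib]
  refine Finset.sum_le_sum fun a _ => ?_
  rw [← hr, Finset.sum_mul, ← Finset.sum_add_distrib]
  refine Finset.sum_le_sum fun b _ => ?_
  rw [← mul_add]
  refine mul_le_mul_of_nonneg_left ?_ (h0 a b)
  rw [mism_comm (f' t a) b]
  exact mism_triangle _ _ _

/-- A rule is Lipschitz with constant `K` for the mismatch distance. -/
def IsLipRule {n : ℕ} {I 𝒜 ℱ : Type} (K : ℝ) (φ : (Pos n → I) → (Pos n → 𝒜) → Pos n → ℱ) : Prop :=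
  ∀ t a a', mism (φ t a) (φ t a') ≤ K * mism a a'

theorem isLipRule_two_pow {n : ℕ} {I 𝒜 ℱ : Type} (φ : (Pos n → I) → (Pos n → 𝒜) → Pos n → ℱ) :
    IsLipRule (2 ^ n) φ := by
  intro t a a'
  by_cases h : a = a'
  · subst h; simp [mism]
  · obtain ⟨p, hp⟩ := Function.ne_iff.mp h
    refine (mism_le_one _ _).trans ?_
    rw [mism, mul_div_cancel₀ _ (by positivity), ← discrep_of_ne hp]
    exact Finset.single_le_sum (f := fun p => discrep (a p) (a' p))
      (fun p _ => discrep_nonneg _ _) (Finset.mem_univ p)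

theorem mism_eq_avg {n r : ℕ} {ℱ : Type} (b b' : Pos (n + r) → ℱ) :
    mism b b' = (∑ j : Pos r, mism (subBlock b j) (subBlock b' j)) / 2 ^ r := by
  rw [mism, sum_pos_append]
  simp only [mism, subBlock]
  rw [← Finset.sum_div, div_div, pow_add]

theorem IsLipRule.liftRule {n : ℕ} {I 𝒜 ℱ : Type} {K : ℝ}
    {φ : (Pos n → I) → (Pos n → 𝒜) → Pos n → ℱ} (hφ : IsLipRule K φ) (r : ℕ) :
    IsLipRule K (liftRule r φ) := by
  intro t a a'
  rw [mism_eq_avg, mism_eq_avg a a', mul_div_assoc', Finset.mul_sum]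
  refine div_le_div_of_nonneg_right (Finset.sum_le_sum fun j _ => ?_) (by positivity)
  have e : ∀ a, subBlock (_root_.liftRule r φ t a) j = φ (subBlock t j) (subBlock a j) := by
    intro a; funext w; simp [subBlock, _root_.liftRule]
  rw [e, e]
  exact hφ _ _ _

/-- A Lipschitz decoding rule decodes the output of an accurate coding rule. -/
theorem IsStage.decode {I 𝒜 ℱ : Type} [Fintype 𝒜] [Fintype ℱ] {P : I → 𝒜 → ℝ} {Q : I → ℱ → ℝ}
    {Adm : ∀ n, (Pos n → I) → Prop} {n : ℕ} {ε ε' K : ℝ} (hK : 0 ≤ K)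
    {ξ : (Pos n → I) → (Pos n → 𝒜) → (Pos n → ℱ) → ℝ}
    {f f' : (Pos n → I) → (Pos n → 𝒜) → Pos n → ℱ}
    {g g' : (Pos n → I) → (Pos n → ℱ) → Pos n → 𝒜}
    (hS : IsStage P Q Adm n ε ξ f g) (hS' : IsStage P Q Adm n ε' ξ f' g') (hg : IsLipRule K g)
    (t : Pos n → I) (ht : Adm n t) :
    ∑ a, blockWeight P t a * mism (g t (f' t a)) a ≤ ε + K * ε' := by
  obtain ⟨⟨h0, hr, -⟩, -, h2⟩ := hS t ht
  obtain ⟨-, h2', -⟩ := hS' t ht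
  refine le_trans ?_ (add_le_add h2 (mul_le_mul_of_nonneg_left h2' hK))
  rw [Finset.mul_sum, ← Finset.sum_add_distrib]
  refine Finset.sum_le_sum fun a _ => ?_
  rw [← hr, Finset.sum_mul, Finset.mul_sum, ← Finset.sum_add_distrib]
  refine Finset.sum_le_sum fun b _ => ?_
  have h3 := mism_triangle (g t (f' t a)) (g t b) a
  have h4 := hg t (f' t a) b
  have h5 := h0 a b
  calc ξ t a b * mism (g t (f' t a)) a
      ≤ ξ t a b * (mism (g t b) a + K * mism (f' t a) b) :=
        mul_le_mul_of_nonneg_left (by linarith) h5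
    _ = _ := by ring

end Stages

noncomputable section Transport

variable {G X : Type} [Group G] [Countable G] [MeasurableSpace X]

theorem IsMPAction.lintegral_comp {ν : Measure X} {τ : G → X → X} (hτ : IsMPAction ν τ) (g : G)
    {f : X → ℝ≥0∞} (hf : Measurable f) : ∫⁻ x, f (τ g x) ∂ν = ∫⁻ x, f x ∂ν := by
  conv_rhs => rw [← hτ.2.2.2 g]
  rw [lintegral_map hf (hτ.2.2.1 g)]

theorem IsMPAction.inv_apply {ν : Measure X} {τ : G → X → X} (hτ : IsMPAction ν τ) (g : G)
    (x : X) : τ g⁻¹ (τ g x) = x := by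
  rw [← hτ.2.1, inv_mul_cancel, hτ.1]

theorem IsMPAction.apply_inv {ν : Measure X} {τ : G → X → X} (hτ : IsMPAction ν τ) (g : G)
    (x : X) : τ g (τ g⁻¹ x) = x := by
  rw [← hτ.2.1, mul_inv_cancel, hτ.1]

theorem IsMPAction.ae_of_ae {ν : Measure X} {τ : G → X → X} (hτ : IsMPAction ν τ) {p : X → Prop}
    (hp : ∀ᵐ x ∂ν, p x) (g : G) : ∀ᵐ x ∂ν, p (τ g x) :=
  ae_of_ae_map (hτ.2.2.1 g).aemeasurable (by rwa [hτ.2.2.2 g])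

/-- A choice of group elements is measurable. -/
def MeasCode (γ : X → G) : Prop := ∀ g, MeasurableSet {x | γ x = g}

theorem MeasCode.const (g : G) : MeasCode fun _ : X => g := fun _ => .const _

theorem MeasCode.mul {γ δ : X → G} (hγ : MeasCode γ) (hδ : MeasCode δ) :
    MeasCode fun x => γ x * δ x := by
  intro g
  have : {x | γ x * δ x = g} = ⋃ h : G, {x | γ x = h} ∩ {x | δ x = h⁻¹ * g} := by
    ext x
    simp only [Set.mem_ofPred_eq, Set.mem_iUnion, Set.mem_inter_iff]
    exact ⟨fun h => ⟨γ x, rfl, by rw [← h]; group⟩, fun ⟨h, h1, h2⟩ => by rw [h1, h2]; group⟩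
  rw [this]
  exact .iUnion fun h => (hγ _).inter (hδ _)

theorem MeasCode.measurable_comp {Y : Type} [MeasurableSpace Y] {γ : X → G} (hγ : MeasCode γ)
    {F : G → X → Y} (hF : ∀ g, Measurable (F g)) : Measurable fun x => F (γ x) x := by
  intro s hs
  have : (fun x => F (γ x) x) ⁻¹' s = ⋃ g : G, {x | γ x = g} ∩ F g ⁻¹' s := by
    ext x; simp
  rw [this]
  exact .iUnion fun g => (hγ g).inter (hF g hs)

theorem MeasCode.ite {γ δ : X → G} (hγ : MeasCode γ) (hδ : MeasCode δ) {s : Set X}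
    (hs : MeasurableSet s) : MeasCode fun x => if x ∈ s then γ x else δ x := by
  intro g
  have : {x | (if x ∈ s then γ x else δ x) = g}
      = (s ∩ {x | γ x = g}) ∪ (sᶜ ∩ {x | δ x = g}) := by
    ext x
    by_cases h : x ∈ s <;> simp [h]
  rw [this]
  exact (hs.inter (hγ g)).union (hs.compl.inter (hδ g))

theorem MeasCode.comp {Y : Type} [MeasurableSpace Y] {γ : X → G} (hγ : MeasCode γ) {f : Y → X}
    (hf : Measurable f) : MeasCode fun y => γ (f y) := fun g => hf (hγ g)

theorem MeasCode.comp_code {γ δ : X → G} (hγ : MeasCode γ) (hδ : MeasCode δ) {τ : G → X → X}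
    (hτ : ∀ g, Measurable (τ g)) : MeasCode fun x => γ (τ (δ x) x) := by
  intro g
  have h1 : MeasurableSet ((fun x => τ (δ x) x) ⁻¹' {x | γ x = g}) :=
    hδ.measurable_comp hτ (hγ g)
  exact h1

/-- A piecewise application of the action carrying `A` bijectively onto `B` preserves the
measure. -/
theorem IsMPAction.lintegral_transport {ν : Measure X} {τ : G → X → X} (hτ : IsMPAction ν τ)
    {A B : Set X} (hA : MeasurableSet A) (hB : MeasurableSet B) {γ δ : X → G}
    (hγ : MeasCode γ) (hδ : MeasCode δ)
    (hγB : ∀ x ∈ A, τ (γ x) x ∈ B) (hδA : ∀ y ∈ B, τ (δ y) y ∈ A)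
    (hδγ : ∀ x ∈ A, δ (τ (γ x) x) = (γ x)⁻¹) (hγδ : ∀ y ∈ B, γ (τ (δ y) y) = (δ y)⁻¹)
    {f : X → ℝ≥0∞} (hf : Measurable f) :
    ∫⁻ x in A, f (τ (γ x) x) ∂ν = ∫⁻ y in B, f y ∂ν := by
  have hd1 : Pairwise (Function.onFun Disjoint fun g : G => A ∩ {x | γ x = g}) := by
    intro g g' hgg
    refine Set.disjoint_left.mpr ?_
    rintro x ⟨-, h1⟩ ⟨-, h2⟩
    exact hgg (h1.symm.trans h2)
  have hd2 : Pairwise (Function.onFun Disjoint fun g : G => B ∩ {x | δ x = g⁻¹}) := by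
    intro g g' hgg
    refine Set.disjoint_left.mpr ?_
    rintro x ⟨-, h1⟩ ⟨-, h2⟩
    exact hgg (inv_injective (h1.symm.trans h2))
  have eA : A = ⋃ g : G, A ∩ {x | γ x = g} := by
    rw [← Set.inter_iUnion]; ext x; simp
  have eB : B = ⋃ g : G, B ∩ {x | δ x = g⁻¹} := by
    rw [← Set.inter_iUnion]; ext x
    simp only [Set.mem_inter_iff, Set.mem_iUnion, Set.mem_ofPred_eq]
    exact ⟨fun h => ⟨h, (δ x)⁻¹, by simp⟩, fun h => h.1⟩
  rw [eA, eB, lintegral_iUnion (fun g => hA.inter (hγ g)) hd1,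
    lintegral_iUnion (fun g => hB.inter (hδ _)) hd2]
  congr 1
  funext g
  rw [← lintegral_indicator (hA.inter (hγ g)), ← lintegral_indicator (hB.inter (hδ _)),
    ← hτ.lintegral_comp g (hf.indicator (hB.inter (hδ _)))]
  congr 1
  funext x
  by_cases h : x ∈ A ∩ {x | γ x = g}
  · have h2 : τ g x ∈ B ∩ {x | δ x = g⁻¹} := by
      obtain ⟨h1, rfl⟩ := h
      exact ⟨hγB x h1, hδγ x h1⟩
    rw [Set.indicator_of_mem h, Set.indicator_of_mem h2, h.2]
  · have h2 : τ g x ∉ B ∩ {x | δ x = g⁻¹} := by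
      rintro ⟨h1, h3⟩
      have h4 := hδA _ h1
      have h5 := hγδ _ h1
      rw [h3, hτ.inv_apply] at h4 h5
      exact h ⟨h4, by rw [Set.mem_ofPred_eq, h5, inv_inv]⟩
    rw [Set.indicator_of_notMem h, Set.indicator_of_notMem h2]

/-- A hyperfinite dyadic tower: over a good invariant set, `θ n x w` is the group element moving
`x` to the point of position `w` in the block of level `n` containing `x`. -/
structure Tower (τ : G → X → X) where
  good : Set X
  good_meas : MeasurableSet good
  good_inv : ∀ g x, x ∈ good → τ g x ∈ good
  bits : ℕ → X → Bool
  bits_meas : ∀ n, Measurable (bits n)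
  θ : ∀ n, X → Pos n → G
  θ_meas : ∀ n w, MeasCode fun x => θ n x w
  θ_self : ∀ n x, x ∈ good → θ n x (fun i => bits i x) = 1
  bits_θ : ∀ n x w, x ∈ good → (fun i : Fin n => bits i (τ (θ n x w) x)) = w
  θ_cocycle : ∀ n x w w', x ∈ good → θ n (τ (θ n x w) x) w' * θ n x w = θ n x w'
  θ_nest : ∀ n r x w, x ∈ good →
    θ (n + r) x (Fin.append w (fun i => bits (Fin.natAdd n i : Fin (n + r)) x)) = θ n x w

namespace Tower

variable {τ : G → X → X} (T : Tower τ)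

/-- The position of a point in its block of level `n`. -/
def pos (n : ℕ) (x : X) : Pos n := fun i => T.bits i x

theorem pos_meas (n : ℕ) : Measurable (T.pos n) := measurable_pi_lambda _ fun _ => T.bits_meas _

theorem pos_θ {n : ℕ} {x : X} (hx : x ∈ T.good) (w : Pos n) : T.pos n (τ (T.θ n x w) x) = w :=
  T.bits_θ n x w hx

theorem headPos_pos (n r : ℕ) (x : X) : headPos (T.pos (n + r) x) = T.pos n x := rfl

theorem θ_append {n r : ℕ} {x : X} (hx : x ∈ T.good) (w : Pos n) :
    T.θ (n + r) x (Fin.append w (tailPos (T.pos (n + r) x))) = T.θ n x w :=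
  T.θ_nest n r x w hx

theorem measurable_move (hτ : ∀ g, Measurable (τ g)) (n : ℕ) (w : Pos n) :
    Measurable fun x => τ (T.θ n x w) x := (T.θ_meas n w).measurable_comp hτ

theorem θ_injective {n : ℕ} {x : X} (hx : x ∈ T.good) : Function.Injective (T.θ n x) := by
  intro w w' h
  rw [← T.pos_θ hx w, h, T.pos_θ hx]

/-- The mass transport principle for blocks. -/
theorem lintegral_sum {ν : Measure X} (hτ : IsMPAction ν τ) (hgood : ∀ᵐ x ∂ν, x ∈ T.good) (n : ℕ)
    {f : X → ℝ≥0∞} (hf : Measurable f) :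
    ∫⁻ x, ∑ w, f (τ (T.θ n x w) x) ∂ν = 2 ^ n * ∫⁻ x, f x ∂ν := by
  have hS : ∀ w : Pos n, MeasurableSet (T.good ∩ {x | T.pos n x = w}) := fun w =>
    T.good_meas.inter (T.pos_meas n (measurableSet_singleton w))
  have hsplit : ∀ F : X → ℝ≥0∞, ∫⁻ x, F x ∂ν = ∑ w, ∫⁻ x in T.good ∩ {x | T.pos n x = w}, F x ∂ν := by
    intro F
    have hu : (⋃ w : Pos n, T.good ∩ {x | T.pos n x = w}) = T.good := by
      rw [← Set.inter_iUnion]; ext x; simp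
    have h0 : ∫⁻ x, F x ∂ν = ∫⁻ x in T.good, F x ∂ν := by
      rw [Measure.restrict_eq_self_of_ae_mem hgood]
    rw [h0]
    conv_lhs => rw [← hu]
    rw [lintegral_iUnion hS, tsum_fintype]
    intro w w' hww
    refine Set.disjoint_left.mpr ?_
    rintro x ⟨-, h1⟩ ⟨-, h2⟩
    exact hww (h1.symm.trans h2)
  have hmove : ∀ w, Measurable fun x => f (τ (T.θ n x w) x) := fun w =>
    hf.comp (T.measurable_move hτ.2.2.1 n w)
  rw [lintegral_finsetSum _ fun w _ => hmove w]
  have htr : ∀ w w' : Pos n, ∫⁻ x in T.good ∩ {x | T.pos n x = w'}, f (τ (T.θ n x w) x) ∂ν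
      = ∫⁻ x in T.good ∩ {x | T.pos n x = w}, f x ∂ν := by
    have aux : ∀ w w' : Pos n, ∀ x ∈ T.good ∩ {x | T.pos n x = w'},
        T.θ n (τ (T.θ n x w) x) w' = (T.θ n x w)⁻¹ := by
      rintro w w' x ⟨hx, hp⟩
      have h1 := T.θ_cocycle n x w w' hx
      have h2 := T.θ_self n x hx
      rw [eq_inv_iff_mul_eq_one, h1, ← hp]
      exact h2
    intro w w'
    exact hτ.lintegral_transport (hS w') (hS w) (T.θ_meas n w) (T.θ_meas n w')
      (fun x hx => ⟨T.good_inv _ _ hx.1, T.pos_θ hx.1 w⟩)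
      (fun x hx => ⟨T.good_inv _ _ hx.1, T.pos_θ hx.1 w'⟩)
      (aux w w') (aux w' w) hf
  calc ∑ w, ∫⁻ x, f (τ (T.θ n x w) x) ∂ν
      = ∑ w, ∑ w' : Pos n, ∫⁻ x in T.good ∩ {x | T.pos n x = w}, f x ∂ν := by
        refine Finset.sum_congr rfl fun w _ => ?_
        rw [hsplit]
        exact Finset.sum_congr rfl fun w' _ => htr w w'
    _ = 2 ^ n * ∑ w, ∫⁻ x in T.good ∩ {x | T.pos n x = w}, f x ∂ν := by
        rw [Finset.mul_sum]
        refine Finset.sum_congr rfl fun w _ => ?_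
        rw [Finset.sum_const, Finset.card_univ, nsmul_eq_mul]
        simp
    _ = _ := by rw [← hsplit]

/-- The pull-back of a tower along an equivariant map. -/
def comap {Z : Type} [MeasurableSpace Z] {τ' : G → Z → Z} (π : Z → X) (hπ : Measurable π)
    (he : ∀ g z, π (τ' g z) = τ g (π z)) : Tower τ' where
  good := π ⁻¹' T.good
  good_meas := hπ T.good_meas
  good_inv g z hz := by
    rw [Set.mem_preimage, he]; exact T.good_inv g _ hz
  bits n z := T.bits n (π z)
  bits_meas n := (T.bits_meas n).comp hπ
  θ n z := T.θ n (π z)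
  θ_meas n w := (T.θ_meas n w).comp hπ
  θ_self n z hz := T.θ_self n _ hz
  bits_θ n z w hz := by simp only [he]; exact T.bits_θ n _ w hz
  θ_cocycle n z w w' hz := by simp only [he]; exact T.θ_cocycle n _ w w' hz
  θ_nest n r z w hz := T.θ_nest n r _ w hz

end Tower

end Transport

noncomputable section Pairing

theorem exists_quantile (μ : Measure ℝ) [IsFiniteMeasure μ] {t : ℝ≥0∞} (h0 : 0 < t)
    (h1 : t < μ Set.univ) : ∃ c : ℝ, μ (Set.Iio c) ≤ t ∧ t ≤ μ (Set.Iic c) := by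
  have hne : ∃ c : ℝ, t ≤ μ (Set.Iic c) := by
    have h := tendsto_measure_iUnion_atTop (μ := μ) (s := fun n : ℕ => Set.Iic (n : ℝ))
      (fun a b hab => Set.Iic_subset_Iic.mpr (by exact_mod_cast hab))
    have hu : (⋃ n : ℕ, Set.Iic (n : ℝ)) = Set.univ := by
      ext x; simpa using exists_nat_ge x
    rw [hu] at h
    obtain ⟨n, hn⟩ := (h.eventually (lt_mem_nhds h1)).exists
    exact ⟨n, hn.le⟩
  have hbd : ∃ b : ℝ, μ (Set.Iic b) < t := by
    have h := tendsto_measure_iInter_atTop (μ := μ) (s := fun n : ℕ => Set.Iic (-(n : ℝ)))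
      (fun n => measurableSet_Iic.nullMeasurableSet)
      (fun a b hab => Set.Iic_subset_Iic.mpr (by simpa using hab)) ⟨0, measure_ne_top _ _⟩
    have hu : (⋂ n : ℕ, Set.Iic (-(n : ℝ))) = ∅ := by
      ext x
      simp only [Set.mem_iInter, Set.mem_Iic, Set.mem_empty_iff_false, iff_false, not_forall, not_le]
      obtain ⟨n, hn⟩ := exists_nat_gt (-x)
      exact ⟨n, by linarith⟩
    rw [hu, measure_empty] at h
    obtain ⟨n, hn⟩ := (h.eventually (gt_mem_nhds h0)).exists
    exact ⟨_, hn⟩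
  obtain ⟨b, hb⟩ := hbd
  set A : Set ℝ := {c | t ≤ μ (Set.Iic c)} with hA
  have hAb : BddBelow A := ⟨b, fun c hc => by
    by_contra hlt
    push Not at hlt
    exact absurd (hc.trans (measure_mono (Set.Iic_subset_Iic.mpr hlt.le))) (not_le.mpr hb)⟩
  refine ⟨sInf A, ?_, ?_⟩
  · have h := tendsto_measure_iUnion_atTop (μ := μ)
      (s := fun n : ℕ => Set.Iic (sInf A - 1 / ((n : ℝ) + 1)))
      (fun a b hab => Set.Iic_subset_Iic.mpr (by
        have : 1 / ((b : ℝ) + 1) ≤ 1 / ((a : ℝ) + 1) := Nat.one_div_le_one_div hab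
        linarith))
    have hu : (⋃ n : ℕ, Set.Iic (sInf A - 1 / ((n : ℝ) + 1))) = Set.Iio (sInf A) := by
      ext x
      simp only [Set.mem_iUnion, Set.mem_Iic, Set.mem_Iio]
      constructor
      · rintro ⟨n, hn⟩
        have : (0 : ℝ) < 1 / ((n : ℝ) + 1) := Nat.one_div_pos_of_nat
        linarith
      · intro hx
        obtain ⟨n, hn⟩ := exists_nat_one_div_lt (sub_pos.mpr hx)
        exact ⟨n, by linarith⟩
    rw [hu] at h
    refine le_of_tendsto h (Eventually.of_forall fun n => ?_)
    by_contra hlt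
    push Not at hlt
    have h2 : sInf A ≤ sInf A - 1 / ((n : ℝ) + 1) := csInf_le hAb hlt.le
    have : (0 : ℝ) < 1 / ((n : ℝ) + 1) := Nat.one_div_pos_of_nat
    linarith
  · have h := tendsto_measure_iInter_atTop (μ := μ)
      (s := fun n : ℕ => Set.Iic (sInf A + 1 / ((n : ℝ) + 1)))
      (fun n => measurableSet_Iic.nullMeasurableSet)
      (fun a b hab => Set.Iic_subset_Iic.mpr (by
        have : 1 / ((b : ℝ) + 1) ≤ 1 / ((a : ℝ) + 1) := Nat.one_div_le_one_div hab
        linarith)) ⟨0, measure_ne_top _ _⟩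
    have hu : (⋂ n : ℕ, Set.Iic (sInf A + 1 / ((n : ℝ) + 1))) = Set.Iic (sInf A) := by
      ext x
      simp only [Set.mem_iInter, Set.mem_Iic]
      constructor
      · intro hx
        refine le_of_forall_pos_le_add fun ε hε => ?_
        obtain ⟨n, hn⟩ := exists_nat_one_div_lt hε
        linarith [hx n]
      · intro hx n
        have : (0 : ℝ) < 1 / ((n : ℝ) + 1) := Nat.one_div_pos_of_nat
        linarith
    rw [hu] at h
    refine ge_of_tendsto h (Eventually.of_forall fun n => ?_)
    have hp : (0 : ℝ) < 1 / ((n : ℝ) + 1) := Nat.one_div_pos_of_nat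
    obtain ⟨c, hc, hlt⟩ := exists_lt_of_csInf_lt (s := A) hne (lt_add_of_pos_right (sInf A) hp)
    exact le_trans hc (measure_mono (Set.Iic_subset_Iic.mpr hlt.le))

variable {G X : Type} [Group G] [Countable G] [MeasurableSpace X]

/-- Subsets of every intermediate measure exist for nonatomic measures. -/
theorem exists_subset_measure_eq [StandardBorelSpace X] {ν : Measure X} [IsFiniteMeasure ν]
    [NullSingletonClass ν] {A : Set X} (hA : MeasurableSet A) {t : ℝ≥0∞} (ht : t ≤ ν A) :
    ∃ B ⊆ A, MeasurableSet B ∧ ν B = t := by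
  rcases eq_or_lt_of_le ht with h | h
  · exact ⟨A, subset_rfl, hA, h.symm⟩
  rcases eq_or_ne t 0 with h0 | h0
  · exact ⟨∅, Set.empty_subset _, .empty, by rw [h0, measure_empty]⟩
  have he := measurableEmbedding_embeddingReal X
  set e := embeddingReal X
  have hmap : ∀ s, MeasurableSet s → ((ν.restrict A).map e) s = ν (A ∩ e ⁻¹' s) := by
    intro s hs
    rw [Measure.map_apply he.measurable hs, Measure.restrict_apply (he.measurable hs),
      Set.inter_comm]
  obtain ⟨c, hc1, hc2⟩ := exists_quantile ((ν.restrict A).map e) (pos_iff_ne_zero.mpr h0)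
    (by rw [hmap _ .univ]; simpa using h)
  rw [hmap _ measurableSet_Iio] at hc1
  rw [hmap _ measurableSet_Iic] at hc2
  refine ⟨A ∩ e ⁻¹' Set.Iic c, Set.inter_subset_left, hA.inter (he.measurable measurableSet_Iic),
    le_antisymm ?_ hc2⟩
  have hsub : A ∩ e ⁻¹' Set.Iic c ⊆ (A ∩ e ⁻¹' Set.Iio c) ∪ e ⁻¹' {c} := by
    rintro x ⟨hx, hxc⟩
    rcases lt_or_eq_of_le (show e x ≤ c from hxc) with h | h
    · exact Or.inl ⟨hx, h⟩
    · exact Or.inr h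
  have hnull : ν (e ⁻¹' {c}) = 0 := by
    refine Set.Subsingleton.measure_zero (fun x hx y hy => he.injective ?_) ν
    exact (show e x = c from hx).trans (show e y = c from hy).symm
  calc ν (A ∩ e ⁻¹' Set.Iic c) ≤ ν (A ∩ e ⁻¹' Set.Iio c) + ν (e ⁻¹' {c}) :=
        (measure_mono hsub).trans (measure_union_le _ _)
    _ ≤ t := by rw [hnull, add_zero]; exact hc1

/-- Halving a set along the level sets of a function. -/
theorem exists_halving [StandardBorelSpace X] {ν : Measure X} [IsFiniteMeasure ν]
    [NullSingletonClass ν] {Y : Set X} (hY : MeasurableSet Y) {u : X → ℝ} (hu : Measurable u) {a : ℝ}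
    (ha : ∀ x ∈ Y, a ≤ u x) :
    ∃ U ⊆ Y, MeasurableSet U ∧ ν U = ν (Y \ U) ∧
      ∃ c : ℝ, (∀ x ∈ U, u x ≤ c) ∧ ∀ x ∈ Y \ U, c ≤ u x := by
  rcases eq_or_ne (ν Y) 0 with h0 | h0
  · exact ⟨∅, Set.empty_subset _, .empty, by simp [h0], a, by simp, fun x hx => ha x hx.1⟩
  have hmap : ∀ s, MeasurableSet s → ((ν.restrict Y).map u) s = ν (Y ∩ u ⁻¹' s) := by
    intro s hs
    rw [Measure.map_apply hu hs, Measure.restrict_apply (hu hs), Set.inter_comm]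
  obtain ⟨c, hc1, hc2⟩ := exists_quantile ((ν.restrict Y).map u) (t := ν Y / 2)
    (ENNReal.half_pos h0)
    (by rw [hmap _ .univ]; simpa using ENNReal.half_lt_self h0 (measure_ne_top _ _))
  rw [hmap _ measurableSet_Iio] at hc1
  rw [hmap _ measurableSet_Iic] at hc2
  have hm1 : MeasurableSet (Y ∩ u ⁻¹' Set.Iio c) := hY.inter (hu measurableSet_Iio)
  have hm2 : MeasurableSet (Y ∩ u ⁻¹' {c}) := hY.inter (hu (measurableSet_singleton c))
  have hd : Disjoint (Y ∩ u ⁻¹' Set.Iio c) (Y ∩ u ⁻¹' {c}) := by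
    refine Set.disjoint_left.mpr ?_
    rintro x ⟨-, h1⟩ ⟨-, h2⟩
    exact absurd (show u x = c from h2) (ne_of_lt h1)
  have hun : Y ∩ u ⁻¹' Set.Iic c = (Y ∩ u ⁻¹' Set.Iio c) ∪ (Y ∩ u ⁻¹' {c}) := by
    rw [← Set.inter_union_distrib_left, ← Set.preimage_union, Set.union_comm, Set.singleton_union,
      Set.Iio_insert]
  rw [hun, measure_union hd hm2] at hc2
  obtain ⟨B, hB, hBm, hBν⟩ := exists_subset_measure_eq (ν := ν) hm2
    (t := ν Y / 2 - ν (Y ∩ u ⁻¹' Set.Iio c)) (tsub_le_iff_left.mpr hc2)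
  have hU : ν ((Y ∩ u ⁻¹' Set.Iio c) ∪ B) = ν Y / 2 := by
    rw [measure_union (hd.mono_right hB) hBm, hBν, add_tsub_cancel_of_le hc1]
  refine ⟨(Y ∩ u ⁻¹' Set.Iio c) ∪ B, ?_, hm1.union hBm, ?_, c, ?_, ?_⟩
  · exact Set.union_subset Set.inter_subset_left (hB.trans Set.inter_subset_left)
  · rw [measure_sdiff (Set.union_subset Set.inter_subset_left (hB.trans Set.inter_subset_left))
      (hm1.union hBm).nullMeasurableSet (measure_ne_top _ _), hU]
    exact (ENNReal.sub_half (measure_ne_top _ _)).symm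
  · rintro x (hx | hx)
    · exact (show u x < c from hx.2).le
    · exact (show u x = c from (hB hx).2).le
  · rintro x ⟨hx, hxU⟩
    by_contra hlt
    push Not at hlt
    exact hxU (Or.inl ⟨hx, hlt⟩)

/-- The unmatched parts in the greedy matching of `U` and `V`. -/
def greedyRest (τ : G → X → X) (g : ℕ → G) (U V : Set X) : ℕ → Set X × Set X
  | 0 => (U, V)
  | n + 1 => ({x | x ∈ (greedyRest τ g U V n).1 ∧ τ (g n) x ∉ (greedyRest τ g U V n).2},
      {y | y ∈ (greedyRest τ g U V n).2 ∧ τ (g n)⁻¹ y ∉ (greedyRest τ g U V n).1})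

theorem exists_pairing {ν : Measure X} [IsFiniteMeasure ν] {τ : G → X → X} (hτ : IsMPAction ν τ)
    (herg : ∀ U V, MeasurableSet U → MeasurableSet V → ν U ≠ 0 → ν V ≠ 0 →
      ∃ g, ν (U ∩ τ g ⁻¹' V) ≠ 0)
    {U V : Set X} (hU : MeasurableSet U) (hV : MeasurableSet V) (hUV : Disjoint U V)
    (heq : ν U = ν V) :
    ∃ (γ : X → G) (N : Set X), MeasCode γ ∧ MeasurableSet N ∧ ν N = 0 ∧
      (∀ x ∈ U, x ∉ N → τ (γ x) x ∈ V) ∧ (∀ x ∈ V, x ∉ N → τ (γ x) x ∈ U) ∧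
      ∀ x ∈ U ∪ V, x ∉ N → γ (τ (γ x) x) = (γ x)⁻¹ := by
  obtain ⟨g, hg⟩ := exists_surjective_nat G
  set R := greedyRest τ g U V with hR
  have hR1 : ∀ n x, x ∈ (R (n + 1)).1 ↔ x ∈ (R n).1 ∧ τ (g n) x ∉ (R n).2 := fun n x => Iff.rfl
  have hR2 : ∀ n x, x ∈ (R (n + 1)).2 ↔ x ∈ (R n).2 ∧ τ (g n)⁻¹ x ∉ (R n).1 := fun n x => Iff.rfl
  have hm : ∀ n, MeasurableSet (R n).1 ∧ MeasurableSet (R n).2 := by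
    intro n
    induction n with
    | zero => exact ⟨hU, hV⟩
    | succ n ih =>
      exact ⟨ih.1.inter (hτ.2.2.1 (g n) ih.2.compl), ih.2.inter (hτ.2.2.1 (g n)⁻¹ ih.1.compl)⟩
  have hanti1 : Antitone fun n => (R n).1 := antitone_nat_of_succ_le fun n x hx => ((hR1 n x).mp hx).1
  have hanti2 : Antitone fun n => (R n).2 := antitone_nat_of_succ_le fun n x hx => ((hR2 n x).mp hx).1
  set A : ℕ → Set X := fun n => (R n).1 ∩ τ (g n) ⁻¹' (R n).2 with hA
  set B : ℕ → Set X := fun n => (R n).2 ∩ τ (g n)⁻¹ ⁻¹' (R n).1 with hB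
  have hAm : ∀ n, MeasurableSet (A n) := fun n => (hm n).1.inter (hτ.2.2.1 _ (hm n).2)
  have hBm : ∀ n, MeasurableSet (B n) := fun n => (hm n).2.inter (hτ.2.2.1 _ (hm n).1)
  have hAB : ∀ n, ν (A n) = ν (B n) := by
    intro n
    conv_rhs => rw [← hτ.2.2.2 (g n)]
    rw [Measure.map_apply (hτ.2.2.1 _) (hBm n)]
    congr 1
    ext x
    simp only [hA, hB, Set.mem_inter_iff, Set.mem_preimage, hτ.inv_apply, and_comm]
  have hmeas : ∀ n, ν (R n).1 = ν (R n).2 := by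
    intro n
    induction n with
    | zero => exact heq
    | succ n ih =>
      have e1 : (R (n + 1)).1 = (R n).1 \ A n := by
        ext x; simp only [hR1, hA, Set.mem_sdiff, Set.mem_inter_iff, Set.mem_preimage]; tauto
      have e2 : (R (n + 1)).2 = (R n).2 \ B n := by
        ext x; simp only [hR2, hB, Set.mem_sdiff, Set.mem_inter_iff, Set.mem_preimage]; tauto
      rw [e1, e2, measure_sdiff Set.inter_subset_left (hAm n).nullMeasurableSet (measure_ne_top _ _),
        measure_sdiff Set.inter_subset_left (hBm n).nullMeasurableSet (measure_ne_top _ _), ih, hAB]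
  have hlim : ν (⋂ n, (R n).1) = ν (⋂ n, (R n).2) := by
    refine tendsto_nhds_unique (tendsto_measure_iInter_atTop
      (fun n => (hm n).1.nullMeasurableSet) hanti1 ⟨0, measure_ne_top _ _⟩) ?_
    have h := tendsto_measure_iInter_atTop (μ := ν)
      (fun n => (hm n).2.nullMeasurableSet) hanti2 ⟨0, measure_ne_top _ _⟩
    refine h.congr fun n => ?_
    exact (hmeas n).symm
  have hm1 : MeasurableSet (⋂ n, (R n).1) := .iInter fun n => (hm n).1
  have hm2 : MeasurableSet (⋂ n, (R n).2) := .iInter fun n => (hm n).2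
  have hnull : ν (⋂ n, (R n).1) = 0 := by
    by_contra h
    obtain ⟨k, hk⟩ := herg _ _ hm1 hm2 h (hlim ▸ h)
    refine hk ?_
    obtain ⟨n, rfl⟩ := hg k
    have : (⋂ n, (R n).1) ∩ τ (g n) ⁻¹' (⋂ n, (R n).2) = ∅ := by
      refine Set.eq_empty_iff_forall_notMem.mpr ?_
      rintro x ⟨h1, h2⟩
      have h3 := Set.mem_iInter.mp h1 (n + 1)
      exact ((hR1 n x).mp h3).2 (Set.mem_iInter.mp h2 n)
    rw [this, measure_empty]
  have hAlt : ∀ n n' x, n < n' → x ∈ A n → x ∉ A n' := by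
    intro n n' x hlt h1 h2
    have h3 := hanti1 (Nat.succ_le_of_lt hlt) h2.1
    exact ((hR1 n x).mp h3).2 h1.2
  have hBlt : ∀ n n' x, n < n' → x ∈ B n → x ∉ B n' := by
    intro n n' x hlt h1 h2
    have h3 := hanti2 (Nat.succ_le_of_lt hlt) h2.1
    exact ((hR2 n x).mp h3).2 h1.2
  have hAu : ∀ n n' x, x ∈ A n → x ∈ A n' → n = n' := by
    intro n n' x h1 h2
    rcases lt_trichotomy n n' with h | h | h
    · exact absurd h2 (hAlt _ _ _ h h1)
    · exact h
    · exact absurd h1 (hAlt _ _ _ h h2)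
  have hBu : ∀ n n' x, x ∈ B n → x ∈ B n' → n = n' := by
    intro n n' x h1 h2
    rcases lt_trichotomy n n' with h | h | h
    · exact absurd h2 (hBlt _ _ _ h h1)
    · exact h
    · exact absurd h1 (hBlt _ _ _ h h2)
  have hAU : ∀ n, A n ⊆ U := fun n x hx => hanti1 (Nat.zero_le n) hx.1
  have hBV : ∀ n, B n ⊆ V := fun n x hx => hanti2 (Nat.zero_le n) hx.1
  set γ : X → G := fun x => if h : ∃ n, x ∈ A n then g h.choose
    else if h : ∃ n, x ∈ B n then (g h.choose)⁻¹ else 1 with hγ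
  have hγA : ∀ n x, x ∈ A n → γ x = g n := by
    intro n x hx
    have h : ∃ n, x ∈ A n := ⟨n, hx⟩
    simp only [hγ, dif_pos h]
    rw [hAu _ _ x h.choose_spec hx]
  have hγB : ∀ n x, x ∈ B n → γ x = (g n)⁻¹ := by
    intro n x hx
    have h : ∃ n, x ∈ B n := ⟨n, hx⟩
    have h' : ¬ ∃ n, x ∈ A n := fun ⟨k, hk⟩ => Set.disjoint_left.mp hUV (hAU k hk) (hBV n hx)
    simp only [hγ, dif_neg h', dif_pos h]
    rw [hBu _ _ x h.choose_spec hx]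
  have hγ0 : ∀ x, (¬ ∃ n, x ∈ A n) → (¬ ∃ n, x ∈ B n) → γ x = 1 := by
    intro x h1 h2
    simp only [hγ, dif_neg h1, dif_neg h2]
  have hAB' : ∀ n x, x ∈ A n → τ (g n) x ∈ B n := fun n x hx =>
    ⟨hx.2, by rw [Set.mem_preimage, hτ.inv_apply]; exact hx.1⟩
  have hBA' : ∀ n x, x ∈ B n → τ (g n)⁻¹ x ∈ A n := fun n x hx =>
    ⟨hx.2, by rw [Set.mem_preimage, hτ.apply_inv]; exact hx.1⟩
  have hUA : ∀ x ∈ U, x ∉ (⋂ n, (R n).1) → ∃ n, x ∈ A n := by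
    intro x hx hN
    by_contra hno
    push Not at hno
    refine hN (Set.mem_iInter.mpr fun n => ?_)
    induction n with
    | zero => exact hx
    | succ n ih => exact (hR1 n x).mpr ⟨ih, fun h => hno n ⟨ih, h⟩⟩
  have hVB : ∀ x ∈ V, x ∉ (⋂ n, (R n).2) → ∃ n, x ∈ B n := by
    intro x hx hN
    by_contra hno
    push Not at hno
    refine hN (Set.mem_iInter.mpr fun n => ?_)
    induction n with
    | zero => exact hx
    | succ n ih => exact (hR2 n x).mpr ⟨ih, fun h => hno n ⟨ih, h⟩⟩
  refine ⟨γ, (⋂ n, (R n).1) ∪ (⋂ n, (R n).2), ?_, hm1.union hm2,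
    measure_union_null hnull (hlim ▸ hnull), ?_, ?_, ?_⟩
  · intro k
    have : {x | γ x = k} = (⋃ n, A n ∩ {_x | g n = k}) ∪ (⋃ n, B n ∩ {_x | (g n)⁻¹ = k}) ∪
        (((⋃ n, A n) ∪ (⋃ n, B n))ᶜ ∩ {_x | 1 = k}) := by
      ext x
      by_cases h1 : ∃ n, x ∈ A n
      · obtain ⟨n, hn⟩ := h1
        have h2 : ∀ k, x ∉ B k := fun k hk => Set.disjoint_left.mp hUV (hAU n hn) (hBV k hk)
        have h3 : (∃ j, x ∈ A j ∧ g j = k) ↔ g n = k :=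
          ⟨fun ⟨j, hj, e⟩ => by rw [hAu n j x hn hj, e], fun e => ⟨n, hn, e⟩⟩
        have h4 : ∃ n, x ∈ A n := ⟨n, hn⟩
        simp [hγA n x hn, h2, h3, h4]
      · by_cases h2 : ∃ n, x ∈ B n
        · obtain ⟨n, hn⟩ := h2
          have h3 : (∃ j, x ∈ B j ∧ (g j)⁻¹ = k) ↔ (g n)⁻¹ = k :=
            ⟨fun ⟨j, hj, e⟩ => by rw [hBu n j x hn hj, e], fun e => ⟨n, hn, e⟩⟩
          have h4 : ∃ n, x ∈ B n := ⟨n, hn⟩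
          push Not at h1
          simp only [Set.mem_ofPred_eq, hγB n x hn, Set.mem_union, Set.mem_iUnion,
            Set.mem_inter_iff, h1, false_and, exists_false, false_or, h3, Set.mem_compl_iff, h4,
            or_true, not_true_eq_false, or_false]
        · rw [Set.mem_ofPred_eq, hγ0 x h1 h2]
          push Not at h1 h2
          simp [h1, h2]
    rw [this]
    exact ((MeasurableSet.iUnion fun n => (hAm n).inter (.const _)).union
      (.iUnion fun n => (hBm n).inter (.const _))).union
      (((MeasurableSet.iUnion hAm).union (.iUnion hBm)).compl.inter (.const _))
  · intro x hx hN
    obtain ⟨n, hn⟩ := hUA x hx fun h => hN (Or.inl h)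
    rw [hγA n x hn]
    exact hBV n (hAB' n x hn)
  · intro x hx hN
    obtain ⟨n, hn⟩ := hVB x hx fun h => hN (Or.inr h)
    rw [hγB n x hn]
    exact hAU n (hBA' n x hn)
  · rintro x (hx | hx) hN
    · obtain ⟨n, hn⟩ := hUA x hx fun h => hN (Or.inl h)
      rw [hγA n x hn, hγB n _ (hAB' n x hn)]
    · obtain ⟨n, hn⟩ := hVB x hx fun h => hN (Or.inr h)
      rw [hγB n x hn, hγA n _ (hBA' n x hn), inv_inv]

end Pairing

noncomputable section Levels

variable {G X : Type} [Group G] [Countable G] [MeasurableSpace X]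

/-- The first `n` levels of a dyadic tower. -/
structure TowerLevel (ν : Measure X) (τ : G → X → X) (n : ℕ) where
  good : Set X
  good_meas : MeasurableSet good
  good_ae : ∀ᵐ x ∂ν, x ∈ good
  good_inv : ∀ g x, x ∈ good → τ g x ∈ good
  pos : X → Pos n
  pos_meas : Measurable pos
  θ : X → Pos n → G
  θ_meas : ∀ w, MeasCode fun x => θ x w
  θ_self : ∀ x, x ∈ good → θ x (pos x) = 1
  pos_θ : ∀ x w, x ∈ good → pos (τ (θ x w) x) = w
  θ_cocycle : ∀ x w w', x ∈ good → θ (τ (θ x w) x) w' * θ x w = θ x w'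

theorem append_eq_snoc {n r : ℕ} (w : Pos n) (f : Pos (r + 1)) :
    (show Pos (n + (r + 1)) from Fin.append w f)
      = Fin.snoc (Fin.append w fun k => f k.castSucc : Pos (n + r)) (f (Fin.last r)) := by
  funext i
  refine Fin.lastCases ?_ (fun j => ?_) i
  · exact (Fin.append_right w f (Fin.last r)).trans
      (Fin.snoc_last (α := fun _ => Bool) _ _).symm
  · refine Eq.trans ?_ (Fin.snoc_castSucc (α := fun _ => Bool) _ _ j).symm
    refine Fin.addCases (fun k => ?_) (fun k => ?_) j
    · rw [Fin.append_left]
      exact Fin.append_left w f k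
    · rw [Fin.append_right]
      exact Fin.append_right w f k.castSucc

namespace TowerLevel

variable {ν : Measure X} {τ : G → X → X}

/-- The first level, where all blocks are points. -/
def zero : TowerLevel ν τ 0 where
  good := Set.univ
  good_meas := .univ
  good_ae := by simp
  good_inv _ _ _ := trivial
  pos _ := Fin.elim0
  pos_meas := measurable_const
  θ _ _ := 1
  θ_meas _ := .const _
  θ_self _ _ := rfl
  pos_θ _ _ _ := Subsingleton.elim _ _
  θ_cocycle _ _ _ _ := mul_one _

/-- Sums of a function over the blocks of a level. -/
def blockSum {n : ℕ} (L : TowerLevel ν τ n) (e : X → ℝ) (x : X) : ℝ := ∑ w, e (τ (L.θ x w) x)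

variable {n : ℕ} (L : TowerLevel ν τ n)

/-- The point of position `0` in the block of a given point. -/
def root (x : X) : X := τ (L.θ x fun _ => false) x

theorem root_move (h2 : ∀ g h x, τ (g * h) x = τ g (τ h x)) {x : X} (hx : x ∈ L.good) (w : Pos n) :
    L.root (τ (L.θ x w) x) = L.root x := by
  rw [root, ← h2, L.θ_cocycle x w _ hx, root]

theorem blockSum_move (h2 : ∀ g h x, τ (g * h) x = τ g (τ h x)) {x : X} (hx : x ∈ L.good)
    (w : Pos n) (e : X → ℝ) : L.blockSum e (τ (L.θ x w) x) = L.blockSum e x := by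
  unfold blockSum
  refine Finset.sum_congr rfl fun w' _ => ?_
  rw [← h2, L.θ_cocycle x w _ hx]

theorem measurable_blockSum (hτ : ∀ g, Measurable (τ g)) {e : X → ℝ} (he : Measurable e) :
    Measurable (L.blockSum e) :=
  Finset.measurable_sum _ fun w _ => he.comp ((L.θ_meas w).measurable_comp hτ)

/-- `L'` refines `L` : the blocks of `L'` are unions of two blocks of `L`. -/
structure Extends (L' : TowerLevel ν τ (n + 1)) (L : TowerLevel ν τ n) : Prop where
  good : L'.good ⊆ L.good
  pos : ∀ x, Fin.init (L'.pos x) = L.pos x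
  θ : ∀ x, x ∈ L'.good → ∀ w, L'.θ x (Fin.snoc w (L'.pos x (Fin.last n))) = L.θ x w

theorem measurable_snoc {n : ℕ} {f : X → Pos n} (hf : Measurable f) {b : X → Bool}
    (hb : Measurable b) : Measurable fun x => (Fin.snoc (f x) (b x) : Pos (n + 1)) :=
  (measurable_of_countable fun p : Pos n × Bool => (Fin.snoc p.1 p.2 : Pos (n + 1))).comp
    (hf.prodMk hb)

/-- Joining the blocks of a level in pairs. -/
theorem exists_extends_of_pairing (hτ : IsMPAction ν τ) {V : Set X} (hV : MeasurableSet V)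
    {γ : X → G} (hγ : MeasCode γ) {good : Set X} (hgm : MeasurableSet good)
    (hga : ∀ᵐ x ∂ν, x ∈ good) (hgi : ∀ g x, x ∈ good → τ g x ∈ good) (hgL : good ⊆ L.good)
    (hpos : ∀ x ∈ good, (L.pos x = fun _ => false) → L.pos (τ (γ x) x) = fun _ => false)
    (hVx : ∀ x ∈ good, (L.pos x = fun _ => false) → (τ (γ x) x ∈ V ↔ x ∉ V))
    (hinv : ∀ x ∈ good, (L.pos x = fun _ => false) → γ (τ (γ x) x) = (γ x)⁻¹) :
    ∃ L' : TowerLevel ν τ (n + 1), L'.Extends L ∧ L'.good = good ∧ ∀ x ∈ good, ∀ e,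
      L'.blockSum e x = L.blockSum e (L.root x) + L.blockSum e (τ (γ (L.root x)) (L.root x)) := by
  obtain ⟨h1, h2, hm, -⟩ := hτ
  have hrootm : Measurable L.root := (L.θ_meas _).measurable_comp hm
  set bit : X → Bool := fun x => decide (L.root x ∈ V) with hbit
  have hbitm : Measurable bit := by
    refine measurable_to_bool ?_
    have : bit ⁻¹' {true} = L.root ⁻¹' V := by ext x; simp [hbit]
    rw [this]
    exact hrootm hV
  set y : X → X := fun x => τ (γ (L.root x)) (L.root x) with hy
  set θ' : X → Pos (n + 1) → G := fun x s => if s (Fin.last n) = bit x then L.θ x (Fin.init s)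
    else L.θ (y x) (Fin.init s) * (γ (L.root x) * L.θ x fun _ => false) with hθ'
  have hyx : ∀ x, y x = τ (γ (L.root x) * L.θ x fun _ => false) x := fun x => by
    rw [h2]; rfl
  have hroot_good : ∀ x ∈ good, L.root x ∈ good := fun x hx => hgi _ _ hx
  have hy_good : ∀ x ∈ good, y x ∈ good := fun x hx => hgi _ _ (hroot_good x hx)
  have hroot_pos : ∀ x ∈ good, L.pos (L.root x) = fun _ => false := fun x hx =>
    L.pos_θ x _ (hgL hx)
  have hy_pos : ∀ x ∈ good, L.pos (y x) = fun _ => false := fun x hx =>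
    hpos _ (hroot_good x hx) (hroot_pos x hx)
  have hroot_of : ∀ x ∈ good, (L.pos x = fun _ => false) → L.root x = x := by
    intro x hx hp
    rw [root, ← hp, L.θ_self x (hgL hx), h1]
  have hrooty : ∀ x ∈ good, L.root (y x) = y x := fun x hx => hroot_of _ (hy_good x hx) (hy_pos x hx)
  have hbity : ∀ x ∈ good, bit (y x) = !bit x := by
    intro x hx
    have h := hVx _ (hroot_good x hx) (hroot_pos x hx)
    simp only [hbit, hrooty x hx]
    by_cases hc : L.root x ∈ V
    · have : y x ∉ V := fun h' => h.mp h' hc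
      simp [hc, this]
    · have : y x ∈ V := h.mpr hc
      simp [hc, this]
  have hmove1 : ∀ x ∈ good, ∀ w, L.root (τ (L.θ x w) x) = L.root x ∧ bit (τ (L.θ x w) x) = bit x := by
    intro x hx w
    have := L.root_move h2 (hgL hx) w
    exact ⟨this, by simp only [hbit, this]⟩
  have hτ'same : ∀ x s, s (Fin.last n) = bit x → τ (θ' x s) x = τ (L.θ x (Fin.init s)) x := by
    intro x s hs
    simp only [hθ', if_pos hs]
  have hτ'other : ∀ x s, s (Fin.last n) ≠ bit x →
      τ (θ' x s) x = τ (L.θ (y x) (Fin.init s)) (y x) := by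
    intro x s hs
    simp only [hθ', if_neg hs]
    rw [h2, ← hyx]
  refine ⟨⟨good, hgm, hga, hgi, fun x => Fin.snoc (L.pos x) (bit x), ?_, θ', ?_, ?_, ?_, ?_⟩,
    ⟨hgL, ?_, ?_⟩, rfl, ?_⟩
  · exact measurable_snoc L.pos_meas hbitm
  · intro s
    have hsm : MeasurableSet {x | s (Fin.last n) = bit x} :=
      measurableSet_eq_fun measurable_const hbitm
    have hg2 : MeasCode fun x => γ (L.root x) * L.θ x fun _ => false :=
      (hγ.comp hrootm).mul (L.θ_meas _)
    have hg3 : MeasCode fun x => L.θ (y x) (Fin.init s) := by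
      have := MeasCode.comp_code (L.θ_meas (Fin.init s)) hg2 hm
      simpa only [hyx] using this
    intro g
    have h := (L.θ_meas (Fin.init s)).ite (hg3.mul hg2) hsm g
    simp only [Set.mem_ofPred_eq] at h
    convert h using 3 with x
    by_cases hc : s (Fin.last n) = bit x <;> simp [hθ', hc]
  · intro x hx
    simp only [hθ', Fin.snoc_last, if_true, Fin.init_snoc]
    exact L.θ_self x (hgL hx)
  · intro x s hx
    by_cases hs : s (Fin.last n) = bit x
    · rw [hτ'same x s hs, (hmove1 x hx _).2, L.pos_θ x _ (hgL hx), ← hs, Fin.snoc_init_self]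
    · rw [hτ'other x s hs, (hmove1 _ (hy_good x hx) _).2, L.pos_θ _ _ (hgL (hy_good x hx)),
        hbity x hx]
      have : (!bit x) = s (Fin.last n) := by
        revert hs; cases s (Fin.last n) <;> cases bit x <;> simp
      rw [this, Fin.snoc_init_self]
  · intro x s s' hx
    by_cases hs : s (Fin.last n) = bit x
    · rw [hτ'same x s hs]
      have hr := hmove1 x hx (Fin.init s)
      by_cases hs' : s' (Fin.last n) = bit x
      · simp only [hθ', hr.2, if_pos hs, if_pos hs']
        exact L.θ_cocycle x _ _ (hgL hx)
      · simp only [hθ', hr.2, if_pos hs, if_neg hs', hy, hr.1]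
        rw [mul_assoc, mul_assoc, L.θ_cocycle x _ _ (hgL hx)]
    · rw [hτ'other x s hs]
      have hyg := hy_good x hx
      have hr := hmove1 _ hyg (Fin.init s)
      have hb := hbity x hx
      have hbs : s (Fin.last n) = !bit x := by
        revert hs; cases s (Fin.last n) <;> cases bit x <;> simp
      by_cases hs' : s' (Fin.last n) = bit x
      · have hs2 : s' (Fin.last n) ≠ bit (y x) := by rw [hs', hb]; cases bit x <;> simp
        simp only [hθ', hr.2, if_neg hs, if_neg hs2, if_pos hs']
        have hγy : γ (y x) = (γ (L.root x))⁻¹ := hinv _ (hroot_good x hx) (hroot_pos x hx)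
        have hyy : y (τ (L.θ (y x) (Fin.init s)) (y x)) = L.root x := by
          simp only [hy] at hr ⊢
          rw [hr.1]
          have h3 := hrooty x hx
          simp only [hy] at h3 hγy
          rw [h3, hγy, ← h2, inv_mul_cancel, h1]
        rw [hyy, hr.1, hrooty x hx, hγy]
        have h4 : (L.θ (τ (L.θ (y x) (Fin.init s)) (y x)) fun _ => false) * L.θ (y x) (Fin.init s)
            = 1 := by
          rw [L.θ_cocycle _ _ _ (hgL hyg), ← hy_pos x hx, L.θ_self _ (hgL hyg)]
        have h5 := L.θ_cocycle x (fun _ => false) (Fin.init s') (hgL hx)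
        calc _ = L.θ (L.root x) (Fin.init s') * ((γ (L.root x))⁻¹ *
              ((L.θ (τ (L.θ (y x) (Fin.init s)) (y x)) fun _ => false) * L.θ (y x) (Fin.init s)) *
                γ (L.root x)) * L.θ x fun _ => false := by group
          _ = _ := by rw [h4, mul_one, inv_mul_cancel, mul_one]; exact h5
      · have hs2 : s' (Fin.last n) = bit (y x) := by
          rw [hb]; revert hs'; cases s' (Fin.last n) <;> cases bit x <;> simp
        simp only [hθ', hr.2, if_neg hs, if_pos hs2, if_neg hs']
        rw [← mul_assoc, L.θ_cocycle _ _ _ (hgL hyg)]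
  · intro x
    exact Fin.init_snoc _ _
  · intro x hx w
    simp only [hθ', Fin.snoc_last, Fin.init_snoc, if_true]
  · intro x hx e
    have hsum : ∀ F : Pos (n + 1) → ℝ, ∑ s, F s
        = ∑ w, F (Fin.snoc w (bit x)) + ∑ w, F (Fin.snoc w (!bit x)) := by
      intro F
      rw [← (Fin.snocEquiv fun _ : Fin (n + 1) => Bool).sum_comp, Fintype.sum_prod_type,
        Fintype.sum_bool]
      cases bit x
      · rw [add_comm]; rfl
      · rfl
    have e1 : L.blockSum e (L.root x) = L.blockSum e x := L.blockSum_move h2 (hgL hx) _ e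
    rw [e1]
    unfold blockSum
    rw [hsum]
    congr 1
    · refine Finset.sum_congr rfl fun w _ => ?_
      show e (τ (θ' x _) x) = _
      rw [hτ'same x _ (Fin.snoc_last _ _), Fin.init_snoc]
    · refine Finset.sum_congr rfl fun w _ => ?_
      show e (τ (θ' x _) x) = _
      rw [hτ'other x _ (by rw [Fin.snoc_last]; cases bit x <;> simp), Fin.init_snoc]

/-- Range control passes to a suitable extension of a level. -/
theorem exists_extends [StandardBorelSpace X] [IsFiniteMeasure ν] [NullSingletonClass ν]
    (hτ : IsMPAction ν τ)
    (herg : ∀ U V, MeasurableSet U → MeasurableSet V → ν U ≠ 0 → ν V ≠ 0 →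
      ∃ g, ν (U ∩ τ g ⁻¹' V) ≠ 0)
    {e : X → ℝ} (he : Measurable e) {R : ℝ}
    (hR : ∃ a : ℝ, ∀ x ∈ L.good, a ≤ L.blockSum e x ∧ L.blockSum e x ≤ a + R) :
    ∃ L' : TowerLevel ν τ (n + 1), L'.Extends L ∧
      ∃ a : ℝ, ∀ x ∈ L'.good, a ≤ L'.blockSum e x ∧ L'.blockSum e x ≤ a + R := by
  obtain ⟨a, ha⟩ := hR
  have hm := hτ.2.2.1
  set Y : Set X := L.good ∩ {x | L.pos x = fun _ => false} with hY
  have hYm : MeasurableSet Y := L.good_meas.inter (L.pos_meas (measurableSet_singleton _))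
  have hum : Measurable (L.blockSum e) := L.measurable_blockSum hm he
  obtain ⟨U, hUY, hUm, hUV, c, hc1, hc2⟩ := exists_halving (ν := ν) hYm hum
    (a := a) fun x hx => (ha x hx.1).1
  set V : Set X := Y \ U with hV
  have hVm : MeasurableSet V := hYm.diff hUm
  have hdis : Disjoint U V := Set.disjoint_sdiff_right
  obtain ⟨γ, N, hγ, hNm, hN0, hγU, hγV, hγi⟩ := exists_pairing hτ herg hUm hVm hdis hUV
  set good : Set X := L.good ∩ ⋂ g : G, τ g ⁻¹' Nᶜ with hgood
  have hgN : ∀ x ∈ good, x ∉ N := by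
    intro x hx hxN
    have := Set.mem_iInter.mp hx.2 1
    rw [Set.mem_preimage, hτ.1] at this
    exact this hxN
  have hYUV : ∀ x ∈ L.good, (L.pos x = fun _ => false) → x ∈ U ∪ V := by
    intro x hx hp
    by_cases h : x ∈ U
    · exact Or.inl h
    · exact Or.inr ⟨⟨hx, hp⟩, h⟩
  have hUVY : U ∪ V ⊆ Y := Set.union_subset hUY Set.sdiff_subset
  obtain ⟨L', hL', hLg, hsum⟩ := L.exists_extends_of_pairing hτ hVm hγ (good := good)
    (L.good_meas.inter (.iInter fun g => hm g hNm.compl))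
    (by
      have : ∀ᵐ x ∂ν, ∀ g : G, τ g x ∉ N :=
        ae_all_iff.mpr fun g => hτ.ae_of_ae (measure_eq_zero_iff_ae_notMem.mp hN0) g
      filter_upwards [L.good_ae, this] with x h1 h2
      exact ⟨h1, Set.mem_iInter.mpr h2⟩)
    (by
      rintro g x ⟨h1, h2⟩
      refine ⟨L.good_inv g x h1, Set.mem_iInter.mpr fun k => ?_⟩
      rw [Set.mem_preimage, ← hτ.2.1]
      exact Set.mem_iInter.mp h2 (k * g))
    Set.inter_subset_left
    (by
      intro x hx hp
      rcases hYUV x hx.1 hp with h | h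
      · exact (hUVY (Or.inr (hγU x h (hgN x hx)))).2
      · exact (hUVY (Or.inl (hγV x h (hgN x hx)))).2)
    (by
      intro x hx hp
      rcases hYUV x hx.1 hp with h | h
      · exact iff_of_true (hγU x h (hgN x hx)) (Set.disjoint_left.mp hdis h)
      · exact iff_of_false (Set.disjoint_left.mp hdis (hγV x h (hgN x hx))) (not_not.mpr h))
    (fun x hx hp => hγi x (hYUV x hx.1 hp) (hgN x hx))
  refine ⟨L', hL', a + c, fun x hx => ?_⟩
  rw [hLg] at hx
  rw [hsum x hx e]
  have hgi : ∀ g, τ g x ∈ good := fun g => by rw [← hLg] at hx ⊢; exact L'.good_inv g x hx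
  have hr : L.root x ∈ good := hgi _
  have hr2 : ∀ g, τ g (L.root x) ∈ good := fun g => by rw [← hLg] at hr ⊢; exact L'.good_inv g _ hr
  have h1 := ha _ hr.1
  have h2 := ha _ (hr2 (γ (L.root x))).1
  rcases hYUV _ hr.1 (L.pos_θ x _ hx.1) with h | h
  · have h3 := hc1 _ h
    have h4 := hc2 _ (hγU _ h (hgN _ hr))
    constructor <;> linarith
  · have h3 := hc2 _ h
    have h4 := hc1 _ (hγV _ h (hgN _ hr))
    constructor <;> linarith

end TowerLevel

/-- Dyadic towers with controlled block sums exist for nonatomic ergodic actions. -/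
theorem Tower.exists_of_ergodic [StandardBorelSpace X] {ν : Measure X} {τ : G → X → X}
    [IsProbabilityMeasure ν] [NullSingletonClass ν]
    (hτ : IsMPAction ν τ)
    (herg : ∀ U V, MeasurableSet U → MeasurableSet V → ν U ≠ 0 → ν V ≠ 0 →
      ∃ g, ν (U ∩ τ g ⁻¹' V) ≠ 0)
    {e : X → ℝ} (he : Measurable e) (he0 : ∀ x, 0 ≤ e x) {R : ℝ} (heR : ∀ x, e x ≤ R) :
    ∃ T : Tower τ, (∀ᵐ x ∂ν, x ∈ T.good) ∧ ∀ n, ∀ x ∈ T.good,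
      |∑ w, e (τ (T.θ n x w) x) - 2 ^ n * ∫ x, e x ∂ν| ≤ R := by
  have hm := hτ.2.2.1
  let St : ℕ → Type := fun n => {L : TowerLevel ν τ n //
    ∃ a : ℝ, ∀ x ∈ L.good, a ≤ L.blockSum e x ∧ L.blockSum e x ≤ a + R}
  have hst : ∀ n (L : St n), ∃ L' : St (n + 1), L'.1.Extends L.1 := by
    intro n L
    obtain ⟨L', h1, h2⟩ := L.1.exists_extends hτ herg he L.2
    exact ⟨⟨L', h2⟩, h1⟩
  choose next hnext using hst
  let L0 : St 0 := ⟨TowerLevel.zero, 0, fun x _ => by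
    simp [TowerLevel.blockSum, TowerLevel.zero, hτ.1, he0, heR]⟩
  let L : ∀ n, St n := fun n => Nat.rec L0 (fun n L => next n L) n
  have hL : ∀ n, (L (n + 1)).1.Extends (L n).1 := fun n => hnext n (L n)
  set bits : ℕ → X → Bool := fun n x => (L (n + 1)).1.pos x (Fin.last n) with hbits
  have hpos : ∀ n x, (L n).1.pos x = fun i : Fin n => bits i x := by
    intro n x
    induction n with
    | zero => exact Subsingleton.elim _ _
    | succ n ih =>
      rw [← Fin.snoc_init_self ((L (n + 1)).1.pos x), (hL n).pos x, ih]
      funext i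
      refine Fin.lastCases ?_ (fun j => ?_) i
      · simp [hbits]
      · simp
  set good : Set X := ⋂ n, (L n).1.good with hgood
  have hgn : ∀ n x, x ∈ good → x ∈ (L n).1.good := fun n x hx => Set.mem_iInter.mp hx n
  have hgae : ∀ᵐ x ∂ν, x ∈ good := by
    have : ∀ᵐ x ∂ν, ∀ n, x ∈ (L n).1.good := ae_all_iff.mpr fun n => (L n).1.good_ae
    filter_upwards [this] with x hx
    exact Set.mem_iInter.mpr hx
  let T : Tower τ :=
    { good := good
      good_meas := .iInter fun n => (L n).1.good_meas
      good_inv := fun g x hx => Set.mem_iInter.mpr fun n => (L n).1.good_inv g x (hgn n x hx)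
      bits := bits
      bits_meas := fun n => (measurable_pi_apply (Fin.last n)).comp (L (n + 1)).1.pos_meas
      θ := fun n => (L n).1.θ
      θ_meas := fun n w => (L n).1.θ_meas w
      θ_self := fun n x hx => by rw [← hpos]; exact (L n).1.θ_self x (hgn n x hx)
      bits_θ := fun n x w hx => by rw [← hpos]; exact (L n).1.pos_θ x w (hgn n x hx)
      θ_cocycle := fun n x w w' hx => (L n).1.θ_cocycle x w w' (hgn n x hx)
      θ_nest := by
        intro n r x w hx
        induction r with
        | zero =>
          show (L n).1.θ x _ = _
          congr 1
          exact Fin.append_right_nil _ _ rfl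
        | succ r ih =>
          rw [← ih, ← (hL (n + r)).θ x (hgn _ x hx)]
          show (L (n + r + 1)).1.θ x _ = _
          congr 1
          exact append_eq_snoc w fun i => bits (Fin.natAdd n i : Fin (n + (r + 1))) x }
  refine ⟨T, hgae, fun n x hx => ?_⟩
  obtain ⟨a, ha⟩ := (L n).2
  have hsumint : ∫ x, ∑ w, e (τ (T.θ n x w) x) ∂ν = 2 ^ n * ∫ x, e x ∂ν := by
    have hl := T.lintegral_sum hτ hgae n (f := fun x => ENNReal.ofReal (e x)) he.ennreal_ofReal
    have hmeas : Measurable fun x => ∑ w, e (τ (T.θ n x w) x) :=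
      Finset.measurable_sum _ fun w _ => he.comp ((T.θ_meas n w).measurable_comp hm)
    rw [integral_eq_lintegral_of_nonneg_ae (Eventually.of_forall fun x =>
        Finset.sum_nonneg fun w _ => he0 _) hmeas.aestronglyMeasurable,
      integral_eq_lintegral_of_nonneg_ae (Eventually.of_forall he0) he.aestronglyMeasurable]
    have : ∀ x, ENNReal.ofReal (∑ w, e (τ (T.θ n x w) x))
        = ∑ w, ENNReal.ofReal (e (τ (T.θ n x w) x)) := fun x =>
      ENNReal.ofReal_sum_of_nonneg fun w _ => he0 _
    simp only [this]
    rw [hl, ENNReal.toReal_mul]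
    simp
  have hsb : ∀ᵐ x ∂ν, a ≤ ∑ w, e (τ (T.θ n x w) x) ∧ ∑ w, e (τ (T.θ n x w) x) ≤ a + R := by
    filter_upwards [hgae] with x hx
    exact ha x (hgn n x hx)
  have hmeas : Measurable fun x => ∑ w, e (τ (T.θ n x w) x) :=
    Finset.measurable_sum _ fun w _ => he.comp ((T.θ_meas n w).measurable_comp hm)
  have hi : Integrable (fun x => ∑ w, e (τ (T.θ n x w) x)) ν :=
    Integrable.of_mem_Icc a (a + R) hmeas.aemeasurable hsb
  have h1 : a ≤ ∫ x, ∑ w, e (τ (T.θ n x w) x) ∂ν := by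
    have := integral_mono_ae (integrable_const a) hi (hsb.mono fun x hx => hx.1)
    simpa using this
  have h2 : ∫ x, ∑ w, e (τ (T.θ n x w) x) ∂ν ≤ a + R := by
    have := integral_mono_ae hi (integrable_const (a + R)) (hsb.mono fun x hx => hx.2)
    simpa using this
  rw [hsumint] at h1 h2
  have h3 := ha x (hgn n x hx)
  simp only [TowerLevel.blockSum] at h3
  have h4 : ∀ w, (L n).1.θ x w = T.θ n x w := fun w => rfl
  simp only [h4] at h3
  rw [abs_le]
  constructor <;> linarith [h3.1, h3.2]

end Levels

noncomputable section Environment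

/-- The cylinder over `W` prescribed by `α`. -/
def cyl {G 𝒜 : Type} (W : Finset G) (α : G → 𝒜) : Set (G → 𝒜) := {a | ∀ g ∈ W, a g = α g}

section Cylinders

variable {G 𝒜 : Type} [MeasurableSpace 𝒜] [MeasurableSingletonClass 𝒜]

theorem cyl_eq_pi (W : Finset G) (α : G → 𝒜) : cyl W α = Set.pi W fun g => {α g} := by
  ext a; simp [cyl, Set.mem_pi]

theorem measurableSet_cyl (W : Finset G) (α : G → 𝒜) : MeasurableSet (cyl W α) := by
  rw [cyl_eq_pi]
  exact .pi W.countable_toSet fun g _ => measurableSet_singleton _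

theorem isPiSystem_cyl : IsPiSystem {s : Set (G → 𝒜) | ∃ W α, s = cyl W α} := by
  rintro _ ⟨W, α, rfl⟩ _ ⟨W', α', rfl⟩ ⟨a, ha, ha'⟩
  refine ⟨W ∪ W', a, ?_⟩
  ext b
  simp only [cyl, Set.mem_inter_iff, Set.mem_ofPred_eq, Finset.mem_union] at ha ha' ⊢
  constructor
  · rintro ⟨h, h'⟩ g (hg | hg)
    · rw [h g hg, ha g hg]
    · rw [h' g hg, ha' g hg]
  · intro h
    exact ⟨fun g hg => by rw [h g (.inl hg), ha g hg], fun g hg => by rw [h g (.inr hg), ha' g hg]⟩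

theorem generateFrom_cyl [Countable 𝒜] :
    MeasurableSpace.generateFrom {s : Set (G → 𝒜) | ∃ W α, s = cyl W α} = MeasurableSpace.pi := by
  refine le_antisymm (MeasurableSpace.generateFrom_le ?_) ?_
  · rintro _ ⟨W, α, rfl⟩
    exact measurableSet_cyl W α
  · refine iSup_le fun g => ?_
    rintro _ ⟨s, -, rfl⟩
    have : (fun a : G → 𝒜 => a g) ⁻¹' s = ⋃ c ∈ s, cyl {g} (fun _ => c) := by
      ext a; simp [cyl]
    rw [this]
    exact MeasurableSet.biUnion s.to_countable fun c _ =>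
      MeasurableSpace.measurableSet_generateFrom ⟨_, _, rfl⟩

theorem ext_of_prod_cyl {X : Type} [MeasurableSpace X] [Countable 𝒜] [Nonempty 𝒜]
    {μ μ' : Measure (X × (G → 𝒜))} [IsFiniteMeasure μ]
    (h : ∀ (s : Set X) (W : Finset G) (α : G → 𝒜), MeasurableSet s →
      μ (s ×ˢ cyl W α) = μ' (s ×ˢ cyl W α)) : μ = μ' := by
  have hspan : IsCountablySpanning {s : Set (G → 𝒜) | ∃ W α, s = cyl W α} :=
    ⟨fun _ => Set.univ, fun _ => ⟨∅, fun _ => Classical.arbitrary _, by simp [cyl]⟩,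
      Set.iUnion_const _⟩
  refine ext_of_generate_finite _ (generateFrom_eq_prod (C := {s : Set X | MeasurableSet s})
    (MeasurableSpace.generateFrom_measurableSet) generateFrom_cyl
    isCountablySpanning_measurableSet hspan).symm
    (MeasurableSpace.isPiSystem_measurableSet.prod isPiSystem_cyl) ?_ ?_
  · rintro _ ⟨s, hs, _, ⟨W, α, rfl⟩, rfl⟩
    exact h s W α hs
  · have := h Set.univ ∅ (fun _ => Classical.arbitrary _) .univ
    simpa [cyl] using this

theorem ext_of_cyl [Countable 𝒜] [Nonempty 𝒜] {μ μ' : Measure (G → 𝒜)} [IsFiniteMeasure μ]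
    (h : ∀ (W : Finset G) (α : G → 𝒜), μ (cyl W α) = μ' (cyl W α)) : μ = μ' := by
  refine ext_of_generate_finite _ generateFrom_cyl.symm isPiSystem_cyl ?_ ?_
  · rintro _ ⟨W, α, rfl⟩
    exact h W α
  · simpa [cyl] using h ∅ (fun _ => Classical.arbitrary _)

theorem infinitePi_cyl (μ : G → Measure 𝒜) [∀ g, IsProbabilityMeasure (μ g)] (W : Finset G)
    (α : G → 𝒜) : Measure.infinitePi μ (cyl W α) = ∏ g ∈ W, μ g {α g} := by
  rw [cyl_eq_pi, Measure.infinitePi_pi]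
  exact fun g _ => measurableSet_singleton _

end Cylinders

variable {G X I 𝒜 : Type} [Group G] [Countable G] [MeasurableSpace X] [Fintype I] [MeasurableSpace I]
  [MeasurableSingletonClass I] [Fintype 𝒜] [Nonempty 𝒜] [MeasurableSpace 𝒜]
  [MeasurableSingletonClass 𝒜]

/-- Independent labels, with a law depending on the type of the site. -/
def envKernel {τ : G → X → X} (hτ : ∀ g, Measurable (τ g)) {ty : X → I} (hty : Measurable ty)
    (P : I → Measure 𝒜) [∀ i, IsProbabilityMeasure (P i)] : ProbabilityTheory.Kernel X (G → 𝒜) where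
  toFun x := Measure.infinitePi fun g => P (ty (τ g x))
  measurable' := by
    refine Measurable.measure_of_isPiSystem_of_isProbabilityMeasure generateFrom_cyl.symm
      isPiSystem_cyl ?_
    rintro _ ⟨W, α, rfl⟩
    simp_rw [infinitePi_cyl]
    refine Finset.measurable_fun_prod _ fun g _ => ?_
    exact (measurable_of_countable fun i => P i {α g}).comp (hty.comp (hτ g))

variable {τ : G → X → X} (hτm : ∀ g, Measurable (τ g)) {ty : X → I} (hty : Measurable ty)
    (P : I → Measure 𝒜) [∀ i, IsProbabilityMeasure (P i)]

theorem envKernel_apply (x : X) :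
    envKernel hτm hty P x = Measure.infinitePi fun g => P (ty (τ g x)) := rfl

instance : ProbabilityTheory.IsMarkovKernel (envKernel hτm hty P) :=
  ⟨fun x => by rw [envKernel_apply]; infer_instance⟩

theorem measurable_gShift {Y : Type} [MeasurableSpace Y] (g : G) :
    Measurable (gShift g : (G → Y) → G → Y) :=
  measurable_pi_lambda _ fun _ => measurable_pi_apply _

theorem envKernel_shift (hτ : ∀ g h x, τ (g * h) x = τ g (τ h x)) (g : G) (x : X) :
    envKernel hτm hty P (τ g x) = (envKernel hτm hty P x).map (gShift g) := by
  rw [envKernel_apply, envKernel_apply]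
  have := Measure.map_infinitePi_infinitePi_of_inj (P := fun h => P (ty (τ h x)))
    (f := fun h : G => h * g) (mul_left_injective g)
  rw [show (gShift g : (G → 𝒜) → G → 𝒜) = fun ω i => ω (i * g) from rfl, this]
  simp only [hτ]

/-- The joint law of the environment and of the labels. -/
def envMeasure (ν : Measure X) : Measure (X × (G → 𝒜)) := ν.compProd (envKernel hτm hty P)

instance (ν : Measure X) [IsProbabilityMeasure ν] :
    IsProbabilityMeasure (envMeasure hτm hty P ν) := by
  unfold envMeasure; infer_instance

/-- The action on the environment and on the labels. -/
def prodAct (𝒜 : Type) (τ : G → X → X) (g : G) : X × (G → 𝒜) → X × (G → 𝒜) :=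
  Prod.map (τ g) (gShift g)

theorem envMeasure_isMPAction {ν : Measure X} [IsProbabilityMeasure ν] (hτ : IsMPAction ν τ) :
    IsMPAction (envMeasure hτm hty P ν) (prodAct 𝒜 τ) := by
  refine ⟨fun z => ?_, fun g h z => ?_, fun g => (hτm g).prodMap (measurable_gShift g),
    fun g => ?_⟩
  · refine Prod.ext (hτ.1 _) ?_
    funext h; simp [gShift, prodAct]
  · refine Prod.ext (hτ.2.1 _ _ _) ?_
    funext k; simp [gShift, mul_assoc, prodAct]
  · have hm : Measurable (prodAct 𝒜 τ g) := (hτm g).prodMap (measurable_gShift g)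
    have : IsProbabilityMeasure ((envMeasure hτm hty P ν).map (prodAct 𝒜 τ g)) :=
      Measure.isProbabilityMeasure_map hm.aemeasurable
    refine ext_of_prod_cyl fun s W α hs => ?_
    have hS := hs.prod (measurableSet_cyl W α)
    rw [Measure.map_apply hm hS, envMeasure, Measure.compProd_apply (hm hS),
      Measure.compProd_apply hS, ← hτ.lintegral_comp g
        (ProbabilityTheory.Kernel.measurable_kernel_prodMk_left hS)]
    refine lintegral_congr fun x => ?_
    rw [envKernel_shift hτm hty P hτ.2.1, Measure.map_apply (measurable_gShift g)
      (measurable_prodMk_left hS)]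
    rfl

/-- The weights of a finite measure on a finite set. -/
def wt {I 𝒜 : Type} [MeasurableSpace 𝒜] (P : I → Measure 𝒜) (i : I) (a : 𝒜) : ℝ := (P i).real {a}

theorem wt_nonneg (i : I) (a : 𝒜) : 0 ≤ wt P i a := measureReal_nonneg

theorem sum_wt (i : I) : ∑ a, wt P i a = 1 := by
  have := sum_measureReal_singleton (μ := P i) (Finset.univ : Finset 𝒜)
  simp only [wt, this, Finset.coe_univ, probReal_univ]

theorem ofReal_blockWeight {V : Type} [Fintype V] (t : V → I) (a : V → 𝒜) :
    ENNReal.ofReal (blockWeight (wt P) t a) = ∏ v, P (t v) {a v} := by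
  rw [blockWeight, ENNReal.ofReal_prod_of_nonneg fun v _ => wt_nonneg P _ _]
  refine Finset.prod_congr rfl fun v _ => ?_
  rw [wt, Measure.real, ENNReal.ofReal_toReal (measure_ne_top _ _)]

theorem map_envKernel {V : Type} [Fintype V] (x : X) {s : V → G} (hs : Function.Injective s) :
    (envKernel hτm hty P x).map (fun a v => a (s v))
      = Measure.infinitePi fun v => P (ty (τ (s v) x)) := by
  rw [envKernel_apply]
  exact Measure.map_infinitePi_infinitePi_of_inj (P := fun h => P (ty (τ h x))) hs

theorem lintegral_envKernel {V : Type} [Fintype V] [DecidableEq V] (x : X) {s : V → G}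
    (hs : Function.Injective s) (F : (V → 𝒜) → ℝ≥0∞) :
    ∫⁻ a, F (fun v => a (s v)) ∂(envKernel hτm hty P x)
      = ∑ b, F b * ENNReal.ofReal (blockWeight (wt P) (fun v => ty (τ (s v) x)) b) := by
  have hm : Measurable fun (a : G → 𝒜) (v : V) => a (s v) :=
    measurable_pi_lambda _ fun _ => measurable_pi_apply _
  rw [← lintegral_map (f := F) (measurable_of_countable F) hm, map_envKernel hτm hty P x hs,
    lintegral_fintype]
  refine Finset.sum_congr rfl fun b _ => ?_
  rw [ofReal_blockWeight, Measure.infinitePi_singleton_of_fintype]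

end Environment

noncomputable section Evaluation

variable {G X I 𝒜 ℱ : Type} [Group G] [Countable G] [MeasurableSpace X] [Fintype I]
  [MeasurableSpace I] [MeasurableSingletonClass I] [Fintype 𝒜] [Nonempty 𝒜] [MeasurableSpace 𝒜]
  [MeasurableSingletonClass 𝒜] [Fintype ℱ] [Nonempty ℱ] [MeasurableSpace ℱ]
  [MeasurableSingletonClass ℱ] {τ : G → X → X}

theorem MeasCode.measurable_eval {γ : X → G} (hγ : MeasCode γ) :
    Measurable fun z : X × (G → 𝒜) => z.2 (γ z.1) :=
  (hγ.comp (Y := X × (G → 𝒜)) measurable_fst).measurable_comp (F := fun g z => z.2 g)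
    fun g => (measurable_pi_apply g).comp measurable_snd

/-- The joint action evaluated by a stationary code. -/
def codeMap (τ : G → X → X) (F : X × (G → 𝒜) → ℱ) (z : X × (G → 𝒜)) : X × (G → ℱ) :=
  (z.1, fun g => F (prodAct 𝒜 τ g z))

theorem measurable_codeMap (hτm : ∀ g, Measurable (τ g)) {F : X × (G → 𝒜) → ℱ}
    (hF : Measurable F) : Measurable (codeMap τ F) :=
  measurable_fst.prodMk (measurable_pi_lambda _ fun g =>
    hF.comp ((hτm g).prodMap (measurable_gShift g)))

namespace Tower

variable (T : Tower τ)

/-- The types of the sites of the block of level `n` of a point. -/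
def pat (ty : X → I) (n : ℕ) (x : X) : Pos n → I := fun w => ty (τ (T.θ n x w) x)

/-- The labels of the sites of the block of level `n` of a point. -/
def blk (n : ℕ) (z : X × (G → 𝒜)) : Pos n → 𝒜 := fun w => z.2 (T.θ n z.1 w)

/-- The stationary code given by a block rule of level `n`. -/
def ev (ty : X → I) (n : ℕ) (φ : (Pos n → I) → (Pos n → 𝒜) → Pos n → ℱ) (z : X × (G → 𝒜)) : ℱ :=
  φ (T.pat ty n z.1) (T.blk n z) (T.pos n z.1)

/-- The tower over the labelled space. -/
abbrev labelled (𝒜 : Type) [MeasurableSpace 𝒜] : Tower (prodAct 𝒜 τ) :=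
  T.comap (Prod.fst : X × (G → 𝒜) → X) measurable_fst fun _ _ => rfl

section Moves

variable {𝒞 : Type} {ty : X → I} {n : ℕ} (hmul : ∀ g h x, τ (g * h) x = τ g (τ h x))

include hmul

theorem pat_move {x : X} (hx : x ∈ T.good) (w : Pos n) :
    T.pat ty n (τ (T.θ n x w) x) = T.pat ty n x := by
  funext w'
  rw [pat, pat, ← hmul, T.θ_cocycle n x w w' hx]

omit hmul in
theorem blk_move {z : X × (G → 𝒜)} (hz : z.1 ∈ T.good) (w : Pos n) :
    T.blk n (prodAct 𝒜 τ (T.θ n z.1 w) z) = T.blk n z := by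
  funext w'
  simp only [blk, prodAct, Prod.map_fst, Prod.map_snd, gShift]
  rw [T.θ_cocycle n z.1 w w' hz]

theorem ev_move {z : X × (G → 𝒜)} (hz : z.1 ∈ T.good) (w : Pos n)
    (φ : (Pos n → I) → (Pos n → 𝒜) → Pos n → 𝒞) :
    T.ev ty n φ (prodAct 𝒜 τ (T.θ n z.1 w) z) = φ (T.pat ty n z.1) (T.blk n z) w := by
  have h1 : (prodAct 𝒜 τ (T.θ n z.1 w) z).1 = τ (T.θ n z.1 w) z.1 := rfl
  rw [ev, T.blk_move hz, h1, T.pat_move hmul hz, T.pos_θ hz]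

theorem blk_codeMap {z : X × (G → 𝒜)} (hz : z.1 ∈ T.good)
    (φ : (Pos n → I) → (Pos n → 𝒜) → Pos n → 𝒞) :
    T.blk n (codeMap τ (T.ev ty n φ) z) = φ (T.pat ty n z.1) (T.blk n z) :=
  funext fun w => T.ev_move hmul hz w φ

omit hmul in
theorem blk_pos {z : X × (G → 𝒜)} (hz : z.1 ∈ T.good) :
    T.blk n z (T.pos n z.1) = z.2 1 := by
  rw [blk]; exact congrArg z.2 (T.θ_self n z.1 hz)

omit hmul in
theorem subBlock_pat {r : ℕ} {x : X} (hx : x ∈ T.good) :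
    subBlock (T.pat ty (n + r) x) (tailPos (T.pos (n + r) x)) = T.pat ty n x := by
  funext w
  rw [subBlock, pat, pat, T.θ_append hx]

omit hmul in
theorem ev_liftRule {r : ℕ} {z : X × (G → 𝒜)} (hz : z.1 ∈ T.good)
    (φ : (Pos n → I) → (Pos n → 𝒜) → Pos n → 𝒞) :
    T.ev ty (n + r) (liftRule r φ) z = T.ev ty n φ z := by
  have h : subBlock (T.blk (n + r) z) (tailPos (T.pos (n + r) z.1)) = T.blk n z := by
    funext w
    rw [subBlock, blk, blk, T.θ_append hz]
  rw [ev, liftRule, T.subBlock_pat hz, h, T.headPos_pos]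
  rfl

end Moves

theorem measurable_pat {ty : X → I} (hτm : ∀ g, Measurable (τ g)) (hty : Measurable ty) (n : ℕ) :
    Measurable (T.pat ty n) :=
  measurable_pi_lambda _ fun w => hty.comp (T.measurable_move hτm n w)

theorem measurable_blk (n : ℕ) : Measurable (T.blk n : X × (G → 𝒜) → _) :=
  measurable_pi_lambda _ fun w => (T.θ_meas n w).measurable_eval

theorem measurable_local {Y : Type} [MeasurableSpace Y] {ty : X → I}
    (hτm : ∀ g, Measurable (τ g)) (hty : Measurable ty) (n : ℕ)
    (ψ : (Pos n → I) → (Pos n → 𝒜) → Pos n → Y) :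
    Measurable fun z : X × (G → 𝒜) => ψ (T.pat ty n z.1) (T.blk n z) (T.pos n z.1) := by
  have h : Measurable fun q : (Pos n → I) × (Pos n → 𝒜) × Pos n => ψ q.1 q.2.1 q.2.2 :=
    measurable_of_countable _
  exact h.comp (((T.measurable_pat hτm hty n).comp measurable_fst).prodMk
    ((T.measurable_blk n).prodMk ((T.pos_meas n).comp measurable_fst)))

theorem measurable_ev {ty : X → I} (hτm : ∀ g, Measurable (τ g)) (hty : Measurable ty) (n : ℕ)
    (φ : (Pos n → I) → (Pos n → 𝒜) → Pos n → ℱ) : Measurable (T.ev ty n φ) :=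
  T.measurable_local hτm hty n φ

section Estimates

variable {ν : Measure X} [IsProbabilityMeasure ν] (hτ : IsMPAction ν τ)
  (hgood : ∀ᵐ x ∂ν, x ∈ T.good) {ty : X → I} (hty : Measurable ty)
  (P : I → Measure 𝒜) [∀ i, IsProbabilityMeasure (P i)]

theorem ae_labelled_good : (∀ᵐ x ∂ν, x ∈ T.good) →
    ∀ᵐ z ∂(envMeasure hτ.2.2.1 hty P ν), z.1 ∈ T.good := by
  intro hgood
  have : (envMeasure hτ.2.2.1 hty P ν).map Prod.fst = ν := Measure.fst_compProd _ _
  exact ae_of_ae_map measurable_fst.aemeasurable (by rwa [this])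

include hgood in
/-- The average of a local cost is controlled by its block averages. -/
theorem lintegral_local_le {n : ℕ} (ψ : (Pos n → I) → (Pos n → 𝒜) → Pos n → ℝ)
    (hψ : ∀ t a p, 0 ≤ ψ t a p) {E : ℝ}
    (hE : ∀ x ∈ T.good, ∑ a, blockWeight (wt P) (T.pat ty n x) a *
      ((∑ p, ψ (T.pat ty n x) a p) / 2 ^ n) ≤ E) :
    ∫⁻ z, ENNReal.ofReal (ψ (T.pat ty n z.1) (T.blk n z) (T.pos n z.1))
      ∂(envMeasure hτ.2.2.1 hty P ν) ≤ ENNReal.ofReal E := by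
  have hm := T.measurable_local (𝒜 := 𝒜) hτ.2.2.1 hty n fun t a p => ENNReal.ofReal (ψ t a p)
  have hg := T.ae_labelled_good hτ hty P hgood
  have h1 := (T.labelled 𝒜).lintegral_sum (envMeasure_isMPAction hτ.2.2.1 hty P hτ) hg n hm
  have h2 : ∫⁻ z : X × (G → 𝒜), ∑ w, ENNReal.ofReal (ψ (T.pat ty n z.1) (T.blk n z) w)
      ∂(envMeasure hτ.2.2.1 hty P ν)
      ≤ 2 ^ n * ENNReal.ofReal E := by
    have hm2 : Measurable fun z : X × (G → 𝒜) =>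
        ∑ w, ENNReal.ofReal (ψ (T.pat ty n z.1) (T.blk n z) w) :=
      T.measurable_local hτ.2.2.1 hty n fun t a _ => ∑ w, ENNReal.ofReal (ψ t a w)
    rw [envMeasure, Measure.lintegral_compProd hm2]
    calc _ ≤ ∫⁻ x, 2 ^ n * ENNReal.ofReal E ∂ν := ?_
      _ = _ := by simp
    refine lintegral_mono_ae (hgood.mono fun x hx => ?_)
    have h3 := lintegral_envKernel hτ.2.2.1 hty P x (T.θ_injective hx (n := n))
      fun b => ∑ w, ENNReal.ofReal (ψ (T.pat ty n x) b w)
    refine (le_of_eq h3).trans ?_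
    have h4 : ∀ b : Pos n → 𝒜, (∑ w, ENNReal.ofReal (ψ (T.pat ty n x) b w)) *
        ENNReal.ofReal (blockWeight (wt P) (fun v => ty (τ (T.θ n x v) x)) b)
        = ENNReal.ofReal (2 ^ n * (blockWeight (wt P) (T.pat ty n x) b *
          ((∑ p, ψ (T.pat ty n x) b p) / 2 ^ n))) := by
      intro b
      rw [← ENNReal.ofReal_sum_of_nonneg fun w _ => hψ _ _ _,
        ← ENNReal.ofReal_mul (Finset.sum_nonneg fun w _ => hψ _ _ _)]
      congr 1
      change (∑ i, ψ (T.pat ty n x) b i) * blockWeight (wt P) (T.pat ty n x) b = _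
      field_simp
    rw [Finset.sum_congr rfl fun b _ => h4 b, ← ENNReal.ofReal_sum_of_nonneg, ← Finset.mul_sum,
      ENNReal.ofReal_mul (by positivity), ENNReal.ofReal_pow (by norm_num)]
    · gcongr
      · simp
      · exact hE x hx
    · intro b _
      refine mul_nonneg (by positivity) (mul_nonneg (blockWeight_nonneg (wt_nonneg P) _ _)
        (div_nonneg (Finset.sum_nonneg fun w _ => hψ _ _ _) (by positivity)))
  have h5 : ∫⁻ z : X × (G → 𝒜), ∑ w, ENNReal.ofReal (ψ (T.pat ty n z.1) (T.blk n z) w)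
      ∂(envMeasure hτ.2.2.1 hty P ν) = 2 ^ n *
      ∫⁻ z, ENNReal.ofReal (ψ (T.pat ty n z.1) (T.blk n z) (T.pos n z.1))
      ∂(envMeasure hτ.2.2.1 hty P ν) := by
    rw [← h1]
    refine lintegral_congr_ae (hg.mono fun z hz => Finset.sum_congr rfl fun w _ => ?_)
    exact (T.ev_move hτ.2.1 hz w (fun t a p => ENNReal.ofReal (ψ t a p))).symm
  rw [h5] at h2
  exact (ENNReal.mul_le_mul_iff_right (by simp) (by simp)).mp h2

include hgood in
/-- A block rule error controls the error of the corresponding stationary code. -/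
theorem measure_ne_le {n : ℕ} {𝒞 : Type} (φ φ' : (Pos n → I) → (Pos n → 𝒜) → Pos n → 𝒞) {E : ℝ}
    (hE : ∀ x ∈ T.good, ∑ a, blockWeight (wt P) (T.pat ty n x) a *
      mism (φ (T.pat ty n x) a) (φ' (T.pat ty n x) a) ≤ E) :
    envMeasure hτ.2.2.1 hty P ν {z | T.ev ty n φ z ≠ T.ev ty n φ' z} ≤ ENNReal.ofReal E := by
  have h1 := T.lintegral_local_le hτ hgood hty P (fun t a p => discrep (φ t a p) (φ' t a p))
    (fun _ _ _ => discrep_nonneg _ _) hE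
  refine le_trans ?_ h1
  have hms : MeasurableSet {z : X × (G → 𝒜) | T.ev ty n φ z ≠ T.ev ty n φ' z} := by
    have := T.measurable_local (𝒜 := 𝒜) (Y := Prop) hτ.2.2.1 hty n fun t a p => φ t a p ≠ φ' t a p
    exact measurableSet_setOfPred.mpr this
  rw [← lintegral_indicator_one hms]
  refine lintegral_mono fun z => ?_
  by_cases hz : z ∈ {z : X × (G → 𝒜) | T.ev ty n φ z ≠ T.ev ty n φ' z}
  · rw [Set.indicator_of_mem hz]
    exact (ENNReal.ofReal_one.symm.trans (congrArg _ (discrep_of_ne hz).symm)).le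
  · rw [Set.indicator_of_notMem hz]; simp

/-- The code given by a block rule of level `n` only looks at `2 ^ n` sites. -/
theorem measure_ne_codeMap_le (hgood : ∀ᵐ x ∂ν, x ∈ T.good) {n : ℕ}
    (ψ : (Pos n → I) → (Pos n → ℱ) → Pos n → 𝒜)
    {F F' : X × (G → 𝒜) → ℱ} (hF : Measurable F) (hF' : Measurable F') :
    envMeasure hτ.2.2.1 hty P ν
      {z | T.ev ty n ψ (codeMap τ F z) ≠ T.ev ty n ψ (codeMap τ F' z)}
      ≤ 2 ^ n * envMeasure hτ.2.2.1 hty P ν {z | F z ≠ F' z} := by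
  have hms : MeasurableSet {z : X × (G → 𝒜) | F z ≠ F' z} :=
    (measurableSet_eq_fun hF hF').compl
  have hg := T.ae_labelled_good hτ hty P hgood
  have h1 := (T.labelled 𝒜).lintegral_sum (envMeasure_isMPAction hτ.2.2.1 hty P hτ) hg n
    (f := ({z : X × (G → 𝒜) | F z ≠ F' z}).indicator 1) (measurable_one.indicator hms)
  rw [lintegral_indicator_one hms] at h1
  have hms' : MeasurableSet {z : X × (G → 𝒜) |
      T.ev ty n ψ (codeMap τ F z) ≠ T.ev ty n ψ (codeMap τ F' z)} :=
    (measurableSet_eq_fun ((T.measurable_ev hτ.2.2.1 hty n ψ).comp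
      (measurable_codeMap hτ.2.2.1 hF)) ((T.measurable_ev hτ.2.2.1 hty n ψ).comp
      (measurable_codeMap hτ.2.2.1 hF'))).compl
  rw [← h1, ← lintegral_indicator_one hms']
  refine lintegral_mono fun z => ?_
  by_cases hz : z ∈ {z : X × (G → 𝒜) |
    T.ev ty n ψ (codeMap τ F z) ≠ T.ev ty n ψ (codeMap τ F' z)}
  · have : ∃ w, prodAct 𝒜 τ (T.θ n z.1 w) z ∈ {z : X × (G → 𝒜) | F z ≠ F' z} := by
      by_contra! hne
      refine hz ?_
      have hb : T.blk n (codeMap τ F z) = T.blk n (codeMap τ F' z) := by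
        funext w
        by_contra hw
        exact hne w hw
      rw [ev, ev, hb]
      rfl
    obtain ⟨w, hw⟩ := this
    rw [Set.indicator_of_mem hz]
    refine le_trans (le_of_eq ?_) (Finset.single_le_sum (fun _ _ => zero_le) (Finset.mem_univ w))
    exact (Set.indicator_of_mem hw (1 : X × (G → 𝒜) → ℝ≥0∞)).symm
  · rw [Set.indicator_of_notMem hz]; exact zero_le

end Estimates

end Tower

end Evaluation

noncomputable section CodeLaw

theorem abs_prod_sub_prod_le {ι : Type} (s : Finset ι) (A B : ι → ℝ)
    (hA : ∀ i ∈ s, 0 ≤ A i ∧ A i ≤ 1) (hB : ∀ i ∈ s, 0 ≤ B i ∧ B i ≤ 1) :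
    |∏ i ∈ s, A i - ∏ i ∈ s, B i| ≤ ∑ i ∈ s, |A i - B i| := by
  induction s using Finset.induction_on with
  | empty => simp
  | insert i s hi ih =>
    rw [Finset.prod_insert hi, Finset.prod_insert hi, Finset.sum_insert hi]
    have ih' := ih (fun j hj => hA j (Finset.mem_insert_of_mem hj))
      fun j hj => hB j (Finset.mem_insert_of_mem hj)
    have h1 : |∏ i ∈ s, A i| ≤ 1 := by
      rw [abs_of_nonneg (Finset.prod_nonneg fun j hj => (hA j (Finset.mem_insert_of_mem hj)).1)]
      exact Finset.prod_le_one (fun j hj => (hA j (Finset.mem_insert_of_mem hj)).1)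
        fun j hj => (hA j (Finset.mem_insert_of_mem hj)).2
    have h2 : |B i| ≤ 1 := by
      obtain ⟨h, h'⟩ := hB i (Finset.mem_insert_self i s)
      rwa [abs_of_nonneg h]
    calc |A i * ∏ j ∈ s, A j - B i * ∏ j ∈ s, B j|
        = |(A i - B i) * ∏ j ∈ s, A j + B i * (∏ j ∈ s, A j - ∏ j ∈ s, B j)| := by ring_nf
      _ ≤ |(A i - B i) * ∏ j ∈ s, A j| + |B i * (∏ j ∈ s, A j - ∏ j ∈ s, B j)| := abs_add_le _ _
      _ ≤ |A i - B i| + |∏ j ∈ s, A j - ∏ j ∈ s, B j| := by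
        rw [abs_mul, abs_mul]
        exact add_le_add (mul_le_of_le_one_right (abs_nonneg _) h1)
          (mul_le_of_le_one_left (abs_nonneg _) h2)
      _ ≤ _ := by linarith

/-- The weights of two events are close if a coupling rarely separates them. -/
theorem IsCoupling.abs_sub_le {A B J : Type} [Fintype A] [Fintype B] {p : A → ℝ} {q : B → ℝ}
    {ξ : A → B → ℝ} (h : IsCoupling p q ξ) {𝒞 : Type} (s : Finset J) (u : A → J → 𝒞)
    (v : B → J → 𝒞) (β : J → 𝒞) :
    |∑ a, p a * (if ∀ g ∈ s, u a g = β g then 1 else 0)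
      - ∑ b, q b * (if ∀ g ∈ s, v b g = β g then 1 else 0)|
      ≤ ∑ g ∈ s, ∑ a, ∑ b, ξ a b * discrep (u a g) (v b g) := by
  have h1 : ∑ a, p a * (if ∀ g ∈ s, u a g = β g then (1 : ℝ) else 0)
      = ∑ a, ∑ b, ξ a b * (if ∀ g ∈ s, u a g = β g then 1 else 0) :=
    Finset.sum_congr rfl fun a _ => by rw [← h.2.1, Finset.sum_mul]
  have h2 : ∑ b, q b * (if ∀ g ∈ s, v b g = β g then (1 : ℝ) else 0)
      = ∑ a, ∑ b, ξ a b * (if ∀ g ∈ s, v b g = β g then 1 else 0) := by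
    rw [Finset.sum_comm]
    exact Finset.sum_congr rfl fun b _ => by rw [← h.2.2, Finset.sum_mul]
  rw [h1, h2, ← Finset.sum_sub_distrib, Finset.sum_comm]
  refine (Finset.abs_sum_le_sum_abs _ _).trans (Finset.sum_le_sum fun a _ => ?_) |>.trans
    (le_of_eq (Finset.sum_comm' (s := Finset.univ) (t := fun _ => s) (s' := fun _ => Finset.univ)
      (t' := s) (by simp) (f := fun a g => ∑ b, ξ a b * discrep (u a g) (v b g)))) |>.trans
      (le_of_eq ?_)
  · rw [← Finset.sum_sub_distrib, Finset.sum_comm]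
    refine (Finset.abs_sum_le_sum_abs _ _).trans (Finset.sum_le_sum fun b _ => ?_)
    rw [← mul_sub, abs_mul, abs_of_nonneg (h.1 a b), ← Finset.mul_sum]
    refine mul_le_mul_of_nonneg_left ?_ (h.1 a b)
    by_cases hall : ∀ g ∈ s, u a g = v b g
    · have : (∀ g ∈ s, u a g = β g) ↔ ∀ g ∈ s, v b g = β g :=
        ⟨fun h g hg => (hall g hg) ▸ h g hg, fun h g hg => (hall g hg).symm ▸ h g hg⟩
      simp only [this, sub_self, abs_zero]
      exact Finset.sum_nonneg fun g _ => discrep_nonneg _ _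
    · push Not at hall
      obtain ⟨g, hg, hne⟩ := hall
      refine le_trans ?_ (Finset.single_le_sum (fun g _ => discrep_nonneg _ _) hg)
      rw [discrep_of_ne hne]
      split_ifs <;> simp
  · rw [Finset.sum_comm]

variable {G X I 𝒜 ℱ : Type} [Group G] [Countable G] [MeasurableSpace X] [Fintype I]
  [MeasurableSpace I] [MeasurableSingletonClass I] [Fintype 𝒜] [Nonempty 𝒜] [MeasurableSpace 𝒜]
  [MeasurableSingletonClass 𝒜] [Fintype ℱ] [Nonempty ℱ] [MeasurableSpace ℱ]
  [MeasurableSingletonClass ℱ] {τ : G → X → X}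

namespace Tower

variable (T : Tower τ)

/-- The element moving to the first site of the block of `τ g x`. -/
def key (n : ℕ) (x : X) (g : G) : G := T.θ n (τ g x) (fun _ => false) * g

section Key

variable (hmul : ∀ g h x, τ (g * h) x = τ g (τ h x))

include hmul

theorem θ_key {n : ℕ} {x : X} (hx : x ∈ T.good) (g : G) (w : Pos n) :
    T.θ n (τ (T.key n x g) x) w * T.key n x g = T.θ n (τ g x) w * g := by
  rw [key, hmul, ← mul_assoc, T.θ_cocycle n _ _ _ (T.good_inv g x hx)]

theorem pat_key {ty : X → I} {n : ℕ} {x : X} (hx : x ∈ T.good) (g : G) :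
    T.pat ty n (τ (T.key n x g) x) = T.pat ty n (τ g x) := by
  rw [key, hmul, T.pat_move hmul (T.good_inv g x hx)]

theorem key_θ {n : ℕ} {x : X} (hx : x ∈ T.good) (g : G) (w : Pos n) :
    T.key n x (T.θ n (τ g x) w * g) = T.key n x g := by
  rw [key, key, hmul, ← mul_assoc, T.θ_cocycle n _ _ _ (T.good_inv g x hx)]

/-- The law of a block code factorizes over the blocks. -/
theorem envKernel_ev (hτm : ∀ g, Measurable (τ g)) {ty : X → I} (hty : Measurable ty)
    (P : I → Measure 𝒜) [∀ i, IsProbabilityMeasure (P i)] {n : ℕ} {𝒞 : Type}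
    (φ : (Pos n → I) → (Pos n → 𝒜) → Pos n → 𝒞) {x : X} (hx : x ∈ T.good) (W : Finset G)
    (β : G → 𝒞) :
    envKernel hτm hty P x {a | ∀ g ∈ W, T.ev ty n φ (prodAct 𝒜 τ g (x, a)) = β g}
      = ENNReal.ofReal (∏ r ∈ W.image (T.key n x),
        ∑ a, blockWeight (wt P) (T.pat ty n (τ r x)) a *
          if ∀ g ∈ W.filter (fun g => T.key n x g = r),
            φ (T.pat ty n (τ r x)) a (T.pos n (τ g x)) = β g then 1 else 0) := by
  set K := W.image (T.key n x) with hK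
  set s : K × Pos n → G := fun v => T.θ n (τ (v.1 : G) x) v.2 * (v.1 : G) with hs
  have hkey : ∀ v, T.key n x (s v) = v.1 := by
    rintro ⟨⟨r, hr⟩, w⟩
    obtain ⟨g, -, rfl⟩ := Finset.mem_image.mp hr
    simp only [hs]
    rw [T.θ_key hmul hx, T.key_θ hmul hx]
  have hinj : Function.Injective s := by
    intro v v' h
    have h1 : v.1 = v'.1 := Subtype.ext (by rw [← hkey, ← hkey, h])
    refine Prod.ext h1 ?_
    obtain ⟨r, w⟩ := v
    obtain ⟨r', w'⟩ := v'
    obtain rfl : r = r' := h1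
    exact T.θ_injective (T.good_inv _ _ hx) (mul_right_cancel h)
  set C : K → (Pos n → 𝒜) → Prop := fun r a => ∀ g ∈ W.filter (fun g => T.key n x g = r),
    φ (T.pat ty n (τ (r : G) x)) a (T.pos n (τ g x)) = β g with hC
  have hev : ∀ a : G → 𝒜, (∀ g ∈ W, T.ev ty n φ (prodAct 𝒜 τ g (x, a)) = β g)
      ↔ ∀ r : K, C r (fun w => a (s (r, w))) := by
    intro a
    have h1 : ∀ g, T.ev ty n φ (prodAct 𝒜 τ g (x, a)) = φ (T.pat ty n (τ (T.key n x g) x))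
        (fun w => a (T.θ n (τ (T.key n x g) x) w * T.key n x g)) (T.pos n (τ g x)) := by
      intro g
      rw [T.pat_key hmul hx]
      simp only [T.θ_key hmul hx]
      rfl
    constructor
    · rintro h ⟨r, hr⟩ g hg
      obtain ⟨hgW, rfl⟩ := Finset.mem_filter.mp hg
      rw [← h g hgW, h1]
    · intro h g hg
      rw [h1]
      exact h ⟨T.key n x g, Finset.mem_image_of_mem _ hg⟩ g (Finset.mem_filter.mpr ⟨hg, rfl⟩)
  set Fn : (K × Pos n → 𝒜) → ℝ := fun b => ∏ r : K, if C r (fun w => b (r, w)) then 1 else 0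
    with hFn
  have hms : MeasurableSet {a : G → 𝒜 | ∀ g ∈ W, T.ev ty n φ (prodAct 𝒜 τ g (x, a)) = β g} := by
    simp only [hev]
    have hm : Measurable fun (a : G → 𝒜) (v : K × Pos n) => a (s v) :=
      measurable_pi_lambda _ fun _ => measurable_pi_apply _
    exact hm (MeasurableSet.of_discrete (s := {b | ∀ r : K, C r fun w => b (r, w)}))
  have h0 : ∀ a : G → 𝒜, ({a : G → 𝒜 | ∀ g ∈ W, T.ev ty n φ (prodAct 𝒜 τ g (x, a)) = β g}).indicator
      (1 : (G → 𝒜) → ℝ≥0∞) a = ENNReal.ofReal (Fn fun v => a (s v)) := by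
    intro a
    by_cases ha : ∀ r : K, C r (fun w => a (s (r, w)))
    · refine (Set.indicator_of_mem (show a ∈ {a : G → 𝒜 | ∀ g ∈ W,
        T.ev ty n φ (prodAct 𝒜 τ g (x, a)) = β g} from (hev a).mpr ha) _).trans ?_
      simp [hFn, ha]
    · refine (Set.indicator_of_notMem (fun h : a ∈ {a : G → 𝒜 | ∀ g ∈ W,
        T.ev ty n φ (prodAct 𝒜 τ g (x, a)) = β g} => ha ((hev a).mp h)) _).trans ?_
      push Not at ha
      obtain ⟨r, hr⟩ := ha
      rw [hFn]
      simp only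
      rw [Finset.prod_eq_zero (Finset.mem_univ r) (if_neg hr), ENNReal.ofReal_zero]
  rw [← lintegral_indicator_one hms, lintegral_congr h0,
    lintegral_envKernel hτm hty P x hinj fun b => ENNReal.ofReal (Fn b)]
  have hFn0 : ∀ b, 0 ≤ Fn b := fun b => Finset.prod_nonneg fun r _ => by split_ifs <;> norm_num
  simp only [← ENNReal.ofReal_mul (hFn0 _)]
  rw [← ENNReal.ofReal_sum_of_nonneg fun b _ =>
    mul_nonneg (hFn0 b) (blockWeight_nonneg (wt_nonneg P) _ _)]
  congr 1
  rw [← Finset.prod_coe_sort K (fun r => ∑ a, blockWeight (wt P) (T.pat ty n (τ r x)) a *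
          if ∀ g ∈ W.filter (fun g => T.key n x g = r),
            φ (T.pat ty n (τ r x)) a (T.pos n (τ g x)) = β g then 1 else 0),
    Finset.prod_univ_sum, Fintype.piFinset_univ]
  refine Fintype.sum_equiv (Equiv.curry K (Pos n) 𝒜) _ _ fun b => ?_
  rw [hFn, blockWeight, Fintype.prod_prod_type, ← Finset.prod_mul_distrib]
  refine Finset.prod_congr rfl fun r _ => ?_
  rw [mul_comm]
  congr 1
  simp only [blockWeight, pat, hs, hmul, Equiv.curry_apply]
  rfl

end Key

/-- The error of a block rule at a position. -/
def posError {n : ℕ} (ξ : (Pos n → I) → (Pos n → 𝒜) → (Pos n → ℱ) → ℝ)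
    (f : (Pos n → I) → (Pos n → 𝒜) → Pos n → ℱ) (t : Pos n → I) (p : Pos n) : ℝ :=
  ∑ a, ∑ b, ξ t a b * discrep (f t a p) (b p)

/-- The error of a block rule at a site. -/
def siteError (ty : X → I) (n : ℕ) (ξ : (Pos n → I) → (Pos n → 𝒜) → (Pos n → ℱ) → ℝ)
    (f : (Pos n → I) → (Pos n → 𝒜) → Pos n → ℱ) (x : X) : ℝ :=
  posError ξ f (T.pat ty n x) (T.pos n x)

/-- The patterns occurring in the tower. -/
def Adm (ty : X → I) (n : ℕ) (t : Pos n → I) : Prop := ∃ x ∈ T.good, T.pat ty n x = t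

theorem measurable_siteError {ty : X → I} (hτm : ∀ g, Measurable (τ g)) (hty : Measurable ty) {n : ℕ}
    (ξ : (Pos n → I) → (Pos n → 𝒜) → (Pos n → ℱ) → ℝ)
    (f : (Pos n → I) → (Pos n → 𝒜) → Pos n → ℱ) : Measurable (T.siteError ty n ξ f) := by
  have h2 : Measurable fun x => (T.pat ty n x, T.pos n x) :=
    (T.measurable_pat hτm hty n).prodMk (T.pos_meas n)
  have h : Measurable (Function.uncurry (posError ξ f)) := by
    generalize Function.uncurry (posError ξ f) = φ
    exact measurable_of_countable φ
  have e : T.siteError ty n ξ f = Function.uncurry (posError ξ f) ∘ fun x => (T.pat ty n x, T.pos n x) := by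
    funext x
    rw [siteError, Function.comp_apply, Function.uncurry_apply_pair]
  rw [e]
  generalize Function.uncurry (posError ξ f) = φ at h
  exact h.comp h2

section Stage

variable {ν : Measure X} [IsProbabilityMeasure ν] (hτ : IsMPAction ν τ)
  {ty : X → I} (hty : Measurable ty)
  (P : I → Measure 𝒜) [∀ i, IsProbabilityMeasure (P i)]
  (Q : I → Measure ℱ) [∀ i, IsProbabilityMeasure (Q i)]
  {n : ℕ} {ε : ℝ} {ξ : (Pos n → I) → (Pos n → 𝒜) → (Pos n → ℱ) → ℝ}
  {f : (Pos n → I) → (Pos n → 𝒜) → Pos n → ℱ} {g : (Pos n → I) → (Pos n → ℱ) → Pos n → 𝒜}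
  (hS : IsStage (wt P) (wt Q) (T.Adm ty) n ε ξ f g)

include hS

theorem siteError_nonneg {x : X} (hx : x ∈ T.good) : 0 ≤ T.siteError ty n ξ f x :=
  Finset.sum_nonneg fun a _ => Finset.sum_nonneg fun b _ =>
    mul_nonneg ((hS _ ⟨x, hx, rfl⟩).1.1 a b) (discrep_nonneg _ _)

include hτ hty in
theorem lintegral_siteError_le (hgood : ∀ᵐ x ∂ν, x ∈ T.good) :
    ∫⁻ x, ENNReal.ofReal (T.siteError ty n ξ f x) ∂ν ≤ ENNReal.ofReal ε := by
  have h1 := T.lintegral_sum hτ hgood n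
    (T.measurable_siteError hτ.2.2.1 hty ξ f).ennreal_ofReal
  have h2 : ∫⁻ x, ∑ w, ENNReal.ofReal (T.siteError ty n ξ f (τ (T.θ n x w) x)) ∂ν
      ≤ 2 ^ n * ENNReal.ofReal ε := by
    calc _ ≤ ∫⁻ x, 2 ^ n * ENNReal.ofReal ε ∂ν := ?_
      _ = _ := by simp
    refine lintegral_mono_ae (hgood.mono fun x hx => ?_)
    rw [← ENNReal.ofReal_sum_of_nonneg fun w _ => T.siteError_nonneg P Q hS (T.good_inv _ _ hx)]
    have h3 : ∑ w, T.siteError ty n ξ f (τ (T.θ n x w) x) = 2 ^ n *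
        ∑ a, ∑ b, ξ (T.pat ty n x) a b * mism (f (T.pat ty n x) a) b := by
      simp only [siteError, posError, T.pat_move hτ.2.1 hx, T.pos_θ hx]
      rw [Finset.sum_comm, Finset.mul_sum]
      refine Finset.sum_congr rfl fun a _ => ?_
      rw [Finset.sum_comm, Finset.mul_sum]
      refine Finset.sum_congr rfl fun b _ => ?_
      rw [← Finset.mul_sum, mism]
      field_simp
    rw [h3, ENNReal.ofReal_mul (by positivity), ENNReal.ofReal_pow (by norm_num)]
    gcongr
    · simp
    · exact (hS _ ⟨x, hx, rfl⟩).2.1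
  rw [h1] at h2
  exact (ENNReal.mul_le_mul_iff_right (by simp) (by simp)).mp h2

/-- The law of the code is close to the independent law. -/
theorem abs_envKernel_sub_le {x : X} (hx : x ∈ T.good) (W : Finset G) (β : G → ℱ) :
    |((envKernel hτ.2.2.1 hty P x) {a | ∀ g ∈ W, T.ev ty n f (prodAct 𝒜 τ g (x, a)) = β g}).toReal
      - ((envKernel hτ.2.2.1 hty Q x) (cyl W β)).toReal| ≤ ∑ g ∈ W, T.siteError ty n ξ f (τ g x) := by
  have h1 := T.envKernel_ev hτ.2.1 hτ.2.2.1 hty P f hx W β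
  have h2 := T.envKernel_ev hτ.2.1 hτ.2.2.1 hty Q (n := n) (fun _ (b : Pos n → ℱ) => b) hx W β
  have h3 : {a : G → ℱ | ∀ g ∈ W, T.ev ty n (fun _ (b : Pos n → ℱ) => b) (prodAct ℱ τ g (x, a)) = β g}
      = cyl W β := by
    ext a
    have : ∀ g, T.ev ty n (fun _ (b : Pos n → ℱ) => b) (prodAct ℱ τ g (x, a)) = a g := by
      intro g
      have := T.blk_pos (n := n) (z := prodAct ℱ τ g (x, a)) (T.good_inv g x hx)
      refine this.trans ?_
      simp [prodAct, gShift]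
    simp [cyl, this]
  rw [h3] at h2
  have hbd : ∀ {𝒟 : Type} [Fintype 𝒟] [Nonempty 𝒟] [MeasurableSpace 𝒟] [MeasurableSingletonClass 𝒟]
      (R : I → Measure 𝒟) [∀ i, IsProbabilityMeasure (R i)] (t : Pos n → I)
      (c : (Pos n → 𝒟) → ℝ), (∀ a, 0 ≤ c a ∧ c a ≤ 1) →
      0 ≤ ∑ a, blockWeight (wt R) t a * c a ∧ ∑ a, blockWeight (wt R) t a * c a ≤ 1 := by
    intro 𝒟 _ _ _ _ R _ t c hc
    refine ⟨Finset.sum_nonneg fun a _ => mul_nonneg (blockWeight_nonneg (wt_nonneg R) _ _)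
      (hc a).1, ?_⟩
    rw [← sum_blockWeight (sum_wt R) t]
    exact Finset.sum_le_sum fun a _ => mul_le_of_le_one_right
      (blockWeight_nonneg (wt_nonneg R) _ _) (hc a).2
  have hite : ∀ (c : Prop) [Decidable c], 0 ≤ (if c then (1 : ℝ) else 0) ∧ (if c then (1 : ℝ) else 0) ≤ 1 := by
    intro c _; split_ifs <;> norm_num
  have hbP := fun r => hbd P (T.pat ty n (τ r x)) _ fun a =>
    hite (∀ g ∈ W.filter (fun g => T.key n x g = r), f (T.pat ty n (τ r x)) a (T.pos n (τ g x)) = β g)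
  have hbQ := fun r => hbd Q (T.pat ty n (τ r x)) _ fun a : Pos n → ℱ =>
    hite (∀ g ∈ W.filter (fun g => T.key n x g = r), a (T.pos n (τ g x)) = β g)
  rw [h1, h2, ENNReal.toReal_ofReal (Finset.prod_nonneg fun r _ => (hbP r).1),
    ENNReal.toReal_ofReal (Finset.prod_nonneg fun r _ => (hbQ r).1)]
  refine (abs_prod_sub_prod_le _ _ _ (fun r _ => hbP r) fun r _ => hbQ r).trans ?_
  rw [← Finset.sum_fiberwise_of_maps_to (s := W) (t := W.image (T.key n x)) (g := T.key n x)
    (fun g hg => Finset.mem_image_of_mem _ hg)]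
  refine Finset.sum_le_sum fun r hr => ?_
  obtain ⟨g₀, -, rfl⟩ := Finset.mem_image.mp hr
  have hco := (hS _ ⟨_, T.good_inv (T.key n x g₀) x hx, rfl⟩).1
  refine (hco.abs_sub_le (W.filter fun g => T.key n x g = T.key n x g₀)
    (fun a g => f (T.pat ty n (τ (T.key n x g₀) x)) a (T.pos n (τ g x)))
    (fun b g => b (T.pos n (τ g x))) β).trans (Finset.sum_le_sum fun g hg => ?_)
  rw [← (Finset.mem_filter.mp hg).2, T.pat_key hτ.2.1 hx]
  rfl

/-- The joint law of the environment and the code is close to the independent one. -/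
theorem measure_codeMap_close (hgood : ∀ᵐ x ∂ν, x ∈ T.good) {s : Set X} (hs : MeasurableSet s)
    (W : Finset G) (β : G → ℱ) :
    envMeasure hτ.2.2.1 hty P ν (codeMap τ (T.ev ty n f) ⁻¹' (s ×ˢ cyl W β))
      ≤ envMeasure hτ.2.2.1 hty Q ν (s ×ˢ cyl W β) + W.card * ENNReal.ofReal ε ∧
    envMeasure hτ.2.2.1 hty Q ν (s ×ˢ cyl W β)
      ≤ envMeasure hτ.2.2.1 hty P ν (codeMap τ (T.ev ty n f) ⁻¹' (s ×ˢ cyl W β))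
        + W.card * ENNReal.ofReal ε := by
  have hm1 : MeasurableSet (s ×ˢ cyl W β) := hs.prod (measurableSet_cyl W β)
  have hm2 : MeasurableSet (codeMap τ (T.ev ty n f) ⁻¹' (s ×ˢ cyl W β)) :=
    measurable_codeMap hτ.2.2.1 (T.measurable_ev (𝒜 := 𝒜) hτ.2.2.1 hty n f) hm1
  have herr : ∫⁻ x, ∑ g ∈ W, ENNReal.ofReal (T.siteError ty n ξ f (τ g x)) ∂ν
      ≤ W.card * ENNReal.ofReal ε := by
    have hme := (T.measurable_siteError hτ.2.2.1 hty ξ f).ennreal_ofReal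
    rw [lintegral_finsetSum W (f := fun g x => ENNReal.ofReal (T.siteError ty n ξ f (τ g x)))
      fun g _ => hme.comp (hτ.2.2.1 g), ← nsmul_eq_mul,
      ← Finset.sum_const]
    refine Finset.sum_le_sum fun g _ => ?_
    have := hτ.lintegral_comp g hme
    rw [this]
    exact T.lintegral_siteError_le hτ hty P Q hS hgood
  have hpt : ∀ x ∈ T.good, x ∈ s →
      |((envKernel hτ.2.2.1 hty P x) (Prod.mk x ⁻¹' (codeMap τ (T.ev ty n f) ⁻¹' (s ×ˢ cyl W β)))).toReal
      - ((envKernel hτ.2.2.1 hty Q x) (Prod.mk x ⁻¹' (s ×ˢ cyl W β))).toReal|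
      ≤ ∑ g ∈ W, T.siteError ty n ξ f (τ g x) := by
    intro x hx hxs
    have e1 : Prod.mk x ⁻¹' (codeMap τ (T.ev ty n f) ⁻¹' (s ×ˢ cyl W β))
        = {a | ∀ g ∈ W, T.ev ty n f (prodAct 𝒜 τ g (x, a)) = β g} := by
      ext a; simp [codeMap, hxs, cyl]
    have e2 : Prod.mk x ⁻¹' (s ×ˢ cyl W β) = cyl W β := by
      ext a; simp [hxs]
    rw [e1, e2]
    exact T.abs_envKernel_sub_le hτ hty P Q hS hx W β
  have hout : ∀ x ∉ s, Prod.mk x ⁻¹' (codeMap τ (T.ev ty n f) ⁻¹' (s ×ˢ cyl W β)) = ∅ ∧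
      Prod.mk x ⁻¹' (s ×ˢ cyl W β) = ∅ := by
    intro x hxs
    constructor <;> (ext a; simp [codeMap, hxs])
  have key : ∀ u v : ℝ≥0∞, u ≠ ⊤ → v ≠ ⊤ → ∀ e : ℝ, |u.toReal - v.toReal| ≤ e →
      u ≤ v + ENNReal.ofReal e ∧ v ≤ u + ENNReal.ofReal e := by
    intro u v hu hv e he
    rw [abs_le] at he
    have he0 : 0 ≤ e := by linarith
    constructor
    · rw [← ENNReal.ofReal_toReal hu, ← ENNReal.ofReal_toReal hv,
        ← ENNReal.ofReal_add ENNReal.toReal_nonneg he0]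
      exact ENNReal.ofReal_le_ofReal (by linarith)
    · rw [← ENNReal.ofReal_toReal hu, ← ENNReal.ofReal_toReal hv,
        ← ENNReal.ofReal_add ENNReal.toReal_nonneg he0]
      exact ENNReal.ofReal_le_ofReal (by linarith)
  have hsum : ∀ x ∈ T.good, ENNReal.ofReal (∑ g ∈ W, T.siteError ty n ξ f (τ g x))
      = ∑ g ∈ W, ENNReal.ofReal (T.siteError ty n ξ f (τ g x)) := fun x hx =>
    ENNReal.ofReal_sum_of_nonneg fun g _ => T.siteError_nonneg P Q hS (T.good_inv g x hx)
  have hme1 := ProbabilityTheory.Kernel.measurable_kernel_prodMk_left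
    (κ := envKernel hτ.2.2.1 hty P) hm2
  have hme2 := ProbabilityTheory.Kernel.measurable_kernel_prodMk_left
    (κ := envKernel hτ.2.2.1 hty Q) hm1
  rw [envMeasure, envMeasure, Measure.compProd_apply hm1, Measure.compProd_apply hm2]
  constructor
  · refine le_trans ?_ (add_le_add_right herr _)
    rw [← lintegral_add_left hme2]
    refine lintegral_mono_ae (hgood.mono fun x hx => ?_)
    by_cases hxs : x ∈ s
    · rw [← hsum x hx]
      exact (key _ _ (measure_ne_top _ _) (measure_ne_top _ _) _ (hpt x hx hxs)).1
    · rw [(hout x hxs).1]; simp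
  · refine le_trans ?_ (add_le_add_right herr _)
    rw [← lintegral_add_left hme1]
    refine lintegral_mono_ae (hgood.mono fun x hx => ?_)
    by_cases hxs : x ∈ s
    · rw [← hsum x hx]
      exact (key _ _ (measure_ne_top _ _) (measure_ne_top _ _) _ (hpt x hx hxs)).2
    · rw [(hout x hxs).2]; simp

end Stage

end Tower

end CodeLaw

noncomputable section CodeLimit

theorem exists_limit_code {Z ℱ : Type} [MeasurableSpace Z] (M : Measure Z) [Countable ℱ] [Nonempty ℱ]
    [MeasurableSpace ℱ] [MeasurableSingletonClass ℱ] {F : ℕ → Z → ℱ} (hF : ∀ k, Measurable (F k))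
    {ε : ℕ → ℝ≥0∞} (hε : ∀ k, ε (k + 1) ≤ ε k / 2) (hε0 : ε 0 ≠ ⊤)
    (h : ∀ k, M {z | F k z ≠ F (k + 1) z} ≤ 3 * ε k) :
    ∃ F' : Z → ℱ, Measurable F' ∧ ∀ k, M {z | F k z ≠ F' z} ≤ 6 * ε k := by
  have hgeo : ∀ k j, ε (k + j) ≤ ε k * 2⁻¹ ^ j := by
    intro k j
    induction j with
    | zero => simp
    | succ j ih =>
      refine (hε (k + j)).trans ?_
      rw [pow_succ, ← mul_assoc, ENNReal.div_eq_inv_mul, mul_comm]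
      gcongr
  have htail : ∀ k, ∑' j, M {z | F (k + j) z ≠ F (k + j + 1) z} ≤ 6 * ε k := by
    intro k
    calc _ ≤ ∑' j : ℕ, 3 * ε k * 2⁻¹ ^ j := ENNReal.tsum_le_tsum fun j =>
          (h (k + j)).trans (by rw [mul_assoc]; gcongr; exact hgeo k j)
      _ = 6 * ε k := by
        rw [ENNReal.tsum_mul_left, ENNReal.tsum_geometric, ENNReal.one_sub_inv_two, inv_inv]
        ring
  have hev : ∀ᵐ z ∂M, ∀ᶠ k in atTop, F k z = F (k + 1) z := by
    have := ae_eventually_notMem (μ := M) (s := fun k => {z | F k z ≠ F (k + 1) z})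
      (ne_top_of_le_ne_top (ENNReal.mul_ne_top (a := 6) (by simp) hε0) (by simpa using htail 0))
    filter_upwards [this] with z hz
    filter_upwards [hz] with k hk
    simpa using hk
  have hms : ∀ b : ℱ, MeasurableSet {z | ∀ᶠ k in atTop, F k z = b} := by
    intro b
    simp only [eventually_atTop, Set.ofPred_exists, Set.ofPred_forall]
    exact .iUnion fun n => .iInter fun k => .iInter fun _ => hF k (measurableSet_singleton b)
  set b₀ : ℱ := Classical.arbitrary ℱ
  let F' : Z → ℱ := fun z => if hz : ∃ b, ∀ᶠ k in atTop, F k z = b then hz.choose else b₀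
  have hF'1 : ∀ z b, (∀ᶠ k in atTop, F k z = b) → F' z = b := by
    intro z b hb
    have hz : ∃ b, ∀ᶠ k in atTop, F k z = b := ⟨b, hb⟩
    have e : F' z = hz.choose := dif_pos hz
    obtain ⟨k, h1, h2⟩ := (hz.choose_spec.and hb).exists
    rw [e, ← h1, h2]
  refine ⟨F', ?_, fun k => ?_⟩
  · refine measurable_to_countable' fun b => ?_
    have : F' ⁻¹' {b} = {z | ∀ᶠ k in atTop, F k z = b} ∪
        {z | (¬ ∃ b, ∀ᶠ k in atTop, F k z = b) ∧ b = b₀} := by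
      ext z
      simp only [Set.mem_preimage, Set.mem_singleton_iff, Set.mem_union, Set.mem_ofPred_eq]
      constructor
      · rintro rfl
        by_cases hz : ∃ b, ∀ᶠ k in atTop, F k z = b
        · obtain ⟨b, hb⟩ := hz
          left; rwa [hF'1 z b hb]
        · right; exact ⟨hz, dif_neg hz⟩
      · rintro (hz | ⟨hz, rfl⟩)
        · exact hF'1 z b hz
        · exact dif_neg hz
    rw [this]
    refine (hms b).union ?_
    by_cases hb : b = b₀
    · simp only [hb, and_true]
      have : {z | ¬ ∃ b, ∀ᶠ k in atTop, F k z = b} = (⋃ b, {z | ∀ᶠ k in atTop, F k z = b})ᶜ := by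
        ext z; simp
      rw [this]
      exact (MeasurableSet.iUnion hms).compl
    · simp [hb]
  · refine le_trans ?_ (htail k)
    refine le_trans (measure_mono_ae ?_) (measure_iUnion_le _)
    filter_upwards [hev] with z hz hne
    by_contra hcon
    have hcon' : ∀ j, F (k + j) z = F (k + j + 1) z := by
      intro j
      by_contra hj
      exact hcon (Set.mem_iUnion.mpr ⟨j, hj⟩)
    have hconst : ∀ j, F (k + j) z = F k z := by
      intro j
      induction j with
      | zero => rfl
      | succ j ih => rw [← ih]; exact (hcon' j).symm
    refine hne (hF'1 z _ ?_).symm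
    filter_upwards [eventually_ge_atTop k] with j hj
    obtain ⟨i, rfl⟩ := Nat.exists_eq_add_of_le hj
    exact hconst i

theorem ENNReal.le_of_forall_le_add_mul {ε : ℕ → ℝ≥0∞} (hε : Tendsto ε atTop (nhds 0)) {a b c : ℝ≥0∞}
    (hc : c ≠ ⊤) (h : ∀ k, a ≤ b + c * ε k) : a ≤ b := by
  have h1 : Tendsto (fun k => b + c * ε k) atTop (nhds (b + c * 0)) :=
    tendsto_const_nhds.add (ENNReal.Tendsto.const_mul hε (Or.inr hc))
  simpa using ge_of_tendsto' h1 h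

theorem tendsto_zero_of_le_half {ε : ℕ → ℝ≥0∞} (hε : ∀ k, ε (k + 1) ≤ ε k / 2) (hε0 : ε 0 ≠ ⊤) :
    Tendsto ε atTop (nhds 0) := by
  have h : ∀ k, ε k ≤ ε 0 * 2⁻¹ ^ k := by
    intro k
    induction k with
    | zero => simp
    | succ k ih =>
      refine (hε k).trans ?_
      rw [pow_succ, ← mul_assoc, ENNReal.div_eq_inv_mul, mul_comm]
      gcongr
  have h1 : Tendsto (fun k : ℕ => ε 0 * 2⁻¹ ^ k) atTop (nhds (ε 0 * 0)) :=
    ENNReal.Tendsto.const_mul (ENNReal.tendsto_pow_atTop_nhds_zero_of_lt_one (by simp)) (Or.inr hε0)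
  rw [mul_zero] at h1
  exact tendsto_of_tendsto_of_tendsto_of_le_of_le tendsto_const_nhds h1 (fun _ => zero_le) h

variable {G X 𝒜 ℱ : Type} [Group G] [Countable G] [MeasurableSpace X]
  [Fintype 𝒜] [Nonempty 𝒜] [MeasurableSpace 𝒜] [MeasurableSingletonClass 𝒜] [Fintype ℱ] [Nonempty ℱ]
  [MeasurableSpace ℱ] [MeasurableSingletonClass ℱ] {τ : G → X → X} (hτm : ∀ g, Measurable (τ g))
  {μ : Measure (X × (G → 𝒜))} {μ' : Measure (X × (G → ℱ))} [IsProbabilityMeasure μ]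
  [IsProbabilityMeasure μ'] (hμ : IsMPAction μ (prodAct 𝒜 τ))

theorem codeMap_prodAct (hmul : ∀ g h x, τ (g * h) x = τ g (τ h x)) (F : X × (G → 𝒜) → ℱ) (g : G) (z : X × (G → 𝒜)) :
    codeMap τ F (prodAct 𝒜 τ g z) = prodAct ℱ τ g (codeMap τ F z) := by
  refine Prod.ext rfl (funext fun h => ?_)
  change F (prodAct 𝒜 τ h (prodAct 𝒜 τ g z)) = F (prodAct 𝒜 τ (h * g) z)
  congr 1
  refine Prod.ext (hmul h g _).symm (funext fun k => ?_)
  simp [prodAct, gShift, mul_assoc]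

include hτm hμ

theorem measure_preimage_codeMap_le {F F' : X × (G → 𝒜) → ℱ} (hF : Measurable F)
    (hF' : Measurable F') (s : Set X) (W : Finset G) (β : G → ℱ) :
    μ (codeMap τ F ⁻¹' (s ×ˢ cyl W β)) ≤ μ (codeMap τ F' ⁻¹' (s ×ˢ cyl W β))
      + W.card * μ {z | F z ≠ F' z} := by
  have hm : MeasurableSet {z | F z ≠ F' z} := (measurableSet_eq_fun hF hF').compl
  have h1 : codeMap τ F ⁻¹' (s ×ˢ cyl W β) ⊆ codeMap τ F' ⁻¹' (s ×ˢ cyl W β) ∪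
      ⋃ g ∈ W, prodAct 𝒜 τ g ⁻¹' {z | F z ≠ F' z} := by
    rintro z ⟨hz1, hz2⟩
    by_contra hcon
    refine hcon (Or.inl ⟨hz1, fun g hg => ?_⟩)
    rw [← hz2 g hg]
    by_contra hne
    exact hcon (Or.inr (Set.mem_biUnion hg (Ne.symm hne)))
  refine (measure_mono h1).trans ((measure_union_le _ _).trans ?_)
  gcongr
  refine (measure_biUnion_finset_le _ _).trans ?_
  rw [← nsmul_eq_mul, ← Finset.sum_const]
  refine Finset.sum_le_sum fun g _ => ?_
  rw [← Measure.map_apply (hμ.2.2.1 g) hm, hμ.2.2.2 g]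

theorem map_codeMap_eq {F : ℕ → X × (G → 𝒜) → ℱ} (hF : ∀ k, Measurable (F k))
    {F' : X × (G → 𝒜) → ℱ} (hF' : Measurable F') {ε : ℕ → ℝ≥0∞} (hε : Tendsto ε atTop (nhds 0))
    (h : ∀ k, μ {z | F k z ≠ F' z} ≤ 6 * ε k)
    (hlaw : ∀ k (s : Set X), MeasurableSet s → ∀ (W : Finset G) (β : G → ℱ),
      μ (codeMap τ (F k) ⁻¹' (s ×ˢ cyl W β)) ≤ μ' (s ×ˢ cyl W β) + W.card * ε k ∧
      μ' (s ×ˢ cyl W β) ≤ μ (codeMap τ (F k) ⁻¹' (s ×ˢ cyl W β)) + W.card * ε k) :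
    μ.map (codeMap τ F') = μ' := by
  have hm := measurable_codeMap (𝒜 := 𝒜) hτm hF'
  have : IsProbabilityMeasure (μ.map (codeMap τ F')) := Measure.isProbabilityMeasure_map hm.aemeasurable
  refine ext_of_prod_cyl fun s W β hs => ?_
  rw [Measure.map_apply hm (hs.prod (measurableSet_cyl W β))]
  have h' : ∀ k, μ {z | F' z ≠ F k z} ≤ 6 * ε k := fun k => by
    simp only [ne_comm (a := F' _)]; exact h k
  refine le_antisymm ?_ ?_
  · refine ENNReal.le_of_forall_le_add_mul hε (c := W.card * 7) (by finiteness) fun k => ?_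
    refine (measure_preimage_codeMap_le hτm hμ hF' (hF k) s W β).trans ?_
    refine (add_le_add (hlaw k s hs W β).1 (mul_le_mul_right (h' k) _)).trans (le_of_eq ?_)
    ring
  · refine ENNReal.le_of_forall_le_add_mul hε (c := W.card * 7) (by finiteness) fun k => ?_
    refine (hlaw k s hs W β).2.trans ?_
    refine (add_le_add_left ((measure_preimage_codeMap_le hτm hμ (hF k) hF' s W β).trans
      (add_le_add_right (mul_le_mul_right (h k) _) _)) _).trans (le_of_eq ?_)
    ring

theorem ae_codeMap_codeMap {F : X × (G → 𝒜) → ℱ} {F' : X × (G → ℱ) → 𝒜} (h : ∀ᵐ z ∂μ, F' (codeMap τ F z) = z.2 1)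
    (hmul : ∀ g h x, τ (g * h) x = τ g (τ h x)) :
    ∀ᵐ z ∂μ, codeMap τ F' (codeMap τ F z) = z := by
  have h1 : ∀ᵐ z ∂μ, ∀ g, F' (codeMap τ F (prodAct 𝒜 τ g z)) = (prodAct 𝒜 τ g z).2 1 :=
    ae_all_iff.mpr fun g => hμ.ae_of_ae h g
  filter_upwards [h1] with z hz
  refine Prod.ext rfl (funext fun g => ?_)
  have := hz g
  rw [codeMap_prodAct hmul] at this
  refine this.trans ?_
  simp [prodAct, gShift]

theorem ae_decode {F : ℕ → X × (G → 𝒜) → ℱ} (hF : ∀ k, Measurable (F k)) {F' : X × (G → 𝒜) → ℱ}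
    (hF' : Measurable F') {H : ℕ → X × (G → ℱ) → 𝒜} (hH : ∀ k, Measurable (H k))
    {H' : X × (G → ℱ) → 𝒜} (hH' : Measurable H') {ε : ℕ → ℝ≥0∞} (hε : Tendsto ε atTop (nhds 0))
    {N : ℕ → ℝ≥0∞} (hN : ∀ k, N k * ε (k + 1) ≤ ε k)
    (h : ∀ k, μ {z | F k z ≠ F' z} ≤ 6 * ε k) (h' : ∀ k, μ' {z | H k z ≠ H' z} ≤ 6 * ε k)
    (hdec : ∀ k, μ {z | H k (codeMap τ (F (k + 1)) z) ≠ z.2 1} ≤ 3 * ε k)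
    (hloc : ∀ k {E E' : X × (G → 𝒜) → ℱ}, Measurable E → Measurable E' →
      μ {z | H k (codeMap τ E z) ≠ H k (codeMap τ E' z)} ≤ N k * μ {z | E z ≠ E' z})
    (hlaw : μ.map (codeMap τ F') = μ') :
    ∀ᵐ z ∂μ, H' (codeMap τ F' z) = z.2 1 := by
  have hm := measurable_codeMap (𝒜 := 𝒜) hτm hF'
  have key : μ {z | ¬ H' (codeMap τ F' z) = z.2 1} ≤ 0 := by
    refine ENNReal.le_of_forall_le_add_mul hε (c := 15) (by simp) fun k => ?_
    have hsub : {z : X × (G → 𝒜) | ¬ H' (codeMap τ F' z) = z.2 1} ⊆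
        (codeMap τ F' ⁻¹' {y | H k y ≠ H' y} ∪
          {z | H k (codeMap τ (F (k + 1)) z) ≠ H k (codeMap τ F' z)}) ∪
        {z | H k (codeMap τ (F (k + 1)) z) ≠ z.2 1} := by
      intro z hz
      by_contra hcon
      simp only [Set.mem_union, Set.mem_preimage, Set.mem_ofPred_eq, not_or, not_not] at hcon
      exact hz (by rw [← hcon.2, hcon.1.2, hcon.1.1])
    have b1 : μ (codeMap τ F' ⁻¹' {y | H k y ≠ H' y}) ≤ 6 * ε k := by
      have hms : MeasurableSet {y | H k y ≠ H' y} := (measurableSet_eq_fun (hH k) hH').compl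
      rw [← Measure.map_apply hm hms, hlaw]
      exact h' k
    have b2 : μ {z | H k (codeMap τ (F (k + 1)) z) ≠ H k (codeMap τ F' z)} ≤ 6 * ε k := by
      refine (hloc k (hF _) hF').trans ((mul_le_mul_right (h _) _).trans ?_)
      rw [mul_left_comm]
      exact mul_le_mul_right (hN k) _
    refine (measure_mono hsub).trans ((measure_union_le _ _).trans ((add_le_add
      ((measure_union_le _ _).trans (add_le_add b1 b2)) (hdec k)).trans (le_of_eq ?_)))
    ring
  exact ae_iff.mpr (le_antisymm key zero_le)

omit hμ

/-- Sequences of codes in both directions, becoming more and more accurate, converge to an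
isomorphism. -/
theorem isMeasIsoG_of_codes (hμ : IsMPAction μ (prodAct 𝒜 τ)) (hμ' : IsMPAction μ' (prodAct ℱ τ))
    (hmul : ∀ g h x, τ (g * h) x = τ g (τ h x))
    {F : ℕ → X × (G → 𝒜) → ℱ} (hF : ∀ k, Measurable (F k))
    {H : ℕ → X × (G → ℱ) → 𝒜} (hH : ∀ k, Measurable (H k)) {ε : ℕ → ℝ≥0∞}
    (hε : ∀ k, ε (k + 1) ≤ ε k / 2) (hε0 : ε 0 ≠ ⊤)
    {N : ℕ → ℝ≥0∞} (hN : ∀ k, N k * ε (k + 1) ≤ ε k)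
    (hFF : ∀ k, μ {z | F k z ≠ F (k + 1) z} ≤ 3 * ε k)
    (hHH : ∀ k, μ' {z | H k z ≠ H (k + 1) z} ≤ 3 * ε k)
    (hHF : ∀ k, μ {z | H k (codeMap τ (F (k + 1)) z) ≠ z.2 1} ≤ 3 * ε k)
    (hFH : ∀ k, μ' {z | F k (codeMap τ (H (k + 1)) z) ≠ z.2 1} ≤ 3 * ε k)
    (hloc : ∀ k {E E' : X × (G → 𝒜) → ℱ}, Measurable E → Measurable E' →
      μ {z | H k (codeMap τ E z) ≠ H k (codeMap τ E' z)} ≤ N k * μ {z | E z ≠ E' z})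
    (hloc' : ∀ k {E E' : X × (G → ℱ) → 𝒜}, Measurable E → Measurable E' →
      μ' {z | F k (codeMap τ E z) ≠ F k (codeMap τ E' z)} ≤ N k * μ' {z | E z ≠ E' z})
    (hlaw : ∀ k (s : Set X), MeasurableSet s → ∀ (W : Finset G) (β : G → ℱ),
      μ (codeMap τ (F k) ⁻¹' (s ×ˢ cyl W β)) ≤ μ' (s ×ˢ cyl W β) + W.card * ε k ∧
      μ' (s ×ˢ cyl W β) ≤ μ (codeMap τ (F k) ⁻¹' (s ×ˢ cyl W β)) + W.card * ε k)
    (hlaw' : ∀ k (s : Set X), MeasurableSet s → ∀ (W : Finset G) (β : G → 𝒜),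
      μ' (codeMap τ (H k) ⁻¹' (s ×ˢ cyl W β)) ≤ μ (s ×ˢ cyl W β) + W.card * ε k ∧
      μ (s ×ˢ cyl W β) ≤ μ' (codeMap τ (H k) ⁻¹' (s ×ˢ cyl W β)) + W.card * ε k) :
    IsMeasIsoG μ μ' (prodAct 𝒜 τ) (prodAct ℱ τ) := by
  have hlim := tendsto_zero_of_le_half hε hε0
  obtain ⟨F', hF', h1⟩ := exists_limit_code μ hF hε hε0 hFF
  obtain ⟨H', hH', h2⟩ := exists_limit_code μ' hH hε hε0 hHH
  have m1 := map_codeMap_eq hτm hμ hF hF' hlim h1 hlaw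
  have m2 := map_codeMap_eq hτm hμ' hH hH' hlim h2 hlaw'
  exact ⟨codeMap τ F', codeMap τ H', measurable_codeMap hτm hF', measurable_codeMap hτm hH', m1, m2,
    fun g => ae_of_all _ fun z => codeMap_prodAct hmul F' g z,
    ae_codeMap_codeMap hτm hμ (ae_decode hτm hμ hF hF' hH hH' hlim hN h1 h2 hHF hloc m1) hmul,
    ae_codeMap_codeMap hτm hμ' (ae_decode hτm hμ' hH hH' hF hF' hlim hN h2 h1 hFH hloc' m2) hmul⟩

end CodeLimit

noncomputable section CodeSequence

variable {G X I 𝒜 ℱ : Type} [Group G] [Countable G] [MeasurableSpace X] [Fintype I]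
  [MeasurableSpace I] [MeasurableSingletonClass I] [Fintype 𝒜] [Nonempty 𝒜] [MeasurableSpace 𝒜]
  [MeasurableSingletonClass 𝒜] [Fintype ℱ] [Nonempty ℱ] [MeasurableSpace ℱ]
  [MeasurableSingletonClass ℱ] {τ : G → X → X}

namespace Tower

variable (T : Tower τ)

theorem adm_subBlock (hmul : ∀ g h x, τ (g * h) x = τ g (τ h x)) (ty : X → I) (n r : ℕ)
    (t : Pos (n + r) → I) (ht : T.Adm ty (n + r) t) (j : Pos r) : T.Adm ty n (subBlock t j) := by
  obtain ⟨x, hx, rfl⟩ := ht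
  set w : Pos (n + r) := Fin.append (fun _ => false) j with hw
  have h := T.subBlock_pat (ty := ty) (n := n) (r := r) (T.good_inv (T.θ (n + r) x w) x hx)
  rw [T.pat_move hmul hx, T.pos_θ hx, hw, tailPos_append] at h
  exact ⟨_, T.good_inv _ _ hx, h.symm⟩

variable {ν : Measure X} [IsProbabilityMeasure ν] (hτ : IsMPAction ν τ)
  {ty : X → I} (hty : Measurable ty)
  (P : I → Measure 𝒜) [∀ i, IsProbabilityMeasure (P i)]
  (Q : I → Measure ℱ) [∀ i, IsProbabilityMeasure (Q i)]
  (hgood : ∀ᵐ x ∂ν, x ∈ T.good)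

include hgood

theorem step_estimates {n r r' : ℕ} {ε ε' : ℝ} (hε : 2 * ε + 2 ^ n * ε' ≤ 3 * ε) (hε' : 0 ≤ ε')
    {f : (Pos n → I) → (Pos n → 𝒜) → Pos n → ℱ} {g : (Pos n → I) → (Pos n → ℱ) → Pos n → 𝒜}
    {ξ' : (Pos (n + r + r') → I) → (Pos (n + r + r') → 𝒜) → (Pos (n + r + r') → ℱ) → ℝ}
    {f' : (Pos (n + r + r') → I) → (Pos (n + r + r') → 𝒜) → Pos (n + r + r') → ℱ}
    {g' : (Pos (n + r + r') → I) → (Pos (n + r + r') → ℱ) → Pos (n + r + r') → 𝒜}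
    (h1 : IsStage (wt P) (wt Q) (T.Adm ty) (n + r + r') ε' ξ' f' g')
    (h2 : IsStage (wt P) (wt Q) (T.Adm ty) (n + r + r') (2 * ε) ξ' (liftRule r' (liftRule r f))
        (liftRule r' (liftRule r g))) :
    envMeasure hτ.2.2.1 hty P ν {z | T.ev ty n f z ≠ T.ev ty (n + r + r') f' z}
      ≤ 3 * ENNReal.ofReal ε ∧
    envMeasure hτ.2.2.1 hty P ν {z | T.ev ty n g (codeMap τ (T.ev ty (n + r + r') f') z) ≠ z.2 1}
      ≤ 3 * ENNReal.ofReal ε := by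
  have hz := T.ae_labelled_good hτ hty P hgood
  have h3 : ENNReal.ofReal (3 * ε) = 3 * ENNReal.ofReal ε := by
    rw [ENNReal.ofReal_mul (by norm_num)]; simp
  have hpow : ε' ≤ 2 ^ n * ε' := le_mul_of_one_le_left hε' (one_le_pow₀ (by norm_num))
  rw [← h3]
  constructor
  · refine le_trans (measure_mono_ae ?_) (T.measure_ne_le hτ hgood hty P
      (liftRule r' (liftRule r f)) f' (E := 3 * ε) fun x hx =>
        (h2.rule_close h1 _ ⟨x, hx, rfl⟩).trans (by linarith))
    filter_upwards [hz] with z hz hne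
    have : T.ev ty (n + r + r') (liftRule r' (liftRule r f)) z = T.ev ty n f z := by
      rw [T.ev_liftRule hz, T.ev_liftRule hz]
    exact fun h => hne (this ▸ h)
  · refine le_trans (measure_mono_ae ?_) (T.measure_ne_le hτ hgood hty P
      (fun t a => liftRule r' (liftRule r g) t (f' t a)) (fun _ a => a) (E := 3 * ε) fun x hx =>
        (h2.decode (K := 2 ^ n) (by positivity) h1 (((isLipRule_two_pow g).liftRule r).liftRule r')
          _ ⟨x, hx, rfl⟩).trans hε)
    filter_upwards [hz] with z hz hne h
    refine hne ?_
    have hz' : (codeMap τ (T.ev ty (n + r + r') f') z).1 ∈ T.good := hz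
    rw [← T.ev_liftRule hz' (r := r), ← T.ev_liftRule hz' (r := r'), ← T.blk_pos hz (n := n + r + r')]
    refine Eq.trans ?_ h
    rw [ev, T.blk_codeMap hτ.2.1 hz]
    rfl

/-- A pair of block rules in opposite directions together with their accuracy. -/
structure RulePair (I 𝒜 ℱ : Type) where
  lvl : ℕ
  enc : (Pos lvl → I) → (Pos lvl → 𝒜) → Pos lvl → ℱ
  dec : (Pos lvl → I) → (Pos lvl → ℱ) → Pos lvl → 𝒜
  err : ℝ

/-- Two label processes over the same environment with almost constant and equal block entropies
along a tower are isomorphic. -/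
theorem isMeasIsoG_envMeasure {h R : ℝ} (hh : 0 < h)
    (hAP : ∀ n t, T.Adm ty n t → |∑ v, siteEntropy (wt P) (t v) - 2 ^ n * h| ≤ R)
    (hAQ : ∀ n t, T.Adm ty n t → |∑ v, siteEntropy (wt Q) (t v) - 2 ^ n * h| ≤ R) :
    IsMeasIsoG (envMeasure hτ.2.2.1 hty P ν) (envMeasure hτ.2.2.1 hty Q ν)
      (prodAct 𝒜 τ) (prodAct ℱ τ) := by
  let Valid : RulePair I 𝒜 ℱ → Prop := fun c => R < 2 ^ c.lvl * h ∧ 0 < c.err ∧ c.err ≤ 1 ∧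
    ∃ ξ, IsStage (wt P) (wt Q) (T.Adm ty) c.lvl c.err ξ c.enc c.dec
  have hstep : ∀ c, Valid c → ∃ c', Valid c' ∧ c'.err = c.err / 2 / 2 ^ c.lvl ∧
      envMeasure hτ.2.2.1 hty P ν {z | T.ev ty _ c.enc z ≠ T.ev ty _ c'.enc z}
        ≤ 3 * ENNReal.ofReal c.err ∧
      envMeasure hτ.2.2.1 hty Q ν {z | T.ev ty _ c.dec z ≠ T.ev ty _ c'.dec z}
        ≤ 3 * ENNReal.ofReal c.err ∧
      envMeasure hτ.2.2.1 hty P ν {z | T.ev ty _ c.dec (codeMap τ (T.ev ty _ c'.enc) z) ≠ z.2 1}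
        ≤ 3 * ENNReal.ofReal c.err ∧
      envMeasure hτ.2.2.1 hty Q ν {z | T.ev ty _ c.enc (codeMap τ (T.ev ty _ c'.dec) z) ≠ z.2 1}
        ≤ 3 * ENNReal.ofReal c.err := by
    rintro ⟨n, f, g, ε⟩ ⟨hn, hε, hε1, ξ, hS⟩
    simp only at hn hε hε1 hS
    have hε' : 0 < ε / 2 / 2 ^ n := by positivity
    obtain ⟨r, r', ξ', f', g', h1, h2⟩ := IsStage.exists_next (sum_wt P) (sum_wt Q)
      (T.adm_subBlock hτ.2.1 ty) hh.le hAP hAQ hn hε hε1 hS hε'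
    have hc : 2 * ε + 2 ^ n * (ε / 2 / 2 ^ n) ≤ 3 * ε := by
      rw [mul_div_cancel₀ _ (by positivity)]; linarith
    obtain ⟨e1, e2⟩ := T.step_estimates hτ hty P Q hgood hc hε'.le h1 h2
    obtain ⟨e3, e4⟩ := T.step_estimates hτ hty Q P hgood hc hε'.le h1.swap h2.swap
    refine ⟨⟨n + r + r', f', g', ε / 2 / 2 ^ n⟩, ⟨?_, hε', ?_, ξ', h1⟩, rfl, e1, e3, e2, e4⟩
    · refine hn.trans_le (mul_le_mul_of_nonneg_right ?_ hh.le)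
      exact pow_le_pow_right₀ (by norm_num) (by simp only; omega)
    · refine (div_le_self (by positivity) (one_le_pow₀ (by norm_num))).trans ?_
      linarith
  obtain ⟨n₀, hn₀⟩ : ∃ n₀ : ℕ, R < 2 ^ n₀ * h := by
    obtain ⟨n₀, hn₀⟩ := pow_unbounded_of_one_lt (R / h) (one_lt_two)
    exact ⟨n₀, (div_lt_iff₀ hh).mp hn₀⟩
  have h0 : Valid ⟨n₀, fun _ _ _ => Classical.arbitrary ℱ, fun _ _ _ => Classical.arbitrary 𝒜, 1⟩ :=
    ⟨hn₀, one_pos, le_rfl, _, isStage_one (wt_nonneg P) (wt_nonneg Q) (sum_wt P) (sum_wt Q) _ _ _ _⟩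
  choose! nx hnx using hstep
  let c : ℕ → RulePair I 𝒜 ℱ := fun k => nx^[k]
    ⟨n₀, fun _ _ _ => Classical.arbitrary ℱ, fun _ _ _ => Classical.arbitrary 𝒜, 1⟩
  have hcs : ∀ k, c (k + 1) = nx (c k) := fun k => Function.iterate_succ_apply' _ _ _
  have hV : ∀ k, Valid (c k) := by
    intro k
    induction k with
    | zero => exact h0
    | succ k ih => rw [hcs]; exact (hnx _ ih).1
  have hpos : ∀ k, 0 < (c k).err := fun k => (hV k).2.1
  have herr : ∀ k, (c (k + 1)).err = (c k).err / 2 / 2 ^ (c k).lvl := fun k => by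
    rw [hcs]; exact (hnx _ (hV k)).2.1
  have htwo : (2 : ℝ≥0∞) = ENNReal.ofReal 2 := by simp
  refine isMeasIsoG_of_codes hτ.2.2.1 (envMeasure_isMPAction hτ.2.2.1 hty P hτ)
    (envMeasure_isMPAction hτ.2.2.1 hty Q hτ) hτ.2.1
    (F := fun k => T.ev ty _ (c k).enc) (fun k => T.measurable_ev hτ.2.2.1 hty _ _)
    (H := fun k => T.ev ty _ (c k).dec) (fun k => T.measurable_ev hτ.2.2.1 hty _ _)
    (ε := fun k => ENNReal.ofReal (c k).err) (fun k => ?_) ENNReal.ofReal_ne_top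
    (N := fun k => 2 ^ (c k).lvl) (fun k => ?_) (fun k => ?_) (fun k => ?_) (fun k => ?_)
    (fun k => ?_) (fun k E E' hE hE' => T.measure_ne_codeMap_le hτ hty P hgood _ hE hE')
    (fun k E E' hE hE' => T.measure_ne_codeMap_le hτ hty Q hgood _ hE hE')
    (fun k s hs W β => ?_) (fun k s hs W β => ?_)
  · rw [herr, htwo, ← ENNReal.ofReal_div_of_pos two_pos]
    refine ENNReal.ofReal_le_ofReal (div_le_self (by have := hpos k; positivity)
      (one_le_pow₀ (by norm_num)))
  · rw [herr, htwo, ← ENNReal.ofReal_pow two_pos.le, ← ENNReal.ofReal_mul (by positivity),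
      mul_div_cancel₀ _ (by positivity)]
    exact ENNReal.ofReal_le_ofReal (by linarith [hpos k])
  · rw [hcs]; exact (hnx _ (hV k)).2.2.1
  · rw [hcs]; exact (hnx _ (hV k)).2.2.2.1
  · rw [hcs]; exact (hnx _ (hV k)).2.2.2.2.1
  · rw [hcs]; exact (hnx _ (hV k)).2.2.2.2.2
  · obtain ⟨-, -, -, ξ, hS⟩ := hV k
    exact T.measure_codeMap_close hτ hty P Q hS hgood hs W β
  · obtain ⟨-, -, -, ξ, hS⟩ := hV k
    exact T.measure_codeMap_close hτ hty Q P hS.swap hgood hs W β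

end Tower

end CodeSequence

noncomputable section IidProcesses

theorem IsMeasIsoG.trans {G Y Z W : Type} [Group G] [MeasurableSpace Y] [MeasurableSpace Z]
    [MeasurableSpace W] {μ : Measure Y} {ν : Measure Z} {ρ : Measure W} {S : G → Y → Y}
    {T : G → Z → Z} {U : G → W → W} (h : IsMeasIsoG μ ν S T) (h' : IsMeasIsoG ν ρ T U) :
    IsMeasIsoG μ ρ S U := by
  obtain ⟨f, f', hf, hf', h1, h2, h3, h4, h5⟩ := h
  obtain ⟨k, k', hk, hk', h1', h2', h3', h4', h5'⟩ := h'
  have hμν : ∀ {p : Z → Prop}, (∀ᵐ z ∂ν, p z) → ∀ᵐ y ∂μ, p (f y) := fun hp =>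
    ae_of_ae_map hf.aemeasurable (by rwa [h1])
  have hρν : ∀ {p : Z → Prop}, (∀ᵐ z ∂ν, p z) → ∀ᵐ w ∂ρ, p (k' w) := fun hp =>
    ae_of_ae_map hk'.aemeasurable (by rwa [h2'])
  refine ⟨k ∘ f, f' ∘ k', hk.comp hf, hf'.comp hk', ?_, ?_, fun g => ?_, ?_, ?_⟩
  · rw [← Measure.map_map hk hf, h1, h1']
  · rw [← Measure.map_map hf' hk', h2', h2]
  · filter_upwards [h3 g, hμν (h3' g)] with y e1 e2
    simp only [Function.comp_apply, e1, e2]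
  · filter_upwards [h4, hμν h4'] with y e1 e2
    simp only [Function.comp_apply, e1, e2]
  · filter_upwards [h5', hρν h5] with y e1 e2
    simp only [Function.comp_apply, e1, e2]

theorem IsMeasIsoG.prod_right {G Y Z W : Type} [Group G] [MeasurableSpace Y] [MeasurableSpace Z]
    [MeasurableSpace W] {μ : Measure Y} {ν : Measure Z} {ρ : Measure W} [SFinite μ] [SFinite ν]
    [IsProbabilityMeasure ρ] {S : G → Y → Y}
    {T : G → Z → Z} {U : G → W → W} (h : IsMeasIsoG μ ν S T) :
    IsMeasIsoG (μ.prod ρ) (ν.prod ρ) (fun g => Prod.map (S g) (U g))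
      (fun g => Prod.map (T g) (U g)) := by
  obtain ⟨f, f', hf, hf', h1, h2, h3, h4, h5⟩ := h
  have hfst : ∀ {p : Y → Prop}, (∀ᵐ y ∂μ, p y) → ∀ᵐ z ∂(μ.prod ρ), p z.1 := fun hp =>
    Measure.quasiMeasurePreserving_fst.ae hp
  have hfst' : ∀ {p : Z → Prop}, (∀ᵐ y ∂ν, p y) → ∀ᵐ z ∂(ν.prod ρ), p z.1 := fun hp =>
    Measure.quasiMeasurePreserving_fst.ae hp
  refine ⟨Prod.map f id, Prod.map f' id, hf.prodMap measurable_id, hf'.prodMap measurable_id,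
    ?_, ?_, fun g => ?_, ?_, ?_⟩
  · rw [← Measure.map_prod_map _ _ hf measurable_id, h1, Measure.map_id]
  · rw [← Measure.map_prod_map _ _ hf' measurable_id, h2, Measure.map_id]
  · filter_upwards [hfst (h3 g)] with y e1
    simp only [Prod.map, e1, id]
  · filter_upwards [hfst h4] with y e1
    simp only [Prod.map, e1, id]
  · filter_upwards [hfst' h5] with y e1
    simp only [Prod.map, e1, id]

variable {G Δ : Type} [Group G] [Countable G]

section Iid

variable [Fintype Δ] [Nonempty Δ] [MeasurableSpace Δ] [MeasurableSingletonClass Δ]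

theorem IsIIDG.cyl_eq {ν : Measure (G → Δ)} {p : Δ → ℝ≥0∞} (h : IsIIDG ν p) (W : Finset G)
    (α : G → Δ) : ν (cyl W α) = ∏ g ∈ W, p (α g) := by
  have := h W fun g => α g
  rw [Finset.prod_coe_sort W fun g => p (α g)] at this
  rw [← this]
  congr 1
  ext ω
  simp [cyl]

theorem isIIDG_of_cyl {ν : Measure (G → Δ)} {p : Δ → ℝ≥0∞}
    (h : ∀ (W : Finset G) (α : G → Δ), ν (cyl W α) = ∏ g ∈ W, p (α g)) : IsIIDG ν p := by
  intro F α
  let β : G → Δ := fun g => if h : g ∈ F then α ⟨g, h⟩ else Classical.arbitrary Δ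
  have hβ : ∀ g : {g // g ∈ F}, β g = α g := fun g => by simp [β]
  have := h F β
  rw [← Finset.prod_coe_sort F fun g => p (β g)] at this
  simp only [hβ] at this
  rw [← this]
  congr 1
  ext ω
  simp only [Set.mem_ofPred_eq, cyl]
  exact ⟨fun h g hg => by rw [h ⟨g, hg⟩, hβ ⟨g, hg⟩], fun h g => by rw [h g g.2, hβ]⟩

/-- The measure with given weights on a finite set. -/
def weightMeasure (p : Δ → ℝ≥0∞) : Measure Δ := Measure.sum fun i => p i • Measure.dirac i

theorem weightMeasure_singleton (p : Δ → ℝ≥0∞) (i : Δ) : weightMeasure p {i} = p i := by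
  rw [weightMeasure, Measure.sum_apply _ (measurableSet_singleton i), tsum_fintype,
    Finset.sum_eq_single i]
  · simp
  · intro j _ hj
    simp [hj]
  · simp

theorem weightMeasure_isProb {p : Δ → ℝ≥0∞} (hp : ∑ i, p i = 1) :
    IsProbabilityMeasure (weightMeasure p) := by
  constructor
  rw [weightMeasure, Measure.sum_apply _ .univ, tsum_fintype]
  simpa using hp

theorem IsIIDG.eq_infinitePi {ν : Measure (G → Δ)} {p : Δ → ℝ≥0∞} (h : IsIIDG ν p)
    [IsProbabilityMeasure (weightMeasure p)] :
    ν = Measure.infinitePi fun _ => weightMeasure p := by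
  symm
  refine ext_of_cyl fun W α => ?_
  rw [infinitePi_cyl, h.cyl_eq]
  exact Finset.prod_congr rfl fun g _ => weightMeasure_singleton p _

theorem exists_measure_inter_ne_zero_of_iid [Infinite G] (q : Measure Δ) [IsProbabilityMeasure q]
    {U V : Set (G → Δ)} (hU : MeasurableSet U) (hV : MeasurableSet V)
    (hU0 : Measure.infinitePi (fun _ : G => q) U ≠ 0)
    (hV0 : Measure.infinitePi (fun _ : G => q) V ≠ 0) :
    ∃ g : G, Measure.infinitePi (fun _ : G => q) (U ∩ gShift g ⁻¹' V) ≠ 0 := by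
  set μ := Measure.infinitePi fun _ : G => q with hμ
  have hshift : ∀ g : G, μ.map (gShift g) = μ := fun g =>
    Measure.map_infinitePi_infinitePi_of_inj (P := fun _ : G => q)
      (f := fun h : G => h * g) (mul_left_injective g)
  by_contra hno
  push Not at hno
  set a := μ.real U with ha
  set b := μ.real V with hb
  have ha0 : 0 < a := ENNReal.toReal_pos hU0 (measure_ne_top _ _)
  have hb0 : 0 < b := ENNReal.toReal_pos hV0 (measure_ne_top _ _)
  have ha1 : a ≤ 1 := measureReal_le_one
  have hb1 : b ≤ 1 := measureReal_le_one
  set ε := a * b / 8 with hε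
  have hε0 : 0 < ε := by positivity
  have hcov : ∃ D : Set (Set (G → Δ)), D.Countable ∧ D ⊆ measurableCylinders (fun _ : G => Δ) ∧
      μ (⋃₀ D)ᶜ = 0 := by
    refine ⟨{Set.univ}, Set.countable_singleton _, ?_, by simp⟩
    rintro _ rfl
    rw [mem_measurableCylinders]
    exact ⟨∅, Set.univ, .univ, by simp⟩
  obtain ⟨A, hA, hAU⟩ := exists_measure_symmDiff_lt_of_generateFrom_isSetRing (μ := μ)
    isSetRing_measurableCylinders hcov generateFrom_measurableCylinders.symm hU
    (ENNReal.ofReal_pos.mpr hε0)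
  obtain ⟨B, hB, hBV⟩ := exists_measure_symmDiff_lt_of_generateFrom_isSetRing (μ := μ)
    isSetRing_measurableCylinders hcov generateFrom_measurableCylinders.symm hV
    (ENNReal.ofReal_pos.mpr hε0)
  obtain ⟨F, s, hs, rfl⟩ := (mem_measurableCylinders _).mp hA
  obtain ⟨F', s', hs', rfl⟩ := (mem_measurableCylinders _).mp hB
  have hAm : MeasurableSet (cylinder F s) :=
    MeasurableSet.cylinder (α := fun _ : G => Δ) F hs
  have hBm : MeasurableSet (cylinder F' s') :=
    MeasurableSet.cylinder (α := fun _ : G => Δ) F' hs'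
  obtain ⟨g, hg⟩ := Infinite.exists_notMem_finset
    ((F' ×ˢ F).image fun p : G × G => p.1⁻¹ * p.2)
  have hdis : Disjoint F (F'.image fun k => k * g) := by
    rw [Finset.disjoint_left]
    intro x hx hx'
    obtain ⟨k, hk, rfl⟩ := Finset.mem_image.mp hx'
    exact hg (Finset.mem_image.mpr ⟨(k, k * g), Finset.mem_product.mpr ⟨hk, hx⟩, by simp⟩)
  have hind := (ProbabilityTheory.iIndepFun_infinitePi (P := fun _ : G => q)
    (X := fun _ a => a) fun _ => measurable_id).indepFun_finset F (F'.image fun k => k * g) hdis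
    fun i => measurable_pi_apply i
  let φ : ((F'.image fun k => k * g) → Δ) → F' → Δ :=
    fun c k => c ⟨k * g, Finset.mem_image_of_mem _ k.2⟩
  have hφ : Measurable φ := measurable_pi_lambda _ fun _ => measurable_pi_apply _
  have hprod : μ (cylinder F s ∩ gShift g ⁻¹' cylinder F' s')
      = μ (cylinder F s) * μ (cylinder F' s') := by
    have h1 := hind.measure_inter_preimage_eq_mul s (φ ⁻¹' s') hs (hφ hs')
    have h2 : μ (gShift g ⁻¹' cylinder F' s') = μ (cylinder F' s') := by
      conv_rhs => rw [← hshift g]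
      rw [Measure.map_apply (measurable_gShift g) hBm]
    rw [← h2]
    exact h1
  have hreal : μ.real (cylinder F s ∩ gShift g ⁻¹' cylinder F' s')
      = μ.real (cylinder F s) * μ.real (cylinder F' s') := by
    simp only [Measure.real, hprod, ENNReal.toReal_mul]
  have hAU' : μ.real (cylinder F s ∆ U) < ε :=
    (ENNReal.toReal_lt_of_lt_ofReal hAU)
  have hBV' : μ.real (cylinder F' s' ∆ V) < ε :=
    (ENNReal.toReal_lt_of_lt_ofReal hBV)
  have h1 : a ≤ μ.real (cylinder F s) + μ.real (cylinder F s ∆ U) := by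
    refine (measureReal_mono ?_).trans (measureReal_union_le _ _)
    intro x hx
    by_cases h : x ∈ cylinder F s
    · exact Or.inl h
    · exact Or.inr (Or.inr ⟨hx, h⟩)
  have h2 : b ≤ μ.real (cylinder F' s') + μ.real (cylinder F' s' ∆ V) := by
    refine (measureReal_mono ?_).trans (measureReal_union_le _ _)
    intro x hx
    by_cases h : x ∈ cylinder F' s'
    · exact Or.inl h
    · exact Or.inr (Or.inr ⟨hx, h⟩)
  have h3 : μ.real (gShift g ⁻¹' (cylinder F' s' ∆ V)) = μ.real (cylinder F' s' ∆ V) := by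
    conv_rhs => rw [← hshift g]
    rw [Measure.real, Measure.real, Measure.map_apply (measurable_gShift g) (hBm.symmDiff hV)]
  have h4 : μ.real (cylinder F s ∩ gShift g ⁻¹' cylinder F' s')
      ≤ μ.real (U ∩ gShift g ⁻¹' V) + μ.real (cylinder F s ∆ U)
        + μ.real (gShift g ⁻¹' (cylinder F' s' ∆ V)) := by
    refine (measureReal_mono (s₂ := (U ∩ gShift g ⁻¹' V) ∪ (cylinder F s ∆ U) ∪
      (gShift g ⁻¹' (cylinder F' s' ∆ V))) ?_).trans ((measureReal_union_le _ _).trans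
        (add_le_add_left (measureReal_union_le _ _) _))
    rintro x ⟨hx, hx'⟩
    by_cases h : x ∈ U
    · by_cases h' : gShift g x ∈ V
      · exact Or.inl (Or.inl ⟨h, h'⟩)
      · exact Or.inr (Or.inl ⟨hx', h'⟩)
    · exact Or.inl (Or.inr (Or.inl ⟨hx, h⟩))
  have h5 : μ.real (U ∩ gShift g ⁻¹' V) = 0 := by rw [Measure.real, hno g]; rfl
  rw [hreal, h3, h5] at h4
  nlinarith [mul_pos ha0 hb0, mul_nonneg (sub_nonneg.mpr ha1) hb0.le,
    mul_nonneg (sub_nonneg.mpr hb1) ha0.le, (measureReal_nonneg : 0 ≤ μ.real (cylinder F s)),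
    (measureReal_nonneg : 0 ≤ μ.real (cylinder F' s'))]

theorem nullSingletonClass_of_iid [Infinite G] (q : Measure Δ) [IsProbabilityMeasure q]
    (hq : ∀ a, q {a} ≠ 1) : NullSingletonClass (Measure.infinitePi fun _ : G => q) := by
  refine ⟨fun x => ?_⟩
  obtain ⟨a₀, -, ha₀⟩ := Finset.exists_max_image Finset.univ (fun a => q {a}) Finset.univ_nonempty
  have hlt : q {a₀} < 1 := lt_of_le_of_ne prob_le_one (hq a₀)
  have hle : ∀ n : ℕ, Measure.infinitePi (fun _ : G => q) {x} ≤ q {a₀} ^ n := by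
    intro n
    obtain ⟨W, hW⟩ := Infinite.exists_subset_card_eq G n
    calc Measure.infinitePi (fun _ : G => q) {x} ≤ Measure.infinitePi (fun _ : G => q) (cyl W x) :=
          measure_mono (Set.singleton_subset_iff.mpr fun g _ => rfl)
      _ = ∏ g ∈ W, q {x g} := infinitePi_cyl _ W x
      _ ≤ ∏ _g ∈ W, q {a₀} := Finset.prod_le_prod' fun g _ => ha₀ _ (Finset.mem_univ _)
      _ = q {a₀} ^ n := by rw [Finset.prod_const, hW]
  exact le_antisymm (ge_of_tendsto' (ENNReal.tendsto_pow_atTop_nhds_zero_of_lt_one hlt) hle)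
    bot_le

end Iid

/-- The product of two i.i.d. processes is an i.i.d. process. -/
theorem isBernoulliG_prod_iid {Δ₁ Δ₂ : Type} [Fintype Δ₁] [Nonempty Δ₁] [MeasurableSpace Δ₁]
    [MeasurableSingletonClass Δ₁] [Fintype Δ₂] [Nonempty Δ₂] [MeasurableSpace Δ₂]
    [MeasurableSingletonClass Δ₂] (p : Measure Δ₁) (q : Measure Δ₂)
    [IsProbabilityMeasure p] [IsProbabilityMeasure q] :
    IsBernoulliG ((Measure.infinitePi fun _ : G => p).prod (Measure.infinitePi fun _ : G => q))
      (fun g => Prod.map (gShift g) (gShift g)) := by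
  set N := Fintype.card (Δ₁ × Δ₂) with hN
  let E : Δ₁ × Δ₂ ≃ Fin N := Fintype.equivFin _
  set f : (G → Δ₁) × (G → Δ₂) → G → Fin N := fun z g => E (z.1 g, z.2 g)
  set f' : (G → Fin N) → (G → Δ₁) × (G → Δ₂) := fun z =>
    (fun g => (E.symm (z g)).1, fun g => (E.symm (z g)).2)
  have hf : Measurable f := measurable_pi_lambda _ fun g =>
    (measurable_of_countable fun c : Δ₁ × Δ₂ => E c).comp
      (((measurable_pi_apply g).comp measurable_fst).prodMk
        ((measurable_pi_apply g).comp measurable_snd))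
  have hf' : Measurable f' := by
    refine Measurable.prodMk (measurable_pi_lambda _ fun g => ?_) (measurable_pi_lambda _ fun g => ?_)
    · exact (measurable_of_countable fun c : Fin N => (E.symm c).1).comp (measurable_pi_apply g)
    · exact (measurable_of_countable fun c : Fin N => (E.symm c).2).comp (measurable_pi_apply g)
  have hff' : ∀ z, f (f' z) = z := fun z => by
    funext g; exact E.apply_symm_apply (z g)
  have hf'f : ∀ z, f' (f z) = z := fun z =>
    Prod.ext (funext fun g => congrArg Prod.fst (E.symm_apply_apply (z.1 g, z.2 g)))
      (funext fun g => congrArg Prod.snd (E.symm_apply_apply (z.1 g, z.2 g)))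
  set μ := (Measure.infinitePi fun _ : G => p).prod (Measure.infinitePi fun _ : G => q)
  have : NeZero N := ⟨Fintype.card_ne_zero⟩
  refine ⟨N, fun c => p {(E.symm c).1} * q {(E.symm c).2},
    μ.map f, ?_, isIIDG_of_cyl fun W α => ?_, f, f', hf, hf', rfl, ?_,
    fun g => Eventually.of_forall fun z => rfl, Eventually.of_forall hf'f,
    Eventually.of_forall hff'⟩
  · rw [← E.sum_comp]
    simp only [Equiv.symm_apply_apply]
    have h1 : ∑ a, p {a} = 1 := by
      rw [sum_measure_singleton]; simp
    have h2 : ∑ a, q {a} = 1 := by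
      rw [sum_measure_singleton]; simp
    rw [Fintype.sum_prod_type]
    simp only [← Finset.mul_sum, h2, mul_one, h1]
  · rw [Measure.map_apply hf (measurableSet_cyl W α)]
    have : f ⁻¹' cyl W α = cyl W (f' α).1 ×ˢ cyl W (f' α).2 := by
      ext z
      simp only [cyl, Set.mem_preimage, Set.mem_ofPred_eq, Set.mem_prod, f, f',
        ← forall_and]
      refine forall_congr' fun g => ?_
      refine imp_congr_right fun _ => ?_
      rw [← Equiv.eq_symm_apply, Prod.ext_iff]
    rw [this, Measure.prod_prod, infinitePi_cyl, infinitePi_cyl, Finset.prod_mul_distrib]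
  · rw [Measure.map_map hf' hf]
    have : f' ∘ f = id := funext hf'f
    rw [this, Measure.map_id]

/-- Atomlessness passes along isomorphisms. -/
theorem IsMeasIsoG.nullSingletonClass {Y Z : Type} [MeasurableSpace Y] [MeasurableSpace Z]
    [MeasurableSingletonClass Y] [MeasurableSingletonClass Z]
    {μ : Measure Y} {ν : Measure Z} {S : G → Y → Y} {T : G → Z → Z} (h : IsMeasIsoG μ ν S T)
    [NullSingletonClass ν] : NullSingletonClass μ := by
  obtain ⟨f, f', hf, hf', h1, h2, h3, h4, h5⟩ := h
  refine ⟨fun y => ?_⟩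
  rw [← h2, Measure.map_apply hf' (measurableSet_singleton y)]
  have : ν {f y} = 0 := measure_singleton _
  refine measure_mono_null_ae ?_ this
  filter_upwards [h5] with z hz hzy
  have hzy' : f' z = y := hzy
  rw [hzy'] at hz
  exact hz.symm

/-- The quantitative ergodicity property passes along isomorphisms. -/
theorem IsMeasIsoG.exists_measure_inter_ne_zero {Y Z : Type} [MeasurableSpace Y]
    [MeasurableSpace Z] {μ : Measure Y} {ν : Measure Z} {S : G → Y → Y} {T : G → Z → Z}
    (h : IsMeasIsoG μ ν S T) (hS : IsMPAction μ S) (hT : ∀ g, Measurable (T g))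
    (herg : ∀ U V, MeasurableSet U → MeasurableSet V → ν U ≠ 0 → ν V ≠ 0 →
      ∃ g, ν (U ∩ T g ⁻¹' V) ≠ 0)
    {U V : Set Y} (hU : MeasurableSet U) (hV : MeasurableSet V) (hU0 : μ U ≠ 0) (hV0 : μ V ≠ 0) :
    ∃ g, μ (U ∩ S g ⁻¹' V) ≠ 0 := by
  obtain ⟨f, f', hf, hf', h1, h2, h3, h4, h5⟩ := h
  have e1 : ∀ {s}, MeasurableSet s → ν (f' ⁻¹' s) = μ s := fun hs => by
    rw [← h2, Measure.map_apply hf' hs]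
  obtain ⟨g, hg⟩ := herg (f' ⁻¹' U) (f' ⁻¹' V) (hf' hU) (hf' hV) (by rwa [e1 hU]) (by rwa [e1 hV])
  refine ⟨g, ?_⟩
  rw [← h1, Measure.map_apply hf ((hf' hU).inter (hT g (hf' hV)))] at hg
  refine fun h0 => hg (measure_mono_null_ae ?_ h0)
  filter_upwards [h4, h3 g, hS.ae_of_ae h4 g] with y e2 e3 e4 hy
  obtain ⟨hy1, hy2⟩ := hy
  refine ⟨?_, ?_⟩
  · have : f' (f y) ∈ U := hy1
    rwa [e2] at this
  · have : f' (T g (f y)) ∈ V := hy2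
    rwa [← e3, e4] at this

end IidProcesses

noncomputable section BernoulliEnvironment

section SiteEntropy

variable {I 𝒜 : Type} [Fintype I] [MeasurableSpace I] [MeasurableSingletonClass I]
  [Fintype 𝒜] [Nonempty 𝒜] [MeasurableSpace 𝒜] [MeasurableSingletonClass 𝒜]
  (P : I → Measure 𝒜) [∀ i, IsProbabilityMeasure (P i)]

theorem eq_dirac_of_singleton_eq_one {q : Measure 𝒜} [IsProbabilityMeasure q] {c : 𝒜}
    (hc : q {c} = 1) : q = Measure.dirac c := by
  refine Measure.ext_of_singleton fun a => ?_
  rw [Measure.dirac_apply' _ (measurableSet_singleton a)]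
  by_cases hac : c = a
  · subst hac; simp [hc]
  · rw [Set.indicator_of_notMem (by simpa using hac)]
    exact measure_mono_null (by simpa using hac)
      ((prob_compl_eq_zero_iff (measurableSet_singleton c)).mpr hc)

theorem siteEntropy_wt_nonneg (i : I) : 0 ≤ siteEntropy (wt P) i :=
  Finset.sum_nonneg fun a _ => Real.negMulLog_nonneg (wt_nonneg P i a) measureReal_le_one

theorem exists_eq_dirac_of_siteEntropy_eq_zero {i : I} (h : siteEntropy (wt P) i = 0) :
    ∃ c, P i = Measure.dirac c := by
  have h0 := (Finset.sum_eq_zero_iff_of_nonneg fun a _ =>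
    Real.negMulLog_nonneg (wt_nonneg P i a) measureReal_le_one).mp h
  obtain ⟨c, hc⟩ : ∃ c, wt P i c ≠ 0 := by
    by_contra! hno
    have := sum_wt P i
    simp [hno] at this
  have hc1 : wt P i c = 1 := by
    have h1 : wt P i c * Real.log (wt P i c) = 0 := by
      have := h0 c (Finset.mem_univ _)
      rw [Real.negMulLog_eq_neg] at this
      linarith
    have h2 : 0 < wt P i c := lt_of_le_of_ne (wt_nonneg P i c) hc.symm
    rcases mul_eq_zero.mp h1 with h3 | h3
    · exact absurd h3 hc
    · exact Real.eq_one_of_pos_of_log_eq_zero h2 h3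
  have hc2 : P i {c} = 1 := by
    rw [wt, Measure.real] at hc1
    rw [← ENNReal.ofReal_toReal (measure_ne_top (P i) {c}), hc1, ENNReal.ofReal_one]
  exact ⟨c, eq_dirac_of_singleton_eq_one hc2⟩

/-- Interpolating between a point mass and a given law realises every smaller entropy. -/
theorem exists_siteEntropy_eq (i : I) {h : ℝ} (h0 : 0 ≤ h)
    (h1 : h ≤ siteEntropy (wt P) i) :
    ∃ q : Measure 𝒜, IsProbabilityMeasure q ∧ siteEntropy (wt fun _ : Unit => q) () = h := by
  let a₀ : 𝒜 := Classical.arbitrary 𝒜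
  let w : ℝ → 𝒜 → ℝ := fun t a => (1 - t) * (if a = a₀ then 1 else 0) + t * wt P i a
  let H : ℝ → ℝ := fun t => ∑ a, (w t a).negMulLog
  have hH : Continuous H := by
    refine continuous_finsetSum _ fun a _ => Real.continuous_negMulLog.comp ?_
    fun_prop
  have hH0 : H 0 = 0 := by
    refine Finset.sum_eq_zero fun a _ => ?_
    by_cases ha : a = a₀ <;> simp [w, ha]
  have hH1 : H 1 = siteEntropy (wt P) i := by simp [H, w, siteEntropy]
  obtain ⟨t, ⟨ht0, ht1⟩, ht⟩ := intermediate_value_Icc (zero_le_one' ℝ) hH.continuousOn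
    ⟨hH0.le.trans h0, h1.trans hH1.ge⟩
  have hw : ∀ a, 0 ≤ w t a := fun a =>
    add_nonneg (mul_nonneg (by linarith) (by split_ifs <;> norm_num))
      (mul_nonneg ht0 (wt_nonneg P i a))
  have hsum : ∑ a, w t a = 1 := by
    simp only [w, Finset.sum_add_distrib, ← Finset.mul_sum, sum_wt]
    simp
  refine ⟨weightMeasure fun a => ENNReal.ofReal (w t a), weightMeasure_isProb ?_, ?_⟩
  · rw [← ENNReal.ofReal_sum_of_nonneg fun a _ => hw a, hsum, ENNReal.ofReal_one]
  · rw [← ht]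
    refine Finset.sum_congr rfl fun a _ => ?_
    rw [wt, Measure.real, weightMeasure_singleton, ENNReal.toReal_ofReal (hw a)]

end SiteEntropy

variable {G X I 𝒜 : Type} [Group G] [Countable G] [MeasurableSpace X] [Fintype I]
  [MeasurableSpace I] [MeasurableSingletonClass I] [Fintype 𝒜] [Nonempty 𝒜] [MeasurableSpace 𝒜]
  [MeasurableSingletonClass 𝒜] {τ : G → X → X} {ν : Measure X} [IsProbabilityMeasure ν]
  (hτ : IsMPAction ν τ) {ty : X → I} (hty : Measurable ty)
  (P : I → Measure 𝒜) [∀ i, IsProbabilityMeasure (P i)]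

include hτ in
theorem envMeasure_eq_prod {q : Measure 𝒜} [IsProbabilityMeasure q]
    (h : ∀ᵐ x ∂ν, P (ty x) = q) :
    envMeasure hτ.2.2.1 hty P ν = ν.prod (Measure.infinitePi fun _ : G => q) := by
  rw [envMeasure, ← Measure.compProd_const]
  refine Measure.compProd_congr ?_
  filter_upwards [ae_all_iff.mpr fun g => hτ.ae_of_ae h g] with x hx
  rw [envKernel_apply, ProbabilityTheory.Kernel.const_apply]
  simp only [hx]

/-- Deterministic labels add nothing to the environment. -/
theorem isMeasIsoG_envMeasure_of_dirac (c : I → 𝒜)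
    (h : ∀ᵐ x ∂ν, P (ty x) = Measure.dirac (c (ty x))) :
    IsMeasIsoG (envMeasure hτ.2.2.1 hty P ν) ν (prodAct 𝒜 τ) τ := by
  have hc : Measurable fun x => fun g => c (ty (τ g x)) := measurable_pi_lambda _ fun g =>
    ((measurable_of_countable c).comp hty).comp (hτ.2.2.1 g)
  have hM : envMeasure hτ.2.2.1 hty P ν = ν.map fun x => (x, fun g => c (ty (τ g x))) := by
    rw [envMeasure, ← Measure.compProd_deterministic hc]
    refine Measure.compProd_congr ?_
    filter_upwards [ae_all_iff.mpr fun g => hτ.ae_of_ae h g] with x hx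
    rw [envKernel_apply, ProbabilityTheory.Kernel.deterministic_apply]
    simp only [hx]
    exact Measure.infinitePi_dirac _
  have hf' : Measurable fun x => (x, fun g => c (ty (τ g x))) := measurable_id.prodMk hc
  refine ⟨Prod.fst, fun x => (x, fun g => c (ty (τ g x))), measurable_fst, hf', ?_, hM.symm,
    fun g => Eventually.of_forall fun z => rfl, ?_, Eventually.of_forall fun z => rfl⟩
  · exact Measure.fst_compProd ν _
  · have : ∀ᵐ z ∂(envMeasure hτ.2.2.1 hty P ν), ∀ g, c (ty (τ g z.1)) = z.2 g := by
      refine ae_all_iff.mpr fun g => ?_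
      rw [hM, ae_map_iff hf'.aemeasurable]
      · exact Eventually.of_forall fun x => rfl
      · exact measurableSet_eq_fun
          (((measurable_of_countable c).comp hty).comp ((hτ.2.2.1 g).comp measurable_fst))
          ((measurable_pi_apply g).comp measurable_snd)
    filter_upwards [this] with z hz
    exact Prod.ext rfl (funext hz)

/-- A Bernoulli environment carrying conditionally independent labels, whose laws depend on the
types of the sites only, is Bernoulli. -/
theorem isBernoulliG_envMeasure [Infinite G] [StandardBorelSpace X] (hB : IsBernoulliG ν τ) :
    IsBernoulliG (envMeasure hτ.2.2.1 hty P ν) (prodAct 𝒜 τ) := by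
  obtain ⟨n, p, ν', hp, hiid, hiso⟩ := hB
  have : NeZero n := ⟨by rintro rfl; simp at hp⟩
  have := weightMeasure_isProb hp
  have hν' := hiid.eq_infinitePi
  set p' := weightMeasure p
  have key : ∀ q : Measure 𝒜, IsProbabilityMeasure q →
      IsMeasIsoG (envMeasure hτ.2.2.1 hty P ν) (ν.prod (Measure.infinitePi fun _ : G => q))
        (prodAct 𝒜 τ) (fun g => Prod.map (τ g) (gShift g)) →
      IsBernoulliG (envMeasure hτ.2.2.1 hty P ν) (prodAct 𝒜 τ) := by
    intro q hq hi
    obtain ⟨N, r, ρ, hr, hρ, hj⟩ := isBernoulliG_prod_iid (G := G) p' q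
    have h1 : IsMeasIsoG (ν.prod (Measure.infinitePi fun _ : G => q)) _
        (fun g => Prod.map (τ g) (gShift g)) (fun g => Prod.map (gShift g) (gShift g)) :=
      IsMeasIsoG.prod_right (ρ := Measure.infinitePi fun _ : G => q) (hν' ▸ hiso)
    exact ⟨N, r, ρ, hr, hρ, (hi.trans h1).trans hj⟩
  have refl : ∀ (q : Measure 𝒜) [IsProbabilityMeasure q], (∀ᵐ x ∂ν, P (ty x) = q) →
      IsMeasIsoG (envMeasure hτ.2.2.1 hty P ν) (ν.prod (Measure.infinitePi fun _ : G => q))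
        (prodAct 𝒜 τ) (fun g => Prod.map (τ g) (gShift g)) := by
    intro q _ hq
    have := envMeasure_eq_prod hτ hty P hq
    exact ⟨id, id, measurable_id, measurable_id, by rw [Measure.map_id, this],
      by rw [Measure.map_id, this], fun g => Eventually.of_forall fun z => rfl,
      Eventually.of_forall fun z => rfl, Eventually.of_forall fun z => rfl⟩
  by_cases htriv : ∃ a, p' {a} = 1
  · obtain ⟨a, ha⟩ := htriv
    have hdir : ν' = Measure.dirac fun _ => a := by
      rw [hν', ← Measure.infinitePi_dirac]
      rw [eq_dirac_of_singleton_eq_one ha]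
    obtain ⟨f, f', hf, hf', -, h2, -⟩ := hiso
    rw [hdir, Measure.map_dirac' hf'] at h2
    refine key (P (ty (f' fun _ => a))) inferInstance (refl _ ?_)
    rw [← h2, ae_dirac_eq]
    exact rfl
  push Not at htriv
  set e : X → ℝ := fun x => siteEntropy (wt P) (ty x) with he
  have hem : Measurable e := (measurable_of_countable (siteEntropy (wt P))).comp hty
  have he0 : ∀ x, 0 ≤ e x := fun x => siteEntropy_wt_nonneg P _
  have hXne : Nonempty X := nonempty_of_isProbabilityMeasure ν
  have hIne : Nonempty I := hXne.map ty
  obtain ⟨i₀, -, hi₀⟩ := Finset.exists_max_image Finset.univ (fun i => siteEntropy (wt P) i)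
    Finset.univ_nonempty
  set R := siteEntropy (wt P) i₀ with hR
  have heR : ∀ x, e x ≤ R := fun x => hi₀ _ (Finset.mem_univ _)
  have hei : Integrable e ν := Integrable.of_mem_Icc 0 R hem.aemeasurable
    (Eventually.of_forall fun x => ⟨he0 x, heR x⟩)
  set h := ∫ x, e x ∂ν with hh
  have hh0 : 0 ≤ h := integral_nonneg he0
  rcases hh0.eq_or_lt with hz | hpos
  · have hae : ∀ᵐ x ∂ν, e x = 0 :=
      (integral_eq_zero_iff_of_nonneg he0 hei).mp (hh.symm.trans hz.symm)
    have hc : ∀ i, ∃ c, siteEntropy (wt P) i = 0 → P i = Measure.dirac c := fun i => by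
      by_cases hi : siteEntropy (wt P) i = 0
      · obtain ⟨c, hc⟩ := exists_eq_dirac_of_siteEntropy_eq_zero P hi
        exact ⟨c, fun _ => hc⟩
      · exact ⟨Classical.arbitrary 𝒜, fun h => absurd h hi⟩
    choose c hc using hc
    exact ⟨n, p, ν', hp, hiid, (isMeasIsoG_envMeasure_of_dirac hτ hty P c
      (hae.mono fun x hx => hc _ hx)).trans hiso⟩
  have hhR : h ≤ R := by
    have := integral_mono hei (integrable_const R) heR
    simpa using this
  obtain ⟨q, hq, hqh⟩ := exists_siteEntropy_eq P i₀ hh0 hhR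
  refine key q hq ?_
  have hnull' : NullSingletonClass ν' := hν' ▸ nullSingletonClass_of_iid p' htriv
  have hnull : NullSingletonClass ν := hiso.nullSingletonClass
  have herg : ∀ U V, MeasurableSet U → MeasurableSet V → ν U ≠ 0 → ν V ≠ 0 →
      ∃ g, ν (U ∩ τ g ⁻¹' V) ≠ 0 := fun U V hU hV hU0 hV0 =>
    hiso.exists_measure_inter_ne_zero hτ measurable_gShift
      (fun U V hU hV hU0 hV0 => by
        rw [hν'] at hU0 hV0 ⊢
        exact exists_measure_inter_ne_zero_of_iid p' hU hV hU0 hV0) hU hV hU0 hV0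
  obtain ⟨T, hgood, hT⟩ := Tower.exists_of_ergodic hτ herg hem he0 heR
  rw [← envMeasure_eq_prod hτ hty (fun _ => q) (Eventually.of_forall fun x => rfl)]
  refine T.isMeasIsoG_envMeasure hτ hty P (fun _ => q) hgood hpos ?_ ?_ (R := R)
  · rintro k t ⟨x, hx, rfl⟩
    exact hT k x hx
  · intro k t _
    have h1 : ∀ v, siteEntropy (wt fun _ : I => q) (t v) = h := fun v => hqh
    simp only [h1, Finset.sum_const, Finset.card_univ, nsmul_eq_mul]
    have h2 : Fintype.card (Pos k) = 2 ^ k := by simp [Pos]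
    rw [h2]
    push_cast
    rw [sub_self, abs_zero]
    exact siteEntropy_wt_nonneg P i₀

end BernoulliEnvironment

section

/-- A measurable equivariant map with an almost sure measurable left inverse is an isomorphism onto
its image measure. -/
theorem isMeasIsoG_map {G Y Z : Type} [Group G] [MeasurableSpace Y] [MeasurableSpace Z]
    [StandardBorelSpace Z] {μ : Measure Y} {S : G → Y → Y} {T : G → Z → Z} {f : Y → Z} {f' : Z → Y}
    (hf : Measurable f) (hf' : Measurable f') (hS : ∀ g y, f (S g y) = T g (f y))
    (h : ∀ᵐ y ∂μ, f' (f y) = y) : IsMeasIsoG μ (μ.map f) S T := by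
  refine ⟨f, f', hf, hf', rfl, ?_, fun g => Eventually.of_forall (hS g), h, ?_⟩
  · rw [Measure.map_map hf' hf, Measure.map_congr (show f' ∘ f =ᵐ[μ] id from h), Measure.map_id]
  · have := upgradeStandardBorel Z
    refine (ae_map_iff hf.aemeasurable
      (measurableSet_eq_fun (hf.comp hf') measurable_id)).mpr ?_
    filter_upwards [h] with y hy
    simp only [Function.comp_apply, hy, id]

noncomputable section TileLabels

variable {G Λ : Type} [Group G] [Countable G] [Fintype Λ] [Nonempty Λ] [MeasurableSpace Λ]
  [MeasurableSingletonClass Λ] {m : ℕ} (S : Fin m → Finset G) (U : Finset G)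

/-- The restriction of a block to the shape of type `i`, padded by a constant. -/
def padBlock (i : Fin (m + 1)) (b : G → Λ) (u : {g // g ∈ U}) : Λ :=
  if ∃ j : Fin m, i = j.succ ∧ (u : G) ∈ S j then b u else Classical.arbitrary Λ

/-- Each site is labelled by the block on the tile centered there. -/
def tileLabel (x : G → Fin (m + 1)) (ω : G → Λ) (g : G) : {g // g ∈ U} → Λ :=
  padBlock S U (x g) fun s => ω (s * g)

/-- A label which is constant outside the shape of type `i`. -/
def IsPadded (i : Fin (m + 1)) (a : {g // g ∈ U} → Λ) : Prop :=
  ∀ u : {g // g ∈ U}, (¬ ∃ j : Fin m, i = j.succ ∧ (u : G) ∈ S j) → a u = Classical.arbitrary Λ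

theorem padBlock_eq_iff (i : Fin (m + 1)) (b : G → Λ) (a : {g // g ∈ U} → Λ) :
    padBlock S U i b = a ↔
      IsPadded S U i a ∧ ∀ j : Fin m, i = j.succ → ∀ u : {g // g ∈ U}, (u : G) ∈ S j → b u = a u := by
  constructor
  · rintro rfl
    exact ⟨fun u hu => if_neg hu, fun j hj u hu => (if_pos ⟨j, hj, hu⟩).symm⟩
  · rintro ⟨h1, h2⟩
    funext u
    by_cases hu : ∃ j : Fin m, i = j.succ ∧ (u : G) ∈ S j
    · obtain ⟨j, hj, hu'⟩ := hu
      rw [padBlock, if_pos ⟨j, hj, hu'⟩, h2 j hj u hu']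
    · rw [padBlock, if_neg hu, h1 u hu]

theorem measurable_tileLabel :
    Measurable fun z : (G → Fin (m + 1)) × (G → Λ) => tileLabel S U z.1 z.2 := by
  refine measurable_pi_lambda _ fun g => measurable_pi_lambda _ fun u => ?_
  refine Measurable.ite ?_ ((measurable_pi_apply _).comp measurable_snd) measurable_const
  have hs : MeasurableSet {i : Fin (m + 1) | ∃ j : Fin m, i = j.succ ∧ (u : G) ∈ S j} :=
    .of_discrete
  have hm : Measurable fun z : (G → Fin (m + 1)) × (G → Λ) => z.1 g :=
    (measurable_pi_apply g).comp measurable_fst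
  exact hm hs

theorem tileLabel_shift (x : G → Fin (m + 1)) (ω : G → Λ) (h : G) :
    tileLabel S U (gShift h x) (gShift h ω) = gShift h (tileLabel S U x ω) := by
  funext g u
  simp only [tileLabel, padBlock, gShift, mul_assoc]

/-- The entry of a family of candidates selected by the shapes. -/
def selectEntry (c : {g // g ∈ U} → Fin (m + 1) × Λ) : Λ :=
  if hu : ∃ u : {g // g ∈ U}, ∃ j : Fin m, (c u).1 = j.succ ∧ (u : G) ∈ S j then (c hu.choose).2
  else Classical.arbitrary Λ

/-- The configuration read off from the labels. -/
def unlabel (x : G → Fin (m + 1)) (a : G → {g // g ∈ U} → Λ) (h : G) : Λ :=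
  selectEntry S U fun u => (x ((u : G)⁻¹ * h), a ((u : G)⁻¹ * h) u)

theorem measurable_unlabel :
    Measurable fun z : (G → Fin (m + 1)) × (G → {g // g ∈ U} → Λ) => unlabel S U z.1 z.2 := by
  refine measurable_pi_lambda _ fun h => ?_
  refine (measurable_of_countable (selectEntry (Λ := Λ) S U)).comp (measurable_pi_lambda _ fun u => ?_)
  exact ((measurable_pi_apply _).comp measurable_fst).prodMk
    ((measurable_pi_apply u).comp ((measurable_pi_apply _).comp measurable_snd))

theorem unlabel_tileLabel {x : G → Fin (m + 1)}
    (hx : ∀ h, ∃ u : {g // g ∈ U}, ∃ j : Fin m, x ((u : G)⁻¹ * h) = j.succ ∧ (u : G) ∈ S j)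
    (ω : G → Λ) : unlabel S U x (tileLabel S U x ω) = ω := by
  funext h
  rw [unlabel, selectEntry, dif_pos (hx h), tileLabel, padBlock, if_pos (hx h).choose_spec,
    mul_inv_cancel_left]

/-- The tiles of `x` carry independent blocks under `κ`, and the law of the block on a tile of
shape `S i` is `D i`. -/
def HasIndependentTiles (D : (i : Fin m) → ({ s // s ∈ S i } → Λ) → ℝ≥0∞)
    (κ : Measure (G → Λ)) (x : G → Fin (m + 1)) : Prop :=
  (∀ (g : G) (i : Fin m) (α : { s // s ∈ S i } → Λ), x g = i.succ →
    κ {ω : G → Λ | ∀ s : { s // s ∈ S i }, ω ((s : G) * g) = α s} = D i α) ∧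
  ∀ (J : Finset G) (β : G → G → Λ), (∀ g ∈ J, ∃ i : Fin m, x g = i.succ) →
    κ (⋂ g ∈ J, tileEvent S x β g) = ∏ g ∈ J, κ (tileEvent S x β g)

variable {S U} {D : (i : Fin m) → ({ s // s ∈ S i } → Λ) → ℝ≥0∞}

theorem measurable_tileLabel_apply (x : G → Fin (m + 1)) (g : G) :
    Measurable fun ω : G → Λ => tileLabel S U x ω g :=
  (measurable_pi_apply g).comp ((measurable_tileLabel S U).comp measurable_prodMk_left)

theorem HasIndependentTiles.map_tileLabel (hU : ∀ i, S i ⊆ U) {κ κ' : Measure (G → Λ)}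
    [IsProbabilityMeasure κ] [IsProbabilityMeasure κ'] {x x' : G → Fin (m + 1)}
    (hx : HasIndependentTiles S D κ x) (hx' : HasIndependentTiles S D κ' x') {g g' : G}
    (hg : x g = x' g') :
    κ.map (fun ω => tileLabel S U x ω g) = κ'.map (fun ω => tileLabel S U x' ω g') := by
  refine Measure.ext_of_singleton fun a => ?_
  rw [Measure.map_apply (measurable_tileLabel_apply x g) (measurableSet_singleton a),
    Measure.map_apply (measurable_tileLabel_apply x' g') (measurableSet_singleton a)]
  let val : Fin (m + 1) → ℝ≥0∞ := fun k =>
    if IsPadded S U k a then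
      if hi : ∃ i : Fin m, k = i.succ then D hi.choose fun s => a ⟨s, hU _ s.2⟩ else 1
    else 0
  have key : ∀ {κ : Measure (G → Λ)} [IsProbabilityMeasure κ] {x : G → Fin (m + 1)} {g : G},
      HasIndependentTiles S D κ x → κ ((fun ω => tileLabel S U x ω g) ⁻¹' {a})
        = val (x g) := by
    intro κ _ x g hx
    have hset : (fun ω => tileLabel S U x ω g) ⁻¹' {a} = {ω | IsPadded S U (x g) a ∧
        ∀ j : Fin m, x g = j.succ → ∀ u : {g // g ∈ U}, (u : G) ∈ S j → ω (u * g) = a u} := by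
      ext ω
      exact padBlock_eq_iff S U _ _ a
    rw [hset]
    simp only [val]
    split_ifs with hp hi
    · rw [← hx.1 g _ _ hi.choose_spec]
      congr 1
      ext ω
      refine ⟨fun h s => h.2 _ hi.choose_spec ⟨s, hU _ s.2⟩ s.2, fun h => ⟨hp, fun j hj u hu => ?_⟩⟩
      obtain rfl : j = hi.choose := Fin.succ_injective _ (hj.symm.trans hi.choose_spec)
      exact h ⟨u, hu⟩
    · rw [show {ω : G → Λ | IsPadded S U (x g) a ∧ ∀ j : Fin m, x g = j.succ →
          ∀ u : {g // g ∈ U}, (u : G) ∈ S j → ω (u * g) = a u} = Set.univ from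
        Set.eq_univ_of_forall fun ω => ⟨hp, fun j hj => absurd ⟨j, hj⟩ hi⟩]
      exact measure_univ
    · rw [show {ω : G → Λ | IsPadded S U (x g) a ∧ ∀ j : Fin m, x g = j.succ →
          ∀ u : {g // g ∈ U}, (u : G) ∈ S j → ω (u * g) = a u} = ∅ from
        Set.eq_empty_of_forall_notMem fun ω h => hp h.1]
      exact measure_empty
  rw [key hx, key hx', hg]

theorem HasIndependentTiles.measure_tileLabel_cyl (hU : ∀ i, S i ⊆ U) {κ : Measure (G → Λ)}
    [IsProbabilityMeasure κ] {x : G → Fin (m + 1)} (hx : HasIndependentTiles S D κ x)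
    (W : Finset G) (α : G → {g // g ∈ U} → Λ) :
    κ {ω | tileLabel S U x ω ∈ cyl W α}
      = ∏ g ∈ W, κ.map (fun ω => tileLabel S U x ω g) {α g} := by
  have hmap : ∀ g, κ.map (fun ω => tileLabel S U x ω g) {α g} = κ {ω | tileLabel S U x ω g = α g} :=
    fun g => Measure.map_apply (measurable_tileLabel_apply x g) (measurableSet_singleton _)
  simp only [hmap]
  have hiff : ∀ (ω : G → Λ) g, tileLabel S U x ω g = α g ↔ IsPadded S U (x g) (α g) ∧
      ∀ j : Fin m, x g = j.succ → ∀ u : {g // g ∈ U}, (u : G) ∈ S j → ω (u * g) = α g u :=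
    fun ω g => padBlock_eq_iff S U _ _ _
  by_cases hp : ∀ g ∈ W, IsPadded S U (x g) (α g)
  · let β : G → G → Λ := fun g k =>
      if h : k * g⁻¹ ∈ U then α g ⟨k * g⁻¹, h⟩ else Classical.arbitrary Λ
    have hev : ∀ g ∈ W, {ω | tileLabel S U x ω g = α g} = tileEvent S x β g := by
      intro g hg
      ext ω
      simp only [Set.mem_ofPred_eq, hiff, tileEvent, hp g hg, true_and]
      have hβ : ∀ s (hs : s ∈ U), β g (s * g) = α g ⟨s, hs⟩ := fun s hs => by
        simp [β, hs]
      refine forall_congr' fun j => imp_congr_right fun hj => ⟨fun h s hs => ?_, fun h u hu => ?_⟩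
      · rw [hβ s (hU j hs)]
        exact h ⟨s, hU j hs⟩ hs
      · rw [h u hu, hβ u u.2]
    set J := W.filter fun g => ∃ i : Fin m, x g = i.succ with hJ
    have huniv : ∀ g ∈ W, g ∉ J → tileEvent (Λ := Λ) S x β g = Set.univ := fun g hg hgJ =>
      Set.eq_univ_of_forall fun ω i hi => absurd (Finset.mem_filter.mpr ⟨hg, i, hi⟩) hgJ
    have h1 : {ω | tileLabel S U x ω ∈ cyl W α} = ⋂ g ∈ J, tileEvent S x β g := by
      ext ω
      simp only [cyl, Set.mem_ofPred_eq, Set.mem_iInter]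
      refine ⟨fun h g hg => ?_, fun h g hg => ?_⟩
      · have hgW := (Finset.mem_filter.mp hg).1
        rw [← hev g hgW]
        exact h g hgW
      · have : ω ∈ tileEvent S x β g := by
          by_cases hgJ : g ∈ J
          · exact h g hgJ
          · rw [huniv g hg hgJ]; trivial
        rw [← hev g hg] at this
        exact this
    rw [h1, hx.2 J β fun g hg => (Finset.mem_filter.mp hg).2,
      Finset.prod_congr (rfl : W = W) fun g hg => congrArg κ (hev g hg)]
    refine Finset.prod_subset (Finset.filter_subset _ _) fun g hg hgJ => ?_
    rw [huniv g hg hgJ, measure_univ]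
  · push Not at hp
    obtain ⟨g, hg, hpg⟩ := hp
    have h1 : {ω | tileLabel S U x ω g = α g} = ∅ :=
      Set.eq_empty_of_forall_notMem fun ω h => hpg ((hiff ω g).mp h).1
    rw [Finset.prod_eq_zero hg (by rw [h1, measure_empty])]
    refine measure_mono_null (fun ω h => ?_) (measure_empty (μ := κ))
    rw [← h1]
    exact h g hg

end TileLabels

noncomputable section LabelProcess

variable {G Λ : Type} [Group G] [Countable G] [Fintype Λ] [Nonempty Λ] [MeasurableSpace Λ]
  [MeasurableSingletonClass Λ] {m : ℕ} {S : Fin m → Finset G} {U : Finset G}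
  {D : (i : Fin m) → ({ s // s ∈ S i } → Λ) → ℝ≥0∞}

theorem isMPAction_gShift {Δ : Type} [MeasurableSpace Δ] {ν : Measure (G → Δ)}
    (h : ShiftInvariant ν) : IsMPAction ν gShift :=
  ⟨fun x => funext fun k => by simp [gShift],
    fun g h x => funext fun k => by simp [gShift, mul_assoc], measurable_gShift, h⟩

/-- The law of the labels on a tile, common to all configurations with independent tiles. -/
theorem exists_tileLabel_law (hU : ∀ i, S i ⊆ U)
    (κ : (G → Fin (m + 1)) → Measure (G → Λ)) [∀ x, IsProbabilityMeasure (κ x)] :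
    ∃ P : Fin (m + 1) → Measure ({g // g ∈ U} → Λ), (∀ i, IsProbabilityMeasure (P i)) ∧
      ∀ x, HasIndependentTiles S D (κ x) x → ∀ g,
        (κ x).map (fun ω => tileLabel S U x ω g) = P (x g) := by
  have hP : ∀ i : Fin (m + 1), ∃ P : Measure ({g // g ∈ U} → Λ), IsProbabilityMeasure P ∧
      ∀ x, HasIndependentTiles S D (κ x) x → ∀ g, x g = i →
        (κ x).map (fun ω => tileLabel S U x ω g) = P := by
    intro i
    by_cases hi : ∃ x, HasIndependentTiles S D (κ x) x ∧ ∃ g, x g = i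
    · obtain ⟨x, hx, g, hg⟩ := hi
      exact ⟨_, Measure.isProbabilityMeasure_map (measurable_tileLabel_apply x g).aemeasurable,
        fun x' hx' g' hg' => hx'.map_tileLabel hU hx (hg'.trans hg.symm)⟩
    · exact ⟨Measure.dirac (Classical.arbitrary _), inferInstance,
        fun x hx g hg => absurd ⟨x, hx, g, hg⟩ hi⟩
  choose P hP1 hP2 using hP
  exact ⟨P, hP1, fun x hx g => hP2 _ x hx g rfl⟩

theorem map_tileLabel_eq_envMeasure (hU : ∀ i, S i ⊆ U) {ν : Measure (G → Fin (m + 1))}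
    [IsProbabilityMeasure ν] (hτ : IsMPAction ν gShift)
    (κ : ProbabilityTheory.Kernel (G → Fin (m + 1)) (G → Λ)) [ProbabilityTheory.IsMarkovKernel κ]
    (hκ : ∀ᵐ x ∂ν, HasIndependentTiles S D (κ x) x)
    (P : Fin (m + 1) → Measure ({g // g ∈ U} → Λ)) [∀ i, IsProbabilityMeasure (P i)]
    (hP : ∀ x, HasIndependentTiles S D (κ x) x → ∀ g,
      (κ x).map (fun ω => tileLabel S U x ω g) = P (x g)) :
    (ν.compProd κ).map (fun z => (z.1, tileLabel S U z.1 z.2))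
      = envMeasure hτ.2.2.1 (measurable_pi_apply (1 : G)) P ν := by
  have hF : Measurable fun z : (G → Fin (m + 1)) × (G → Λ) => (z.1, tileLabel S U z.1 z.2) :=
    measurable_fst.prodMk (measurable_tileLabel S U)
  have : IsProbabilityMeasure ((ν.compProd κ).map fun z => (z.1, tileLabel S U z.1 z.2)) :=
    Measure.isProbabilityMeasure_map hF.aemeasurable
  refine ext_of_prod_cyl fun s W α hs => ?_
  have hsW : MeasurableSet (s ×ˢ cyl W α) := hs.prod (measurableSet_cyl W α)
  rw [Measure.map_apply hF hsW, envMeasure, Measure.compProd_apply (hF hsW),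
    Measure.compProd_apply hsW]
  refine lintegral_congr_ae ?_
  filter_upwards [hκ] with x hx
  by_cases hxs : x ∈ s
  · have h1 : Prod.mk x ⁻¹' ((fun z : (G → Fin (m + 1)) × (G → Λ) =>
        (z.1, tileLabel S U z.1 z.2)) ⁻¹' (s ×ˢ cyl W α)) = {ω | tileLabel S U x ω ∈ cyl W α} := by
      ext ω; simp [hxs]
    have h2 : Prod.mk x ⁻¹' (s ×ˢ cyl W α) = cyl W α := by
      ext ω; simp [hxs]
    rw [h1, h2, hx.measure_tileLabel_cyl hU, envKernel_apply, infinitePi_cyl]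
    refine Finset.prod_congr rfl fun g _ => ?_
    rw [hP x hx g]
    simp only [gShift, one_mul]
  · have h1 : Prod.mk x ⁻¹' ((fun z : (G → Fin (m + 1)) × (G → Λ) =>
        (z.1, tileLabel S U z.1 z.2)) ⁻¹' (s ×ˢ cyl W α)) = ∅ := by
      ext ω; simp [hxs]
    have h2 : Prod.mk x ⁻¹' (s ×ˢ cyl W α) = ∅ := by
      ext ω; simp [hxs]
    rw [h1, h2, measure_empty, measure_empty]

end LabelProcess

/-- **The lift with conditionally independent tiles is Bernoulli when the tiling system is
Bernoulli** (Lemma 3.3 of the paper). -/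
theorem independent_tiles_lift_is_bernoulli
    {G Λ : Type} [Group G] [Countable G] [Infinite G] [DecidableEq G]
    [Fintype Λ] [Nonempty Λ] [MeasurableSpace Λ]
    [TopologicalSpace Λ] [DiscreteTopology Λ] [BorelSpace Λ]
    {m : ℕ} (S : Fin m → Finset G) (hSone : ∀ i, (1 : G) ∈ S i)
    (ν : Measure (G → Fin (m + 1))) [IsProbabilityMeasure ν] (hνinv : ShiftInvariant ν)
    (htile : ∀ᵐ ωb ∂ν, ∀ h : G, ∃! p : Fin m × G,
      ωb p.2 = p.1.succ ∧ h ∈ (S p.1).image (fun s => s * p.2))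
    (η ηbar : Measure ((G → Fin (m + 1)) × (G → Λ)))
    [IsProbabilityMeasure η] [IsProbabilityMeasure ηbar]
    (hηinv : ∀ g : G, Measure.map (Prod.map (gShift g) (gShift g)) η = η)
    (hηbarinv : ∀ g : G, Measure.map (Prod.map (gShift g) (gShift g)) ηbar = ηbar)
    (hηfst : η.fst = ν) (hηbarfst : ηbar.fst = ν)
    (D : (i : Fin m) → ({ s // s ∈ S i } → Λ) → ℝ≥0∞)
    (hD : ∀ (i : Fin m) (α : { s // s ∈ S i } → Λ),
      D i α = η {q : (G → Fin (m + 1)) × (G → Λ) |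
          q.1 (1 : G) = i.succ ∧ ∀ s : { s // s ∈ S i }, q.2 (s : G) = α s} /
        η {q : (G → Fin (m + 1)) × (G → Λ) | q.1 (1 : G) = i.succ})
    (hcond : ∀ᵐ ωb ∂ν, ∀ (g : G) (i : Fin m) (α : { s // s ∈ S i } → Λ), ωb g = i.succ →
      ηbar.condKernel ωb {ω : G → Λ | ∀ s : { s // s ∈ S i }, ω ((s : G) * g) = α s} = D i α)
    (hindep : ∀ᵐ ωb ∂ν, ∀ (J : Finset G) (β : G → G → Λ),
      (∀ g ∈ J, ∃ i : Fin m, ωb g = i.succ) →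
      ηbar.condKernel ωb (⋂ g ∈ J, tileEvent S ωb β g) =
        ∏ g ∈ J, ηbar.condKernel ωb (tileEvent S ωb β g))
    (hBern : IsBernoulliG ν gShift) :
    IsBernoulliG ηbar (fun g => Prod.map (gShift g) (gShift g)) := by
  obtain ⟨U, hU⟩ : ∃ U : Finset G, ∀ i, S i ⊆ U :=
    ⟨Finset.univ.biUnion S, fun i => Finset.subset_biUnion_of_mem S (Finset.mem_univ i)⟩
  have hτ : IsMPAction ν gShift := isMPAction_gShift hνinv
  obtain ⟨P, hP1, hP2⟩ := exists_tileLabel_law (D := D) hU fun x => ηbar.condKernel x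
  have hind : ∀ᵐ x ∂ν, HasIndependentTiles S D (ηbar.condKernel x) x := by
    filter_upwards [hcond, hindep] with x h1 h2
    exact ⟨h1, h2⟩
  have hlaw := map_tileLabel_eq_envMeasure hU hτ ηbar.condKernel hind P hP2
  have hdis : ν.compProd ηbar.condKernel = ηbar := by
    rw [← hηbarfst]
    exact ηbar.disintegrate ηbar.condKernel
  rw [hdis] at hlaw
  have hcover : ∀ᵐ x ∂ν, ∀ h, ∃ u : {g // g ∈ U}, ∃ j : Fin m,
      x ((u : G)⁻¹ * h) = j.succ ∧ (u : G) ∈ S j := by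
    filter_upwards [htile] with x hx h
    obtain ⟨⟨i, c⟩, ⟨h1, h2⟩, -⟩ := hx h
    obtain ⟨s, hs, rfl⟩ := Finset.mem_image.mp h2
    exact ⟨⟨s, hU i hs⟩, i, by simpa using h1, hs⟩
  have hcover' : ∀ᵐ z ∂ηbar, ∀ h, ∃ u : {g // g ∈ U}, ∃ j : Fin m,
      z.1 ((u : G)⁻¹ * h) = j.succ ∧ (u : G) ∈ S j := by
    rw [← hηbarfst] at hcover
    exact ae_of_ae_map measurable_fst.aemeasurable hcover
  have : StandardBorelSpace Λ := inferInstance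
  have : Countable {g // g ∈ U} := inferInstance
  have : StandardBorelSpace ({g // g ∈ U} → Λ) := inferInstance
  have : StandardBorelSpace (G → {g // g ∈ U} → Λ) := inferInstance
  have : StandardBorelSpace (G → Fin (m + 1)) := inferInstance
  have hiso := isMeasIsoG_map (μ := ηbar) (S := fun g : G => Prod.map (gShift g) (gShift g))
    (T := prodAct ({g // g ∈ U} → Λ) gShift)
    (f := fun z => (z.1, tileLabel S U z.1 z.2)) (f' := fun z => (z.1, unlabel S U z.1 z.2))
    (measurable_fst.prodMk (measurable_tileLabel S U))
    (measurable_fst.prodMk (measurable_unlabel S U))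
    (fun g z => Prod.ext rfl (tileLabel_shift S U z.1 z.2 g))
    (hcover'.mono fun z hz => Prod.ext rfl (unlabel_tileLabel S U hz z.2))
  rw [hlaw] at hiso
  obtain ⟨n, p, ρ, hp, hρ, hj⟩ := isBernoulliG_envMeasure hτ (measurable_pi_apply (1 : G)) P hBern
  exact ⟨n, p, ρ, hp, hρ, hiso.trans hj⟩
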